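/- Fix integers m,n ≥ 1 and a real number 1 ≤ p < n+1. There is a constant C > 0 depending only on m, n and p with the following property: for every compact set Z ⊂ ℝ^m, every bounded domain (open connected set) Ω ⊂ ℝ^m with Z ⊂ Ω, every L ≥ 0, and every L-Lipschitz map f : Z → ℍⁿ (Lipschitz from the Euclidean metric on Z to the Carnot–Carathéodory metric on ℍⁿ), there exists a map F : Ω → ℍⁿ in the class W^{1,p}(Ω,ℍⁿ) with F(x) = f(x) for all x ∈ Z; moreover, writing F = (F_1,…,F_{2n+1}), the weak partial derivatives satisfy ‖∂F_j/∂x_k‖_{L^p(Ω)} ≤ C·L·(diam Ω)^{m/p} for all k = 1,…,m and j = 1,…,2n. -/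

import Mathlib

open MeasureTheory Metric Set
noncomputable section

/-- `Euc d` is `ℝ^d` with the Euclidean metric. -/
abbrev Euc (d : ℕ) := EuclideanSpace ℝ (Fin d)

/-- The index of the coordinate `x_j` in `ℍⁿ = ℝ^{2n+1}`. -/
def xIdx (n : ℕ) (j : Fin n) : Fin (2*n+1) := ⟨2*(j:ℕ), by have := j.isLt; omega⟩

/-- The index of the coordinate `y_j` in `ℍⁿ = ℝ^{2n+1}`. -/
def yIdx (n : ℕ) (j : Fin n) : Fin (2*n+1) := ⟨2*(j:ℕ)+1, by have := j.isLt; omega⟩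

/-- The index of the coordinate `t` in `ℍⁿ = ℝ^{2n+1}`. -/
def tIdx (n : ℕ) : Fin (2*n+1) := ⟨2*n, by omega⟩

/-- `γ` is an absolutely continuous curve on `[a,b]` with a.e. derivative `g`
(each component is the integral of the corresponding component of `g`), which is
horizontal: the derivative of the `t`-component satisfies the contact condition. -/
def IsHorizontalWith (n : ℕ) (a b : ℝ) (γ g : ℝ → Euc (2*n+1)) : Prop :=
  (∀ i, IntervalIntegrable (fun s => g s i) volume a b) ∧
  (∀ i, ∀ x ∈ Set.Icc a b, γ x i = γ a i + ∫ s in a..x, g s i) ∧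
  (∀ᵐ s ∂(volume.restrict (Set.Icc a b)),
    g s (tIdx n) = 2 * ∑ j : Fin n,
      (γ s (yIdx n j) * g s (xIdx n j) - γ s (xIdx n j) * g s (yIdx n j)))

/-- The horizontal length of a horizontal curve with a.e. derivative `g`:
the Euclidean length of the projection to `ℝ^{2n}`. -/
def horizLength (n : ℕ) (a b : ℝ) (g : ℝ → Euc (2*n+1)) : ℝ :=
  ∫ s in a..b, Real.sqrt (∑ j : Fin n, ((g s (xIdx n j))^2 + (g s (yIdx n j))^2))

/-- The Carnot–Carathéodory distance on `ℍⁿ`. -/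
def ccDist (n : ℕ) (p q : Euc (2*n+1)) : ℝ :=
  sInf { ℓ : ℝ | ∃ a b γ g, a ≤ b ∧ IsHorizontalWith n a b γ g ∧
    γ a = p ∧ γ b = q ∧ ℓ = horizLength n a b g }

/-- `f` is `L`-Lipschitz on `Z` as a map into `ℍⁿ` with the Carnot–Carathéodory metric. -/
def LipschitzOnCC (m n : ℕ) (L : ℝ) (Z : Set (Euc m)) (f : Euc m → Euc (2*n+1)) : Prop :=
  ∀ x ∈ Z, ∀ y ∈ Z, ccDist n (f x) (f y) ≤ L * dist x y

/-- `v` represents the distributional partial derivative `∂u/∂x_k` on `Ω`. -/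
def IsWeakPartialDeriv (m : ℕ) (Ω : Set (Euc m)) (u : Euc m → ℝ) (k : Fin m)
    (v : Euc m → ℝ) : Prop :=
  ∀ φ : Euc m → ℝ, ContDiff ℝ (⊤ : ℕ∞) φ → HasCompactSupport φ → tsupport φ ⊆ Ω →
    ∫ x in Ω, u x * fderiv ℝ φ x (EuclideanSpace.single k 1) = - ∫ x in Ω, v x * φ x

/-- `u ∈ L^p(Ω)`. -/
def MemLpOn (m : ℕ) (p : ℝ) (Ω : Set (Euc m)) (u : Euc m → ℝ) : Prop :=
  MemLp u (ENNReal.ofReal p) (volume.restrict Ω)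

/-- `u ∈ W^{1,p}(Ω)` with weak partial derivatives `v k = ∂u/∂x_k ∈ L^p(Ω)`. -/
def MemW1pWith (m : ℕ) (p : ℝ) (Ω : Set (Euc m)) (u : Euc m → ℝ)
    (v : Fin m → Euc m → ℝ) : Prop :=
  MemLpOn m p Ω u ∧ ∀ k, MemLpOn m p Ω (v k) ∧ IsWeakPartialDeriv m Ω u k (v k)

/-- The weak contact equation holds a.e. on `Ω` for `F` with weak partial
derivatives `v i k = ∂F_i/∂x_k`. -/
def ContactAEOn (m n : ℕ) (Ω : Set (Euc m)) (F : Euc m → Euc (2*n+1))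
    (v : Fin (2*n+1) → Fin m → Euc m → ℝ) : Prop :=
  ∀ᵐ x ∂(volume.restrict Ω), ∀ k : Fin m,
    v (tIdx n) k x = 2 * ∑ j : Fin n,
      (F x (yIdx n j) * v (xIdx n j) k x - F x (xIdx n j) * v (yIdx n j) k x)

/-- `F ∈ W^{1,p}(Ω,ℍⁿ)` with weak partial derivatives `v`:
all components belong to `W^{1,p}(Ω)` and the weak contact equation holds a.e. -/
def MemW1pHeisWith (m n : ℕ) (p : ℝ) (Ω : Set (Euc m)) (F : Euc m → Euc (2*n+1))
    (v : Fin (2*n+1) → Fin m → Euc m → ℝ) : Prop :=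
  (∀ i, MemW1pWith m p Ω (fun x => F x i) (fun k => v i k)) ∧ ContactAEOn m n Ω F v

section CarnotCaratheodory

variable {n : ℕ}

lemma xIdx_ne_tIdx (j : Fin n) : xIdx n j ≠ tIdx n := by
  intro h; have := congrArg Fin.val h; simp only [xIdx, tIdx] at this; omega

lemma yIdx_ne_tIdx (j : Fin n) : yIdx n j ≠ tIdx n := by
  intro h; have := congrArg Fin.val h; simp only [yIdx, tIdx] at this; omega

lemma xIdx_ne_yIdx (j j' : Fin n) : xIdx n j ≠ yIdx n j' := by
  intro h; have := congrArg Fin.val h; simp only [xIdx, yIdx] at this; omega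

lemma xIdx_injective : Function.Injective (xIdx n) := by
  intro j j' h; have := congrArg Fin.val h; simp only [xIdx] at this; ext; omega

lemma yIdx_injective : Function.Injective (yIdx n) := by
  intro j j' h; have := congrArg Fin.val h; simp only [yIdx] at this; ext; omega

lemma eq_xIdx_or_yIdx_or_tIdx (i : Fin (2 * n + 1)) :
    (∃ j, i = xIdx n j) ∨ (∃ j, i = yIdx n j) ∨ i = tIdx n := by
  rcases Nat.even_or_odd' (i : ℕ) with ⟨c, hc | hc⟩
  · by_cases h : c < n
    · exact Or.inl ⟨⟨c, h⟩, by ext; simp [xIdx, hc]⟩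
    · right; right; ext; simp only [tIdx]; have := i.isLt; omega
  · have := i.isLt
    exact Or.inr (Or.inl ⟨⟨c, by omega⟩, by ext; simp [yIdx, hc]⟩)

/-- Any two points of `ℍⁿ` are joined by a (polynomial) horizontal curve. -/
lemma exists_isHorizontalWith (hn : 1 ≤ n) (p q : Euc (2 * n + 1)) :
    ∃ a b γ g, a ≤ b ∧ IsHorizontalWith n a b γ g ∧ γ a = p ∧ γ b = q := by
  classical
  let j₀ : Fin n := ⟨0, hn⟩
  -- the horizontal coordinates of the curve and of its derivative
  let c : ℝ → ℝ → Fin (2 * n + 1) → ℝ := fun B s i =>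
    p i + s * (q i - p i) + (if i = xIdx n j₀ then s - s ^ 2 else 0)
      + B * (if i = yIdx n j₀ then s - 3 * s ^ 2 + 2 * s ^ 3 else 0)
  let c' : ℝ → ℝ → Fin (2 * n + 1) → ℝ := fun B s i =>
    (q i - p i) + (if i = xIdx n j₀ then 1 - 2 * s else 0)
      + B * (if i = yIdx n j₀ then 1 - 6 * s + 6 * s ^ 2 else 0)
  let W : ℝ → ℝ → ℝ := fun B s => 2 * ∑ j : Fin n,
      (c B s (yIdx n j) * c' B s (xIdx n j) - c B s (xIdx n j) * c' B s (yIdx n j))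
  have hcont : ∀ B i, Continuous fun s => c B s i := by
    intro B i; simp only [c]; split_ifs <;> fun_prop
  have hcont' : ∀ B i, Continuous fun s => c' B s i := by
    intro B i; simp only [c']; split_ifs <;> fun_prop
  have hW : ∀ B, Continuous (W B) := by
    intro B
    refine continuous_const.mul (continuous_finsetSum _ fun j _ => ?_)
    exact ((hcont B _).mul (hcont' B _)).sub ((hcont B _).mul (hcont' B _))
  let h : ℝ → ℝ := fun s =>
    (s - 3 * s ^ 2 + 2 * s ^ 3) * ((q (xIdx n j₀) - p (xIdx n j₀)) + (1 - 2 * s))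
      - (p (xIdx n j₀) + s * (q (xIdx n j₀) - p (xIdx n j₀)) + (s - s ^ 2))
        * (1 - 6 * s + 6 * s ^ 2)
  have hWB : ∀ B s, W B s = W 0 s + (2 * B) * h s := by
    intro B s
    have key : ∀ j : Fin n,
        c B s (yIdx n j) * c' B s (xIdx n j) - c B s (xIdx n j) * c' B s (yIdx n j)
        = (c 0 s (yIdx n j) * c' 0 s (xIdx n j) - c 0 s (xIdx n j) * c' 0 s (yIdx n j))
          + if j = j₀ then B * h s else 0 := by
      intro j
      by_cases hj : j = j₀
      · subst hj
        simp only [c, c', h, if_true, xIdx_ne_yIdx, (xIdx_ne_yIdx _ _).symm, if_false]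
        ring
      · have h1 : xIdx n j ≠ xIdx n j₀ := fun e => hj (xIdx_injective e)
        have h2 : yIdx n j ≠ yIdx n j₀ := fun e => hj (yIdx_injective e)
        simp only [c, c', hj, h1, h2, xIdx_ne_yIdx, (xIdx_ne_yIdx _ _).symm, if_false]
        ring
    simp only [W, key, Finset.sum_add_distrib, Finset.sum_ite_eq', Finset.mem_univ, if_true]
    ring
  have hh : ∫ s in (0:ℝ)..1, h s = 1 / 15 := by
    set d := q (xIdx n j₀) - p (xIdx n j₀) with hd
    set x₀ := p (xIdx n j₀) with hx₀
    have := intervalIntegral.integral_eq_sub_of_hasDerivAt (a := 0) (b := 1)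
      (f := fun s : ℝ => (2 / 3) * s ^ 3 - s ^ 4 + (2 / 5) * s ^ 5
        + d * (s ^ 2 / 2 - s ^ 3 + s ^ 4 / 2) - x₀ * (s - 3 * s ^ 2 + 2 * s ^ 3)
        - d * (s ^ 2 / 2 - 2 * s ^ 3 + (3 / 2) * s ^ 4)) (f' := h) ?_ ?_
    · rw [this]; norm_num
    · intro s _
      have e : ∀ k : ℕ, HasDerivAt (fun s : ℝ => s ^ (k + 1)) ((k + 1 : ℕ) * s ^ k) s := by
        intro k; simpa using hasDerivAt_pow (k + 1) s
      have e1 : HasDerivAt (fun s : ℝ => s) 1 s := hasDerivAt_id s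
      have e2 := e 1
      have e3 := e 2
      have e4 := e 3
      have e5 := e 4
      norm_num at e2 e3 e4 e5
      refine HasDerivAt.congr_deriv ((((((e3.const_mul (2/3)).sub e4).add (e5.const_mul (2/5))).add
        ((((e2.div_const 2).sub e3).add (e4.div_const 2)).const_mul d)).sub
        (((e1.sub (e2.const_mul 3)).add (e3.const_mul 2)).const_mul x₀)).sub
        ((((e2.div_const 2).sub (e3.const_mul 2)).add (e4.const_mul (3/2))).const_mul d)) ?_
      simp only [h]; ring
    · exact (by simp only [h]; fun_prop : Continuous h).intervalIntegrable _ _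
  obtain ⟨B, hB⟩ : ∃ B, p (tIdx n) + ∫ s in (0:ℝ)..1, W B s = q (tIdx n) := by
    refine ⟨(q (tIdx n) - p (tIdx n) - ∫ s in (0:ℝ)..1, W 0 s) * (15 / 2), ?_⟩
    have hhc : Continuous h := by simp only [h]; fun_prop
    have key : ∀ B, ∫ s in (0:ℝ)..1, W B s = (∫ s in (0:ℝ)..1, W 0 s) + 2 * B * (1 / 15) := by
      intro B
      rw [← hh, ← intervalIntegral.integral_const_mul (2 * B) h, ← intervalIntegral.integral_add
        ((hW 0).intervalIntegrable _ _) ((hhc.const_mul _).intervalIntegrable _ _)]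
      exact intervalIntegral.integral_congr fun s _ => hWB B s
    rw [key]
    ring
  let γ : ℝ → Euc (2 * n + 1) := fun s => WithLp.toLp 2 fun i =>
    if i = tIdx n then p (tIdx n) + ∫ r in (0:ℝ)..s, W B r else c B s i
  let g : ℝ → Euc (2 * n + 1) := fun s => WithLp.toLp 2 fun i =>
    if i = tIdx n then W B s else c' B s i
  have hγ0 : γ 0 = p := by
    ext i; simp only [γ]; split_ifs with hi
    · simp [hi]
    · simp [c]
  have hγ1 : γ 1 = q := by
    ext i; simp only [γ]; split_ifs with hi
    · rw [hB, hi]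
    · simp [c]; norm_num
  refine ⟨0, 1, γ, g, zero_le_one, ⟨?_, ?_, ?_⟩, hγ0, hγ1⟩
  · intro i
    by_cases hi : i = tIdx n
    · simpa only [g, hi, if_true] using (hW B).intervalIntegrable 0 1
    · simpa only [g, hi, if_false] using (hcont' B i).intervalIntegrable 0 1
  · intro i x _
    by_cases hi : i = tIdx n
    · simp [γ, g, hi]
    · simp only [γ, g, hi, if_false]
      rw [intervalIntegral.integral_eq_sub_of_hasDerivAt (f := fun s => c B s i)
        _ ((hcont' B i).intervalIntegrable _ _)]
      · ring
      · intro s _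
        have e1 : HasDerivAt (fun s : ℝ => s) 1 s := hasDerivAt_id s
        have e2 : HasDerivAt (fun s : ℝ => s ^ 2) (2 * s) s := by simpa using hasDerivAt_pow 2 s
        have e3 : HasDerivAt (fun s : ℝ => s ^ 3) (3 * s ^ 2) s := by
          simpa using hasDerivAt_pow 3 s
        have f1 : HasDerivAt (fun s : ℝ => if i = xIdx n j₀ then s - s ^ 2 else 0)
            (if i = xIdx n j₀ then 1 - 2 * s else 0) s := by
          split_ifs
          · exact e1.sub e2
          · exact hasDerivAt_const _ _
        have f2 : HasDerivAt
            (fun s : ℝ => if i = yIdx n j₀ then s - 3 * s ^ 2 + 2 * s ^ 3 else 0)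
            (if i = yIdx n j₀ then 1 - 6 * s + 6 * s ^ 2 else 0) s := by
          split_ifs
          · exact ((e1.sub (e2.const_mul 3)).add (e3.const_mul 2)).congr_deriv (by ring)
          · exact hasDerivAt_const _ _
        exact ((((e1.mul_const (q i - p i)).const_add (p i)).add f1).add
          (f2.const_mul B)).congr_deriv (by simp only [c']; ring)
  · refine Filter.Eventually.of_forall fun s => ?_
    simp only [γ, g, if_true, xIdx_ne_tIdx, yIdx_ne_tIdx, if_false]
    rfl

lemma IsHorizontalWith.bounds {a b : ℝ} {γ g : ℝ → Euc (2 * n + 1)} (hab : a ≤ b)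
    (h : IsHorizontalWith n a b γ g) :
    (∀ j, |γ b (xIdx n j) - γ a (xIdx n j)| ≤ horizLength n a b g) ∧
    (∀ j, |γ b (yIdx n j) - γ a (yIdx n j)| ≤ horizLength n a b g) ∧
    |γ b (tIdx n) - γ a (tIdx n) - 2 * ∑ j : Fin n,
      (γ a (yIdx n j) * γ b (xIdx n j) - γ a (xIdx n j) * γ b (yIdx n j))|
      ≤ 4 * n * (horizLength n a b g) ^ 2 := by
  obtain ⟨hint, hγ, hcon⟩ := h
  set ℓ := horizLength n a b g with hℓ
  let S : ℝ → ℝ := fun s => Real.sqrt (∑ j : Fin n, ((g s (xIdx n j))^2 + (g s (yIdx n j))^2))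
  have hSx : ∀ s j, |g s (xIdx n j)| ≤ S s := by
    intro s j
    apply Real.abs_le_sqrt
    refine le_trans ?_ (Finset.single_le_sum
      (f := fun j => (g s (xIdx n j))^2 + (g s (yIdx n j))^2)
      (fun j _ => by positivity) (Finset.mem_univ j))
    nlinarith [sq_nonneg (g s (yIdx n j))]
  have hSy : ∀ s j, |g s (yIdx n j)| ≤ S s := by
    intro s j
    apply Real.abs_le_sqrt
    refine le_trans ?_ (Finset.single_le_sum
      (f := fun j => (g s (xIdx n j))^2 + (g s (yIdx n j))^2)
      (fun j _ => by positivity) (Finset.mem_univ j))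
    nlinarith [sq_nonneg (g s (xIdx n j))]
  have hS0 : ∀ s, 0 ≤ S s := fun s => Real.sqrt_nonneg _
  have hSle : ∀ s, S s ≤ ∑ j : Fin n, (|g s (xIdx n j)| + |g s (yIdx n j)|) := by
    intro s
    have h0 : 0 ≤ ∑ j : Fin n, (|g s (xIdx n j)| + |g s (yIdx n j)|) :=
      Finset.sum_nonneg fun j _ => by positivity
    rw [Real.sqrt_le_left h0]
    calc ∑ j : Fin n, ((g s (xIdx n j))^2 + (g s (yIdx n j))^2)
        ≤ ∑ j : Fin n, (|g s (xIdx n j)| + |g s (yIdx n j)|) ^ 2 := by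
          refine Finset.sum_le_sum fun j _ => ?_
          have := abs_nonneg (g s (xIdx n j)); have := abs_nonneg (g s (yIdx n j))
          nlinarith [sq_abs (g s (xIdx n j)), sq_abs (g s (yIdx n j)), mul_nonneg
            (abs_nonneg (g s (xIdx n j))) (abs_nonneg (g s (yIdx n j)))]
      _ ≤ _ := Finset.sum_sq_le_sq_sum_of_nonneg fun j _ => by positivity
  have hS : IntervalIntegrable S volume a b := by
    have hdom : IntervalIntegrable
        (fun s => ∑ j : Fin n, (|g s (xIdx n j)| + |g s (yIdx n j)|)) volume a b := by
      simpa only [Finset.sum_fn] using IntervalIntegrable.sum Finset.univ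
        (f := fun j s => |g s (xIdx n j)| + |g s (yIdx n j)|)
        fun j _ => (hint _).abs.add (hint _).abs
    refine hdom.mono_fun ?_ ?_
    · have hm : ∀ i, AEMeasurable (fun s => g s i) (volume.restrict (Set.uIoc a b)) := fun i =>
        ((intervalIntegrable_iff.1 (hint i)).aestronglyMeasurable).aemeasurable
      exact (Finset.aemeasurable_fun_sum (s := Finset.univ) (fun j _ =>
        ((hm (xIdx n j)).pow_const 2).add ((hm (yIdx n j)).pow_const 2))).sqrt.aestronglyMeasurable
    · refine Filter.Eventually.of_forall fun s => ?_
      simp only [Real.norm_eq_abs]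
      rw [abs_of_nonneg (hS0 s)]
      exact (hSle s).trans (le_abs_self _)
  have hℓS : ℓ = ∫ s in a..b, S s := rfl
  have hℓ0 : 0 ≤ ℓ := intervalIntegral.integral_nonneg hab fun s _ => hS0 s
  have hsub : ∀ s ∈ Icc a b, Set.uIcc a s ⊆ Set.uIcc a b := fun s hs =>
    Set.uIcc_subset_uIcc Set.left_mem_uIcc (by rw [Set.uIcc_of_le hab]; exact hs)
  have hmove : ∀ i, (∀ s, |g s i| ≤ S s) → ∀ s ∈ Icc a b, |γ s i - γ a i| ≤ ℓ := by
    intro i hi s hs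
    rw [hγ i s hs, add_sub_cancel_left]
    calc |∫ r in a..s, g r i| ≤ ∫ r in a..s, |g r i| :=
          intervalIntegral.abs_integral_le_integral_abs hs.1
      _ ≤ ∫ r in a..s, S r := intervalIntegral.integral_mono_on hs.1
          ((hint i).abs.mono_set (hsub s hs)) (hS.mono_set (hsub s hs)) fun r _ => hi r
      _ ≤ ∫ r in a..b, S r := intervalIntegral.integral_mono_interval le_rfl hs.1 hs.2
          (Filter.Eventually.of_forall hS0) hS
  have hb : b ∈ Icc a b := ⟨hab, le_rfl⟩
  have hx := fun j => hmove (xIdx n j) (fun s => hSx s j)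
  have hy := fun j => hmove (yIdx n j) (fun s => hSy s j)
  refine ⟨fun j => hx j b hb, fun j => hy j b hb, ?_⟩
  have hI : ∀ i, γ b i - γ a i = ∫ r in a..b, g r i := by
    intro i; rw [hγ i b hb]; ring
  have key : γ b (tIdx n) - γ a (tIdx n) - 2 * ∑ j : Fin n,
      (γ a (yIdx n j) * γ b (xIdx n j) - γ a (xIdx n j) * γ b (yIdx n j))
      = ∫ r in a..b, (g r (tIdx n) - 2 * ∑ j : Fin n,
        (γ a (yIdx n j) * g r (xIdx n j) - γ a (xIdx n j) * g r (yIdx n j))) := by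
    have h1 : ∀ j : Fin n, IntervalIntegrable (fun r => γ a (yIdx n j) * g r (xIdx n j)
        - γ a (xIdx n j) * g r (yIdx n j)) volume a b := fun j =>
      ((hint _).const_mul _).sub ((hint _).const_mul _)
    have h2 : IntervalIntegrable (fun r => ∑ j : Fin n, (γ a (yIdx n j) * g r (xIdx n j)
        - γ a (xIdx n j) * g r (yIdx n j))) volume a b := by
      simpa only [Finset.sum_fn] using IntervalIntegrable.sum Finset.univ (fun j _ => h1 j)
    rw [intervalIntegral.integral_sub (hint _) (h2.const_mul 2),
      intervalIntegral.integral_const_mul,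
      intervalIntegral.integral_finsetSum (fun j _ => h1 j), ← hI]
    congr 2
    refine Finset.sum_congr rfl fun j _ => ?_
    rw [intervalIntegral.integral_sub ((hint _).const_mul _) ((hint _).const_mul _),
      intervalIntegral.integral_const_mul, intervalIntegral.integral_const_mul, ← hI, ← hI]
    ring
  rw [key]
  have hbound : ∀ᵐ r ∂volume, r ∈ Set.Ioc a b → ‖g r (tIdx n) - 2 * ∑ j : Fin n,
        (γ a (yIdx n j) * g r (xIdx n j) - γ a (xIdx n j) * g r (yIdx n j))‖
        ≤ 4 * n * ℓ * S r := by
    rw [ae_restrict_iff' measurableSet_Icc] at hcon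
    filter_upwards [hcon] with r hr hr'
    have hrI : r ∈ Icc a b := ⟨hr'.1.le, hr'.2⟩
    rw [hr hrI, ← mul_sub, ← Finset.sum_sub_distrib, Real.norm_eq_abs, abs_mul]
    have : |∑ j : Fin n, (γ r (yIdx n j) * g r (xIdx n j) - γ r (xIdx n j) * g r (yIdx n j)
        - (γ a (yIdx n j) * g r (xIdx n j) - γ a (xIdx n j) * g r (yIdx n j)))|
        ≤ ∑ _j : Fin n, 2 * (ℓ * S r) := by
      refine (Finset.abs_sum_le_sum_abs _ _).trans (Finset.sum_le_sum fun j _ => ?_)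
      have e : γ r (yIdx n j) * g r (xIdx n j) - γ r (xIdx n j) * g r (yIdx n j)
        - (γ a (yIdx n j) * g r (xIdx n j) - γ a (xIdx n j) * g r (yIdx n j))
        = (γ r (yIdx n j) - γ a (yIdx n j)) * g r (xIdx n j)
          - (γ r (xIdx n j) - γ a (xIdx n j)) * g r (yIdx n j) := by ring
      rw [e]
      refine (abs_sub _ _).trans ?_
      rw [abs_mul, abs_mul]
      have := mul_le_mul (hy j r hrI) (hSx r j) (abs_nonneg _) hℓ0
      have := mul_le_mul (hx j r hrI) (hSy r j) (abs_nonneg _) hℓ0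
      linarith
    simp only [Finset.sum_const, Finset.card_univ, Fintype.card_fin, nsmul_eq_mul] at this
    rw [abs_two]
    nlinarith
  calc |∫ r in a..b, (g r (tIdx n) - 2 * ∑ j : Fin n,
        (γ a (yIdx n j) * g r (xIdx n j) - γ a (xIdx n j) * g r (yIdx n j)))|
      ≤ ∫ r in a..b, 4 * n * ℓ * S r :=
        intervalIntegral.norm_integral_le_of_norm_le hab hbound (hS.const_mul _)
    _ = 4 * n * ℓ ^ 2 := by rw [intervalIntegral.integral_const_mul, ← hℓS]; ring

/-- Coordinate bounds in terms of the Carnot–Carathéodory distance. -/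
lemma bounds_of_ccDist_le (hn : 1 ≤ n) {p q : Euc (2 * n + 1)} {D : ℝ} (hD : ccDist n p q ≤ D) :
    (∀ j, |q (xIdx n j) - p (xIdx n j)| ≤ D) ∧
    (∀ j, |q (yIdx n j) - p (yIdx n j)| ≤ D) ∧
    |q (tIdx n) - p (tIdx n) - 2 * ∑ j : Fin n,
      (p (yIdx n j) * q (xIdx n j) - p (xIdx n j) * q (yIdx n j))| ≤ 4 * n * D ^ 2 := by
  have key : ∀ ε > 0, ∃ ℓ < D + ε,
      (∀ j, |q (xIdx n j) - p (xIdx n j)| ≤ ℓ) ∧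
      (∀ j, |q (yIdx n j) - p (yIdx n j)| ≤ ℓ) ∧
      |q (tIdx n) - p (tIdx n) - 2 * ∑ j : Fin n,
        (p (yIdx n j) * q (xIdx n j) - p (xIdx n j) * q (yIdx n j))| ≤ 4 * n * ℓ ^ 2 := by
    intro ε hε
    obtain ⟨a, b, γ, g, hab, hγ, ha, hb⟩ := exists_isHorizontalWith hn p q
    obtain ⟨ℓ, ⟨a, b, γ, g, hab, hγ, ha, hb, rfl⟩, hlt⟩ := exists_lt_of_csInf_lt
      (⟨_, a, b, γ, g, hab, hγ, ha, hb, rfl⟩ : { ℓ : ℝ | ∃ a b γ g, a ≤ b ∧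
        IsHorizontalWith n a b γ g ∧ γ a = p ∧ γ b = q ∧ ℓ = horizLength n a b g }.Nonempty)
      (lt_of_le_of_lt hD (lt_add_of_pos_right D hε))
    refine ⟨_, hlt, ?_⟩
    have := hγ.bounds hab
    rwa [ha, hb] at this
  refine ⟨fun j => ?_, fun j => ?_, ?_⟩
  · refine le_of_forall_pos_le_add fun ε hε => ?_
    obtain ⟨ℓ, hℓ, h1, -, -⟩ := key ε hε
    exact (h1 j).trans hℓ.le
  · refine le_of_forall_pos_le_add fun ε hε => ?_
    obtain ⟨ℓ, hℓ, -, h1, -⟩ := key ε hε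
    exact (h1 j).trans hℓ.le
  · have hlim : Filter.Tendsto (fun ε : ℝ => 4 * n * (D + ε) ^ 2) (nhdsWithin 0 (Ioi 0))
        (nhds (4 * n * D ^ 2)) := by
      have : Continuous fun ε : ℝ => 4 * n * (D + ε) ^ 2 := by fun_prop
      simpa using (this.tendsto 0).mono_left nhdsWithin_le_nhds
    refine ge_of_tendsto hlim ?_
    filter_upwards [self_mem_nhdsWithin] with ε hε
    obtain ⟨ℓ, hℓ, h1, -, h3⟩ := key ε hε
    have h0 : 0 ≤ ℓ := (abs_nonneg _).trans (h1 ⟨0, hn⟩)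
    refine h3.trans ?_
    gcongr

end CarnotCaratheodory

section OrderStatistics

variable {ι : Type*}

/-- The `(k+1)`-st largest value of a family of nonnegative numbers. -/
def ordStat (k : ℕ) (a : ι → ℝ) : ℝ := sInf {t : ℝ | 0 ≤ t ∧ {i | t < a i}.encard ≤ k}

lemma ordStat_bddBelow (k : ℕ) (a : ι → ℝ) :
    BddBelow {t : ℝ | 0 ≤ t ∧ {i | t < a i}.encard ≤ k} := ⟨0, fun _ h => h.1⟩

lemma ordStat_nonneg (k : ℕ) (a : ι → ℝ) : 0 ≤ ordStat k a :=
  Real.sInf_nonneg fun _ h => h.1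

lemma ordStat_le {k : ℕ} {a : ι → ℝ} {t : ℝ} (ht : 0 ≤ t) (h : {i | t < a i}.encard ≤ k) :
    ordStat k a ≤ t := csInf_le (ordStat_bddBelow k a) ⟨ht, h⟩

variable {a a' : ι → ℝ} {B : ℝ}

lemma ordStat_nonempty (k : ℕ) (hB : 0 ≤ B) (ha : ∀ i, a i ≤ B) :
    {t : ℝ | 0 ≤ t ∧ {i | t < a i}.encard ≤ k}.Nonempty := by
  refine ⟨B, hB, ?_⟩
  have : {i | B < a i} = ∅ := by ext i; simpa using ha i
  simp [this]

lemma encard_ordStat_lt (k : ℕ) (hB : 0 ≤ B) (ha : ∀ i, a i ≤ B) :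
    {i | ordStat k a < a i}.encard ≤ k := by
  by_contra! hcon
  have h1 : ((k + 1 : ℕ) : ℕ∞) ≤ {i | ordStat k a < a i}.encard := by
    have := Order.add_one_le_of_lt hcon; exact_mod_cast this
  obtain ⟨s, hs, hcard⟩ := Set.exists_subset_encard_eq h1
  have hfin : s.Finite := Set.finite_of_encard_eq_coe hcard
  have hne : s.Nonempty := by
    rw [← Set.encard_pos, hcard]; exact_mod_cast Nat.succ_pos k
  obtain ⟨i₀, hi₀, hmin⟩ := Set.exists_min_image s a hfin hne
  obtain ⟨t, ⟨ht0, htk⟩, hlt⟩ := exists_lt_of_csInf_lt (ordStat_nonempty k hB ha) (hs hi₀)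
  have : s ⊆ {i | t < a i} := fun i hi => lt_of_lt_of_le hlt (hmin i hi)
  have h2 := (Set.encard_le_encard this).trans htk
  rw [hcard] at h2
  have : k + 1 ≤ k := by exact_mod_cast h2
  omega

lemma ordStat_le_add {δ : ℝ} (k : ℕ) (hB : 0 ≤ B) (ha : ∀ i, a i ≤ B)
    (hδ : ∀ i, |a i - a' i| ≤ δ) (hδ0 : 0 ≤ δ) : ordStat k a' ≤ ordStat k a + δ := by
  refine ordStat_le (add_nonneg (ordStat_nonneg _ _) hδ0) ?_
  refine (Set.encard_le_encard ?_).trans (encard_ordStat_lt k hB ha)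
  intro i hi
  have := (abs_le.1 (hδ i)).1
  simp only [mem_ofPred_eq] at hi ⊢
  linarith

lemma abs_ordStat_sub_le {δ : ℝ} (k : ℕ) (hB : 0 ≤ B) (ha : ∀ i, a i ≤ B) (ha' : ∀ i, a' i ≤ B)
    (hδ : ∀ i, |a i - a' i| ≤ δ) (hδ0 : 0 ≤ δ) : |ordStat k a - ordStat k a'| ≤ δ := by
  have h1 := ordStat_le_add k hB ha hδ hδ0
  have h2 := ordStat_le_add k hB ha' (fun i => by rw [abs_sub_comm]; exact hδ i) hδ0
  rw [abs_le]; constructor <;> linarith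

lemma le_ordStat_zero (hB : 0 ≤ B) (ha : ∀ i, a i ≤ B) (i : ι) : a i ≤ ordStat 0 a := by
  by_contra! h
  have := encard_ordStat_lt 0 hB ha
  simp only [Nat.cast_zero, nonpos_iff_eq_zero, Set.encard_eq_zero] at this
  exact (this ▸ (h : i ∈ {i | ordStat 0 a < a i}) : i ∈ (∅ : Set ι))

lemma ordStat_le_zero (k : ℕ) (hB : 0 ≤ B) (ha : ∀ i, a i ≤ B) : ordStat k a ≤ ordStat 0 a :=
  ordStat_le (ordStat_nonneg _ _) ((encard_ordStat_lt 0 hB ha).trans (by simp))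

lemma exists_card_ordStat_le {k : ℕ} (hpos : 0 < ordStat k a) (hfin : {i | 0 < a i}.Finite) :
    ∃ J : Finset ι, J.card = k + 1 ∧ ∀ i ∈ J, ordStat k a ≤ a i := by
  classical
  set s := ordStat k a with hs
  by_contra! hcon
  have hS : {i | s ≤ a i}.encard ≤ k := by
    by_contra! h
    have h1 : ((k + 1 : ℕ) : ℕ∞) ≤ {i | s ≤ a i}.encard := by
      have := Order.add_one_le_of_lt h; exact_mod_cast this
    obtain ⟨J, hJ, hcard⟩ := Set.exists_subset_encard_eq h1
    have hfinJ : J.Finite := Set.finite_of_encard_eq_coe hcard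
    obtain ⟨i, hi, hlt⟩ := hcon hfinJ.toFinset (by
      rw [hfinJ.encard_eq_coe_toFinset_card] at hcard; exact_mod_cast hcard)
    exact absurd (hJ (hfinJ.mem_toFinset.1 hi)) (not_le.2 hlt)
  obtain ⟨t, ht0, hts, ht⟩ : ∃ t, 0 ≤ t ∧ t < s ∧ ∀ i, a i < s → a i ≤ t := by
    by_cases hne : {i | 0 < a i ∧ a i < s}.Nonempty
    · obtain ⟨i, hi, hmax⟩ := Set.exists_max_image _ a (hfin.subset fun i hi => hi.1) hne
      refine ⟨a i, hi.1.le, hi.2, fun j hj => ?_⟩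
      by_cases h0 : 0 < a j
      · exact hmax j ⟨h0, hj⟩
      · exact (not_lt.1 h0).trans hi.1.le
    · refine ⟨0, le_rfl, hpos, fun j hj => ?_⟩
      by_contra! h0
      exact hne ⟨j, h0, hj⟩
  refine absurd (ordStat_le (k := k) (a := a) ht0 ((Set.encard_le_encard ?_).trans hS))
    (not_le.2 hts)
  intro i hi
  by_contra! h
  simp only [mem_ofPred_eq, not_le] at h hi
  exact absurd (ht i h) (not_le.2 hi)

end OrderStatistics

section Weights

variable {ι : Type*}

/-- The difference between the largest and the `(k+1)`-st largest value. -/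
def gapStat (k : ℕ) (a : ι → ℝ) : ℝ := ordStat 0 a - ordStat k a

/-- The normalised excess over the `(k+1)`-st largest value. -/
def nuW (k : ℕ) (ε : ℝ) (a : ι → ℝ) (i : ι) : ℝ :=
  max 0 (a i - ordStat k a) / max (gapStat k a) ε

variable {a a' : ι → ℝ} {B ε : ℝ} {k : ℕ}

lemma gapStat_nonneg (hB : 0 ≤ B) (ha : ∀ i, a i ≤ B) : 0 ≤ gapStat k a :=
  sub_nonneg.2 (ordStat_le_zero k hB ha)

lemma nuW_nonneg (hε : 0 < ε) (i : ι) : 0 ≤ nuW k ε a i :=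
  div_nonneg (le_max_left _ _) (hε.le.trans (le_max_right _ _))

lemma lt_of_nuW_pos {i : ι} (h : 0 < nuW k ε a i) : ordStat k a < a i := by
  by_contra! h'
  rw [nuW, max_eq_left (by linarith), zero_div] at h
  exact lt_irrefl _ h

lemma pos_of_nuW_pos {i : ι} (h : 0 < nuW k ε a i) : 0 < a i :=
  (ordStat_nonneg k a).trans_lt (lt_of_nuW_pos h)

lemma encard_nuW_pos (hB : 0 ≤ B) (ha : ∀ i, a i ≤ B) :
    {i | 0 < nuW k ε a i}.encard ≤ k :=
  (Set.encard_le_encard fun _ hi => lt_of_nuW_pos hi).trans (encard_ordStat_lt k hB ha)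

lemma exists_nuW_eq_one (hε : 0 < ε) (hB : 0 ≤ B) (ha : ∀ i, a i ≤ B)
    (hfin : {i | 0 < a i}.Finite) (hgap : ε ≤ gapStat k a) : ∃ i, nuW k ε a i = 1 := by
  have h0 : 0 < ordStat 0 a := by
    have := ordStat_nonneg k a; rw [gapStat] at hgap; linarith
  obtain ⟨J, hJ, hJ'⟩ := exists_card_ordStat_le h0 hfin
  obtain ⟨i, hi⟩ := Finset.card_pos.1 (by omega : 0 < J.card)
  have hi' : a i = ordStat 0 a := le_antisymm (le_ordStat_zero hB ha i) (hJ' i hi)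
  refine ⟨i, ?_⟩
  have h1 : max 0 (a i - ordStat k a) = gapStat k a := by
    rw [hi']; exact max_eq_right (gapStat_nonneg hB ha)
  rw [nuW, max_eq_left hgap, h1, div_self (hε.trans_le hgap).ne']

/-- A quotient `x/y` with `0 ≤ x ≤ y`, `c ≤ y` is Lipschitz. -/
lemma abs_div_sub_div_le {x y x' y' c δ δ' : ℝ} (hc : 0 < c) (hy : c ≤ y) (hy' : c ≤ y')
    (hx' : 0 ≤ x') (hxy' : x' ≤ y') (h1 : |x - x'| ≤ δ) (h2 : |y - y'| ≤ δ') :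
    |x / y - x' / y'| ≤ (δ + δ') / c := by
  have hy0 : 0 < y := hc.trans_le hy
  have hy0' : 0 < y' := hc.trans_le hy'
  have e : x / y - x' / y' = ((x - x') - (x' / y') * (y - y')) / y := by
    field_simp; ring
  rw [e, abs_div, abs_of_pos hy0]
  have h3 : |(x' / y') * (y - y')| ≤ δ' := by
    rw [abs_mul, abs_of_nonneg (div_nonneg hx' hy0'.le)]
    calc x' / y' * |y - y'| ≤ 1 * |y - y'| := by
          gcongr; exact div_le_one_of_le₀ hxy' hy0'.le
      _ ≤ δ' := by rw [one_mul]; exact h2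
  have h4 : |(x - x') - (x' / y') * (y - y')| ≤ δ + δ' :=
    (abs_sub _ _).trans (add_le_add h1 h3)
  gcongr
  exact (abs_nonneg _).trans h4

lemma abs_nuW_sub_le {δ : ℝ} (hε : 0 < ε) (hB : 0 ≤ B) (ha : ∀ i, a i ≤ B) (ha' : ∀ i, a' i ≤ B)
    (hδ : ∀ i, |a i - a' i| ≤ δ) (hδ0 : 0 ≤ δ) (i : ι) :
    |nuW k ε a i - nuW k ε a' i| ≤ 4 * δ / ε := by
  have h0 := abs_ordStat_sub_le 0 hB ha ha' hδ hδ0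
  have hk := abs_ordStat_sub_le k hB ha ha' hδ hδ0
  have := abs_div_sub_div_le (x := max 0 (a i - ordStat k a)) (x' := max 0 (a' i - ordStat k a'))
    (y := max (gapStat k a) ε) (y' := max (gapStat k a') ε) (δ := 2 * δ) (δ' := 2 * δ)
    hε (le_max_right _ _) (le_max_right _ _) (le_max_left _ _)
    (max_le (hε.le.trans (le_max_right _ _))
      (le_max_of_le_left (sub_le_sub_right (le_ordStat_zero hB ha' i) _))) ?_ ?_
  · refine this.trans (le_of_eq ?_); ring
  · refine (abs_max_sub_max_le_max _ _ _ _).trans (max_le (by simpa using hδ0) ?_)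
    have e : a i - ordStat k a - (a' i - ordStat k a')
      = (a i - a' i) - (ordStat k a - ordStat k a') := by ring
    rw [e]; refine (abs_sub _ _).trans ?_; linarith [hδ i]
  · refine (abs_max_sub_max_le_max _ _ _ _).trans (max_le ?_ (by simpa using hδ0))
    have e : gapStat k a - gapStat k a'
      = (ordStat 0 a - ordStat 0 a') - (ordStat k a - ordStat k a') := by
      simp only [gapStat]; ring
    rw [e]; refine (abs_sub _ _).trans ?_; linarith

/-- Normalised weights supported where `ν > 1/2`. -/
def kapW (A : Finset ι) (ν : ι → ℝ) (i : ι) : ℝ :=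
  max 0 (ν i - 1 / 2) / max (∑ j ∈ A, max 0 (ν j - 1 / 2)) (1 / 2)

/-- The cut-off equal to `1` where `ν ≥ 1/2`. -/
def thtW (ν : ι → ℝ) (i : ι) : ℝ := min (2 * ν i) 1

open Classical in
/-- The weight of a subset `τ` of `A`. -/
def wgtW (A : Finset ι) (ν : ι → ℝ) (τ : Finset ι) : ℝ :=
  (∏ i ∈ τ, thtW ν i) * ∏ i ∈ A \ τ, (1 - thtW ν i)

variable {ν ν' : ι → ℝ} {A A' : Finset ι}

lemma kapW_nonneg (i : ι) : 0 ≤ kapW A ν i :=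
  div_nonneg (le_max_left _ _) (le_max_of_le_right (by norm_num))

lemma kapW_eq_zero {i : ι} (h : ν i ≤ 1 / 2) : kapW A ν i = 0 := by
  rw [kapW, max_eq_left (by linarith), zero_div]

lemma sum_kapW_le_one : ∑ i ∈ A, kapW A ν i ≤ 1 := by
  simp only [kapW]
  rw [← Finset.sum_div]
  exact div_le_one_of_le₀ (le_max_left _ _) (le_max_of_le_right (by norm_num))

lemma sum_kapW_eq_one {i : ι} (hi : i ∈ A) (h : ν i = 1) : ∑ i ∈ A, kapW A ν i = 1 := by
  have : 1 / 2 ≤ ∑ j ∈ A, max 0 (ν j - 1 / 2) := by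
    refine le_trans ?_ (Finset.single_le_sum (fun j _ => le_max_left _ _) hi)
    rw [h]; norm_num
  simp only [kapW]
  rw [← Finset.sum_div, max_eq_left this, div_self]
  linarith

lemma kapW_congr_finset (hA : A ⊆ A') (h : ∀ i ∈ A', i ∉ A → ν i ≤ 0) :
    kapW A ν = kapW A' ν := by
  funext i
  simp only [kapW]
  rw [Finset.sum_subset hA]
  intro j hj hj'
  exact max_eq_left (by linarith [h j hj hj'])

lemma abs_kapW_sub_le {η : ℝ} (hη : ∀ i, |ν i - ν' i| ≤ η) {i : ι} (hi : i ∈ A) :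
    |kapW A ν i - kapW A ν' i| ≤ 2 * (1 + A.card) * η := by
  have h1 : ∀ j, |max 0 (ν j - 1 / 2) - max 0 (ν' j - 1 / 2)| ≤ η := fun j => by
    refine (abs_max_sub_max_le_max _ _ _ _).trans (max_le ?_ ?_)
    · simpa using (abs_nonneg _).trans (hη j)
    · simpa using hη j
  have := abs_div_sub_div_le (x := max 0 (ν i - 1 / 2)) (x' := max 0 (ν' i - 1 / 2))
    (y := max (∑ j ∈ A, max 0 (ν j - 1 / 2)) (1 / 2))
    (y' := max (∑ j ∈ A, max 0 (ν' j - 1 / 2)) (1 / 2)) (c := 1 / 2) (δ' := A.card * η)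
    (by norm_num) (le_max_right _ _) (le_max_right _ _) (le_max_left _ _)
    (le_max_of_le_left (Finset.single_le_sum (f := fun j => max 0 (ν' j - 1 / 2))
      (fun j _ => le_max_left _ _) hi)) (h1 i) ?_
  · refine this.trans (le_of_eq ?_); ring
  · refine (abs_max_sub_max_le_max _ _ _ _).trans (max_le ?_ ?_)
    · rw [← Finset.sum_sub_distrib]
      refine (Finset.abs_sum_le_sum_abs _ _).trans ((Finset.sum_le_sum fun j _ => h1 j).trans ?_)
      simp
    · have := (abs_nonneg _).trans (hη i)
      simp only [sub_self, abs_zero]; positivity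

lemma thtW_nonneg (h : ∀ i, 0 ≤ ν i) (i : ι) : 0 ≤ thtW ν i :=
  le_min (mul_nonneg two_pos.le (h i)) zero_le_one

lemma thtW_le_one (i : ι) : thtW ν i ≤ 1 := min_le_right _ _

lemma abs_thtW_sub_le {η : ℝ} (hη : ∀ i, |ν i - ν' i| ≤ η) (i : ι) :
    |thtW ν i - thtW ν' i| ≤ 2 * η := by
  refine (abs_min_sub_min_le_max _ _ _ _).trans (max_le ?_ ?_)
  · rw [← mul_sub, abs_mul, abs_two]; linarith [hη i]
  · have := (abs_nonneg _).trans (hη i)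
    simp only [sub_self, abs_zero]; positivity

lemma abs_prod_sub_prod_le (S : Finset ι) (f g : ι → ℝ) {η : ℝ} (hf : ∀ i, 0 ≤ f i ∧ f i ≤ 1)
    (hg : ∀ i, 0 ≤ g i ∧ g i ≤ 1) (h : ∀ i, |f i - g i| ≤ η) :
    |∏ i ∈ S, f i - ∏ i ∈ S, g i| ≤ S.card * η := by
  classical
  induction S using Finset.induction_on with
  | empty => simp
  | insert i S hi ih =>
    rw [Finset.prod_insert hi, Finset.prod_insert hi, Finset.card_insert_of_notMem hi]
    have e : f i * ∏ i ∈ S, f i - g i * ∏ i ∈ S, g i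
      = (f i - g i) * ∏ i ∈ S, f i + g i * (∏ i ∈ S, f i - ∏ i ∈ S, g i) := by ring
    rw [e]
    have h1 : |∏ i ∈ S, f i| ≤ 1 := by
      rw [abs_of_nonneg (Finset.prod_nonneg fun i _ => (hf i).1)]
      exact Finset.prod_le_one (fun i _ => (hf i).1) fun i _ => (hf i).2
    have h2 : |g i| ≤ 1 := by rw [abs_of_nonneg (hg i).1]; exact (hg i).2
    refine (abs_add_le _ _).trans ?_
    rw [abs_mul, abs_mul]
    have h3 := mul_le_mul (h i) h1 (abs_nonneg _) ((abs_nonneg _).trans (h i))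
    have h4 := mul_le_mul h2 ih (abs_nonneg _) zero_le_one
    push_cast
    linarith

lemma wgtW_nonneg (h : ∀ i, 0 ≤ ν i) (τ : Finset ι) : 0 ≤ wgtW A ν τ :=
  mul_nonneg (Finset.prod_nonneg fun i _ => thtW_nonneg h i)
    (Finset.prod_nonneg fun i _ => sub_nonneg.2 (thtW_le_one i))

lemma sum_wgtW : ∑ τ ∈ A.powerset, wgtW A ν τ = 1 := by
  classical
  have := Finset.prod_add (fun i => thtW ν i) (fun i => 1 - thtW ν i) A
  simp only [add_sub_cancel, Finset.prod_const_one] at this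
  rw [this]
  refine Finset.sum_congr rfl fun τ _ => ?_
  simp only [wgtW]

lemma wgtW_le_one (h : ∀ i, 0 ≤ ν i) (τ : Finset ι) : wgtW A ν τ ≤ 1 :=
  mul_le_one₀ (Finset.prod_le_one (fun i _ => thtW_nonneg h i) fun i _ => thtW_le_one i)
    (Finset.prod_nonneg fun i _ => sub_nonneg.2 (thtW_le_one i))
    (Finset.prod_le_one (fun i _ => sub_nonneg.2 (thtW_le_one i))
      fun i _ => by linarith [thtW_nonneg h i])

lemma abs_wgtW_sub_le {η : ℝ} (h : ∀ i, 0 ≤ ν i) (h' : ∀ i, 0 ≤ ν' i)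
    (hη : ∀ i, |ν i - ν' i| ≤ η) {τ : Finset ι} (hτ : τ ⊆ A) :
    |wgtW A ν τ - wgtW A ν' τ| ≤ 2 * A.card * η := by
  classical
  have key : ∀ ν : ι → ℝ, wgtW A ν τ = ∏ i ∈ A, (if i ∈ τ then thtW ν i else 1 - thtW ν i) := by
    intro ν
    rw [Finset.prod_ite, wgtW]
    congr 1
    · refine Finset.prod_congr ?_ fun _ _ => rfl
      ext i; simp only [Finset.mem_filter]; exact ⟨fun hi => ⟨hτ hi, hi⟩, fun hi => hi.2⟩
    · refine Finset.prod_congr ?_ fun _ _ => rfl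
      ext i; simp
  rw [key, key]
  have hh : ∀ (ν : ι → ℝ), (∀ i, 0 ≤ ν i) → ∀ i, 0 ≤ (if i ∈ τ then thtW ν i else 1 - thtW ν i) ∧
      (if i ∈ τ then thtW ν i else 1 - thtW ν i) ≤ 1 := by
    intro ν h i
    have := thtW_nonneg h i
    have := thtW_le_one (ν := ν) i
    split_ifs <;> constructor <;> linarith
  refine (abs_prod_sub_prod_le A _ _ (hh ν h) (hh ν' h') (η := 2 * η) fun i => ?_).trans
    (le_of_eq (by ring))
  have := abs_thtW_sub_le hη i
  split_ifs
  · exact this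
  · rwa [sub_sub_sub_cancel_left, abs_sub_comm]

lemma wgtW_eq_zero {τ : Finset ι} {i : ι} (hi : i ∈ τ) (h : ν i = 0) : wgtW A ν τ = 0 := by
  rw [wgtW, Finset.prod_eq_zero hi (by simp [thtW, h]), zero_mul]

lemma mem_of_wgtW_ne_zero {τ : Finset ι} (h : wgtW A ν τ ≠ 0) {i : ι} (hi : i ∈ A)
    (hν : 1 / 2 ≤ ν i) : i ∈ τ := by
  classical
  by_contra hiτ
  apply h
  rw [wgtW, mul_comm, Finset.prod_eq_zero (i := i) (by simp [hi, hiτ]), zero_mul]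
  rw [thtW, min_eq_right (by linarith), sub_self]

lemma sum_wgtW_smul_congr_finset {V : Type*} [AddCommGroup V] [Module ℝ V] (hA : A ⊆ A')
    (h : ∀ i ∈ A', i ∉ A → ν i = 0) (f : Finset ι → V) :
    ∑ τ ∈ A.powerset, wgtW A ν τ • f τ = ∑ τ ∈ A'.powerset, wgtW A' ν τ • f τ := by
  classical
  rw [← Finset.sum_subset (Finset.powerset_mono.2 hA)]
  · refine Finset.sum_congr rfl fun τ hτ => ?_
    congr 1
    simp only [wgtW]
    congr 1
    refine Finset.prod_subset (Finset.sdiff_subset_sdiff hA le_rfl) fun i hi hi' => ?_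
    simp only [Finset.mem_sdiff, not_and, not_not] at hi hi'
    have : i ∉ A := fun hA => hi.2 (hi' hA)
    simp [thtW, h i hi.1 this]
  · intro τ hτ hτ'
    rw [Finset.mem_powerset, Finset.not_subset] at hτ'
    obtain ⟨i, hi, hiA⟩ := hτ'
    rw [wgtW_eq_zero hi (h i (Finset.mem_powerset.1 hτ hi) hiA), zero_smul]

end Weights

section GeneralPosition

lemma exists_greedy {ι V : Type*} [Inhabited V] (rank : ι → ℕ) (R : ι → (ι → V) → V → Prop)
    (hR : ∀ i y, ∃ v, R i y v)
    (hloc : ∀ i y y' v, (∀ j, rank j < rank i → y j = y' j) → R i y v → R i y' v) :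
    ∃ y : ι → V, ∀ i, R i y (y i) := by
  classical
  let step : (i : ι) → ((j : ι) → rank j < rank i → V) → V := fun i prev =>
    Classical.choose (hR i fun j => if h : rank j < rank i then prev j h else default)
  let y : ι → V := (measure rank).wf.fix step
  refine ⟨y, fun i => ?_⟩
  have hy : y i = step i fun j _ => y j := (measure rank).wf.fix_eq step i
  have := Classical.choose_spec (hR i fun j => if rank j < rank i then y j else default)
  rw [hy]
  exact hloc i _ _ _ (fun j hj => by simp [hj]) this

variable {V : Type*} [NormedAddCommGroup V] [InnerProductSpace ℝ V]

lemma exists_avoid_slabs {κ : Type*} (h : κ → V) (a : κ → ℝ) (hh : ∀ l, ‖h l‖ = 1) (v : V)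
    {r : ℝ} (hr : 0 < r) (T : Finset κ) :
    ∃ v', ∀ v'', ‖v'' - v'‖ ≤ (1 / 4) ^ T.card * r → ‖v'' - v‖ ≤ r ∧
      ∀ l ∈ T, (1 / 4) ^ T.card * r ≤ |inner ℝ (h l) v'' - a l| := by
  classical
  induction T using Finset.induction_on with
  | empty => exact ⟨v, fun v'' hv => ⟨by simpa using hv, by simp⟩⟩
  | insert l T hl ih =>
    obtain ⟨w, hw⟩ := ih
    set ρ := (1 / 4 : ℝ) ^ T.card * r with hρ
    have hρ0 : 0 < ρ := by positivity
    rw [Finset.card_insert_of_notMem hl]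
    have hρ' : (1 / 4 : ℝ) ^ (T.card + 1) * r = ρ / 4 := by rw [hρ, pow_succ]; ring
    rw [hρ']
    have hin : inner ℝ (h l) (h l) = (1 : ℝ) := by rw [real_inner_self_eq_norm_sq, hh]; norm_num
    obtain ⟨σ, hσ, hw'⟩ : ∃ σ : ℝ, |σ| = 1 ∧
        ρ / 2 ≤ |inner ℝ (h l) (w + (σ * (ρ / 2)) • h l) - a l| := by
      simp only [inner_add_right, inner_smul_right, hin, mul_one]
      rcases le_total 0 (inner ℝ (h l) w - a l) with h0 | h0
      · refine ⟨1, abs_one, ?_⟩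
        rw [abs_of_nonneg] <;> linarith
      · refine ⟨-1, by simp, ?_⟩
        rw [abs_of_nonpos] <;> linarith
    set w' := w + (σ * (ρ / 2)) • h l with hw'def
    refine ⟨w', fun v'' hv => ?_⟩
    have hd : ‖v'' - w‖ ≤ ρ := by
      have e : v'' - w = (v'' - w') + (σ * (ρ / 2)) • h l := by rw [hw'def]; abel
      rw [e]
      refine (norm_add_le _ _).trans ?_
      rw [norm_smul, hh, mul_one, Real.norm_eq_abs, abs_mul, hσ, abs_of_pos (by linarith)]
      linarith
    obtain ⟨h1, h2⟩ := hw v'' hd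
    refine ⟨h1, fun l' hl' => ?_⟩
    rcases Finset.mem_insert.1 hl' with rfl | hl'
    · have e : inner ℝ (h l') w' - a l' = (inner ℝ (h l') v'' - a l') - inner ℝ (h l') (v'' - w') := by
        rw [inner_sub_right]; ring
      have h3 : |inner ℝ (h l') (v'' - w')| ≤ ρ / 4 := by
        refine (abs_real_inner_le_norm _ _).trans ?_
        rw [hh, one_mul]; exact hv
      rw [e] at hw'
      have := hw'.trans (abs_sub _ _)
      linarith
    · exact le_trans (by linarith) (h2 l' hl')

lemma exists_unit_orthogonal [FiniteDimensional ℝ V] {ι : Type*} (y : ι → V) (B : Finset ι)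
    (hB : B.Nonempty) (hcard : B.card ≤ Module.finrank ℝ V) :
    ∃ h : V, ‖h‖ = 1 ∧ ∀ j ∈ B, ∀ k ∈ B, inner ℝ h (y j - y k) = 0 := by
  classical
  obtain ⟨j₀, hj₀⟩ := hB
  let S : Submodule ℝ V := Submodule.span ℝ ((B.erase j₀).image fun j => y j - y j₀)
  have hS : Module.finrank ℝ S < Module.finrank ℝ V := by
    refine lt_of_le_of_lt (finrank_span_finset_le_card _) ?_
    refine lt_of_le_of_lt Finset.card_image_le ?_
    rw [Finset.card_erase_of_mem hj₀]
    have := Finset.card_pos.2 ⟨j₀, hj₀⟩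
    omega
  have hne : Sᗮ ≠ ⊥ := by
    intro h
    rw [Submodule.orthogonal_eq_bot_iff] at h
    rw [h, finrank_top] at hS
    exact lt_irrefl _ hS
  obtain ⟨h, hh, h0⟩ := Submodule.exists_mem_ne_zero_of_ne_bot hne
  have key : ∀ j ∈ B, inner ℝ h (y j - y j₀) = 0 := by
    intro j hj
    by_cases hjj : j = j₀
    · simp [hjj]
    · rw [real_inner_comm]
      refine (Submodule.mem_orthogonal _ _).1 hh _ (Submodule.subset_span ?_)
      simp only [Finset.coe_image, Finset.coe_erase]
      exact ⟨j, ⟨hj, hjj⟩, rfl⟩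
  refine ⟨(‖h‖⁻¹ : ℝ) • h, by simp [norm_smul, h0], fun j hj k hk => ?_⟩
  have e : y j - y k = (y j - y j₀) - (y k - y j₀) := by abel
  rw [e, inner_sub_right, inner_smul_left, inner_smul_left, key j hj, key k hk]
  simp

/-- The bound for dual vectors of a simplex with `s` vertices. -/
def dualConst (G c : ℝ) : ℕ → ℝ
  | 0 => 0
  | s + 1 => dualConst G c s + (dualConst G c s * G + 1) * (1 / c)

lemma dualConst_nonneg {G c : ℝ} (hG : 0 ≤ G) (hc : 0 < c) (s : ℕ) : 0 ≤ dualConst G c s := by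
  induction s with
  | zero => exact le_rfl
  | succ s ih => simp only [dualConst]; positivity

lemma dualConst_mono {G c : ℝ} (hG : 0 ≤ G) (hc : 0 < c) : Monotone (dualConst G c) := by
  refine monotone_nat_of_le_succ fun s => ?_
  have := dualConst_nonneg hG hc s
  simp only [dualConst]
  have : 0 ≤ (dualConst G c s * G + 1) * (1 / c) := by positivity
  linarith

open Classical in
lemma exists_dual {ι : Type*} (y : ι → V) (rank : ι → ℕ) (hrank : Function.Injective rank)
    {d c G : ℝ} (hd : 0 < d) (hc : 0 < c) (hG : 0 ≤ G) (τ : Finset ι)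
    (h1 : ∀ i ∈ τ, ∀ j ∈ τ, ‖y i - y j‖ ≤ G * d)
    (h2 : ∀ i ∈ τ, ∀ B ⊆ τ, B.Nonempty → (∀ j ∈ B, rank j < rank i) →
      ∃ h, ‖h‖ = 1 ∧ (∀ j ∈ B, ∀ k ∈ B, inner ℝ h (y j - y k) = 0) ∧
        ∀ j ∈ B, c * d ≤ |inner ℝ h (y i - y j)|) :
    ∃ e : ι → V, (τ.Nonempty → ∑ i ∈ τ, e i = 0) ∧
      (∀ i ∈ τ, ∀ j ∈ τ, ∀ k ∈ τ, inner ℝ (e i) (y j - y k)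
        = (if i = j then (1 : ℝ) else 0) - (if i = k then 1 else 0)) ∧
      ∀ i ∈ τ, ‖e i‖ ≤ dualConst G c τ.card / d := by
  induction τ using Finset.induction_on_max_value rank with
  | empty => exact ⟨fun _ => 0, by simp, by simp, by simp⟩
  | insert a B ha hmax ih =>
    obtain ⟨e, he1, he2, he3⟩ := ih
      (fun i hi j hj => h1 i (Finset.mem_insert_of_mem hi) j (Finset.mem_insert_of_mem hj))
      (fun i hi B' hB' => h2 i (Finset.mem_insert_of_mem hi) B'
        (hB'.trans (Finset.subset_insert _ _)))
    rcases B.eq_empty_or_nonempty with rfl | hB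
    · refine ⟨fun _ => 0, by simp, ?_, ?_⟩
      · intro i hi j hj k hk
        simp only [insert_empty_eq, Finset.mem_singleton] at hi hj hk
        simp [hi, hj, hk]
      · intro i _
        simpa using div_nonneg (dualConst_nonneg hG hc _) hd.le
    obtain ⟨k₀, hk₀⟩ := hB
    have hlt : ∀ j ∈ B, rank j < rank a := fun j hj =>
      lt_of_le_of_ne (hmax j hj) fun h => ha (hrank h ▸ hj)
    obtain ⟨h, hh, horth, hfar⟩ := h2 a (Finset.mem_insert_self _ _) B (Finset.subset_insert _ _)
      ⟨k₀, hk₀⟩ hlt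
    set q : ℝ := inner ℝ h (y a - y k₀) with hq
    have hq0 : q ≠ 0 := by
      have := hfar k₀ hk₀
      intro h0; rw [← hq, h0, abs_zero] at this
      have : 0 < c * d := by positivity
      linarith
    have hqa : ∀ k ∈ B, inner ℝ h (y a - y k) = q := by
      intro k hk
      have e1 : y a - y k = (y a - y k₀) + (y k₀ - y k) := by abel
      rw [e1, inner_add_right, horth k₀ hk₀ k hk, add_zero]
    set es : V := q⁻¹ • h with hes
    have es1 : ∀ k ∈ B, inner ℝ es (y a - y k) = (1 : ℝ) := by
      intro k hk
      rw [hes, inner_smul_left, hqa k hk]; simp [hq0]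
    have es0 : ∀ j ∈ B, ∀ k ∈ B, inner ℝ es (y j - y k) = (0 : ℝ) := by
      intro j hj k hk
      rw [hes, inner_smul_left, horth j hj k hk, mul_zero]
    have esn : ‖es‖ ≤ 1 / c / d := by
      rw [hes, norm_smul, hh, mul_one, norm_inv, Real.norm_eq_abs, div_div, one_div]
      gcongr
      exact hfar k₀ hk₀
    set β : ι → ℝ := fun j => inner ℝ (e j) (y a - y k₀) + if j = k₀ then 1 else 0 with hβ
    have hβk : ∀ j ∈ B, ∀ k ∈ B, inner ℝ (e j) (y a - y k) = β j - if j = k then 1 else 0 := by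
      intro j hj k hk
      have e1 : y a - y k = (y a - y k₀) + (y k₀ - y k) := by abel
      rw [e1, inner_add_right, he2 j hj k₀ hk₀ k hk, hβ]; ring
    have hβn : ∀ j ∈ B, |β j| ≤ dualConst G c B.card * G + 1 := by
      intro j hj
      refine (abs_add_le _ _).trans (add_le_add ?_ ?_)
      · refine (abs_real_inner_le_norm _ _).trans ?_
        calc ‖e j‖ * ‖y a - y k₀‖ ≤ (dualConst G c B.card / d) * (G * d) :=
              mul_le_mul (he3 j hj) (h1 a (Finset.mem_insert_self _ _) k₀
                (Finset.mem_insert_of_mem hk₀)) (norm_nonneg _)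
                (div_nonneg (dualConst_nonneg hG hc _) hd.le)
          _ = dualConst G c B.card * G := by field_simp
      · split_ifs <;> simp
    have hβs : ∑ j ∈ B, β j = 1 := by
      simp only [hβ, Finset.sum_add_distrib, ← sum_inner, he1 ⟨k₀, hk₀⟩, inner_zero_left, zero_add]
      simp [hk₀]
    have hne : ∀ j ∈ B, j ≠ a := fun j hj h => ha (h ▸ hj)
    refine ⟨fun i => if i = a then es else e i - β i • es, ?_, ?_, ?_⟩
    · intro _
      rw [Finset.sum_insert ha]
      have : ∑ i ∈ B, (if i = a then es else e i - β i • es) = ∑ i ∈ B, (e i - β i • es) :=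
        Finset.sum_congr rfl fun i hi => by rw [if_neg (hne i hi)]
      rw [this, Finset.sum_sub_distrib, ← Finset.sum_smul, hβs, he1 ⟨k₀, hk₀⟩]
      simp
    · intro i hi j hj k hk
      have flip : ∀ (w : V) (j k : ι), inner ℝ w (y j - y k) = -inner ℝ w (y k - y j) := by
        intro w j k; rw [← inner_neg_right, neg_sub]
      rcases Finset.mem_insert.1 hi with rfl | hi'
      · rcases Finset.mem_insert.1 hj with rfl | hj' <;> rcases Finset.mem_insert.1 hk with rfl | hk'
        · simp
        · simp [es1 k hk', (hne k hk').symm]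
        · rw [flip]; simp [es1 j hj', (hne j hj').symm]
        · simp [es0 j hj' k hk', (hne j hj').symm, (hne k hk').symm]
      · simp only [hne i hi', if_false, inner_sub_left, inner_smul_left]
        rcases Finset.mem_insert.1 hj with rfl | hj' <;> rcases Finset.mem_insert.1 hk with rfl | hk'
        · simp
        · rw [hβk i hi' k hk', es1 k hk']; simp [hne i hi']
        · rw [flip (e i), flip es, hβk i hi' j hj', es1 j hj']; simp [hne i hi']
        · rw [he2 i hi' j hj' k hk', es0 j hj' k hk']; simp
    · intro i hi
      rw [Finset.card_insert_of_notMem ha]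
      have hD := dualConst_nonneg hG hc B.card
      rcases Finset.mem_insert.1 hi with rfl | hi
      · simp only [if_true]
        refine esn.trans ?_
        simp only [dualConst]
        gcongr
        have : 1 / c ≤ (dualConst G c B.card * G + 1) * (1 / c) :=
          le_mul_of_one_le_left (by positivity) (by nlinarith [mul_nonneg hD hG])
        linarith
      · simp only [hne i hi, if_false]
        refine (norm_sub_le _ _).trans ?_
        rw [norm_smul, Real.norm_eq_abs]
        have := mul_le_mul (hβn i hi) esn (norm_nonneg _) (by positivity)
        have h3 := he3 i hi
        calc ‖e i‖ + |β i| * ‖es‖ ≤ dualConst G c B.card / d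
              + (dualConst G c B.card * G + 1) * (1 / c / d) := add_le_add h3 this
          _ = _ := by simp only [dualConst]; ring

end GeneralPosition

section WhitneyFamily

/-- A family of bump functions adapted to the complement of `Z`, in the manner of a Whitney
decomposition, with reference points on `Z` and a colouring that separates neighbours. -/
structure Whitney (m : ℕ) (Z : Set (Euc m)) (ι Col : Type) (K : ℝ) where
  col : ι → Col
  b : ι → Euc m → ℝ
  r : ι → ℝ
  z : ι → Euc m
  r_pos : ∀ i, 0 < r i
  z_mem : ∀ i, z i ∈ Z
  b_nonneg : ∀ i x, 0 ≤ b i x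
  b_le_one : ∀ i x, b i x ≤ 1
  lip : ∀ i x x', |b i x - b i x'| ≤ dist x x' / r i
  lt_r : ∀ i x, 0 < b i x → infDist x Z < 2 * r i
  r_lt : ∀ i x, 0 < b i x → r i < 2 * infDist x Z
  dist_z : ∀ i x, 0 < b i x → dist (z i) x ≤ K * r i
  exists_b : ∀ x, x ∉ Z → ∃ i, 1 / 4 ≤ b i x
  col_inj : ∀ i j j' x x', 0 < b i x → 0 < b j x → 0 < b i x' → 0 < b j' x' →
    col j = col j' → j = j'

lemma Int.eq_of_abs_sub_lt_of_cast_eq {N : ℕ} {a b : ℤ} (h : (a : ZMod N) = (b : ZMod N))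
    (hab : |(a : ℝ) - b| < N) : a = b := by
  have h1 : |a - b| < N := by
    have : ((|a - b| : ℤ) : ℝ) < ((N : ℤ) : ℝ) := by push_cast; exact hab
    exact_mod_cast this
  have h2 : (N : ℤ) ∣ a - b := by
    rw [← ZMod.intCast_zmod_eq_zero_iff_dvd]; push_cast; rw [h, sub_self]
  have := Int.eq_zero_of_abs_lt_dvd h2 h1
  omega

lemma exists_whitney (m : ℕ) (hm : 1 ≤ m) {Z : Set (Euc m)} (hZ : IsCompact Z)
    (hne : Z.Nonempty) :
    Nonempty (Whitney m Z (ℤ × (Fin m → ℤ)) (ZMod 3 × (Fin m → ZMod 6)) (2 + 2 * m)) := by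
  classical
  -- rescaled position relative to the dyadic lattice point
  let S : ℤ × (Fin m → ℤ) → Euc m → (Fin m → ℝ) := fun i x l => (2 : ℝ) ^ (-i.1) * x l - i.2 l
  let b : ℤ × (Fin m → ℤ) → Euc m → ℝ := fun i x =>
    max 0 (min (min ((2 : ℝ) ^ (-i.1) * infDist x Z - 1 / 2) (2 - (2 : ℝ) ^ (-i.1) * infDist x Z))
      (1 - ‖S i x‖))
  let c : ℤ × (Fin m → ℤ) → Euc m := fun i => WithLp.toLp 2 fun l => (2 : ℝ) ^ i.1 * i.2 l
  have hz : ∀ i, ∃ z ∈ Z, infDist (c i) Z = dist (c i) z := fun i =>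
    hZ.exists_infDist_eq_dist hne _
  choose z hzZ hz using hz
  have hinv : ∀ k : ℤ, (2 : ℝ) ^ (-k) * 2 ^ k = 1 := fun k => by
    rw [← zpow_add₀ two_ne_zero]; simp
  have hpos : ∀ i x, 0 < b i x → 1 / 2 < (2 : ℝ) ^ (-i.1) * infDist x Z ∧
      (2 : ℝ) ^ (-i.1) * infDist x Z < 2 ∧ ‖S i x‖ < 1 := by
    intro i x h
    have h' := (lt_max_iff.1 h).resolve_left (lt_irrefl _)
    rw [lt_min_iff, lt_min_iff] at h'
    refine ⟨?_, ?_, ?_⟩ <;> linarith [h'.1.1, h'.1.2, h'.2]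
  have hscale : ∀ (k : ℤ) (d t : ℝ), (2 : ℝ) ^ (-k) * d < t → d < t * 2 ^ k := by
    intro k d t h
    have := mul_lt_mul_of_pos_right h (zpow_pos (two_pos : (0:ℝ) < 2) k)
    rwa [mul_right_comm, hinv, one_mul] at this
  have hscale' : ∀ (k : ℤ) (d t : ℝ), t < (2 : ℝ) ^ (-k) * d → t * 2 ^ k < d := by
    intro k d t h
    have := mul_lt_mul_of_pos_right h (zpow_pos (two_pos : (0:ℝ) < 2) k)
    rwa [mul_right_comm, hinv, one_mul] at this
  have hlow : ∀ i x, 0 < b i x → infDist x Z < 2 * 2 ^ i.1 := fun i x h =>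
    hscale _ _ _ (hpos i x h).2.1
  have hupp : ∀ i x, 0 < b i x → (2 : ℝ) ^ i.1 < 2 * infDist x Z := fun i x h => by
    have := hscale' _ _ _ (hpos i x h).1
    linarith
  have hcoord : ∀ i x, 0 < b i x → ∀ l, |x l - (2 : ℝ) ^ i.1 * i.2 l| < 2 ^ i.1 := by
    intro i x h l
    have h1 : |(2 : ℝ) ^ (-i.1) * x l - i.2 l| < 1 :=
      (norm_le_pi_norm (S i x) l).trans_lt (hpos i x h).2.2
    have e : x l - (2 : ℝ) ^ i.1 * i.2 l = 2 ^ i.1 * ((2 : ℝ) ^ (-i.1) * x l - i.2 l) := by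
      rw [mul_sub, ← mul_assoc, mul_comm ((2:ℝ) ^ i.1) (2 ^ (-i.1)), hinv, one_mul]
    rw [e, abs_mul, abs_of_pos (zpow_pos two_pos _)]
    exact mul_lt_of_lt_one_right (zpow_pos two_pos _) h1
  have hc : ∀ i x, 0 < b i x → dist x (c i) ≤ m * 2 ^ i.1 := by
    intro i x h
    have hm1 : (1 : ℝ) ≤ m := by exact_mod_cast hm
    rw [EuclideanSpace.dist_eq, Real.sqrt_le_iff]
    refine ⟨by positivity, ?_⟩
    calc ∑ l, dist (x l) (c i l) ^ 2 ≤ ∑ _l : Fin m, ((2 : ℝ) ^ i.1) ^ 2 := by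
          refine Finset.sum_le_sum fun l _ => ?_
          have := (hcoord i x h l).le
          rw [Real.dist_eq]
          gcongr
      _ = m * ((2 : ℝ) ^ i.1) ^ 2 := by simp
      _ ≤ (m * (2 : ℝ) ^ i.1) ^ 2 := by
          rw [mul_pow]; gcongr; nlinarith
  have hlipd : ∀ (i : ℤ × (Fin m → ℤ)) (x x' : Euc m), |(2 : ℝ) ^ (-i.1) * infDist x Z - (2 : ℝ) ^ (-i.1) * infDist x' Z|
      ≤ dist x x' / 2 ^ i.1 := by
    intro i x x'
    rw [← mul_sub, abs_mul, abs_of_pos (zpow_pos two_pos _), zpow_neg, div_eq_inv_mul]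
    gcongr
    have := (lipschitz_infDist_pt Z).dist_le_mul x x'
    rwa [Real.dist_eq, NNReal.coe_one, one_mul] at this
  have hlipS : ∀ (i : ℤ × (Fin m → ℤ)) (x x' : Euc m), |‖S i x‖ - ‖S i x'‖| ≤ dist x x' / 2 ^ i.1 := by
    intro i x x'
    refine (abs_norm_sub_norm_le _ _).trans ?_
    have h0 : 0 ≤ dist x x' / (2 : ℝ) ^ i.1 := by positivity
    rw [pi_norm_le_iff_of_nonneg h0]
    intro l
    have e : (S i x - S i x') l = (2 : ℝ) ^ (-i.1) * (x l - x' l) := by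
      simp only [S, Pi.sub_apply]; ring
    rw [e, Real.norm_eq_abs, abs_mul, abs_of_pos (zpow_pos two_pos _), zpow_neg, div_eq_inv_mul]
    gcongr
    rw [dist_eq_norm]
    exact PiLp.norm_apply_le (x - x') l
  refine ⟨⟨fun i => ((i.1 : ZMod 3), fun l => (i.2 l : ZMod 6)), b, fun i => 2 ^ i.1, z,
    fun i => zpow_pos two_pos _, hzZ, fun i x => le_max_left _ _, ?_, ?_, hlow, hupp, ?_, ?_, ?_⟩⟩
  · intro i x
    exact max_le zero_le_one ((min_le_right _ _).trans (by linarith [norm_nonneg (S i x)]))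
  · intro i x x'
    have h0 : 0 ≤ dist x x' / (2 : ℝ) ^ i.1 := by positivity
    refine (abs_max_sub_max_le_max _ _ _ _).trans (max_le (by simpa using h0) ?_)
    refine (abs_min_sub_min_le_max _ _ _ _).trans (max_le ?_ ?_)
    · refine (abs_min_sub_min_le_max _ _ _ _).trans (max_le ?_ ?_)
      · rw [sub_sub_sub_cancel_right]; exact hlipd i x x'
      · rw [sub_sub_sub_cancel_left, abs_sub_comm]; exact hlipd i x x'
    · rw [sub_sub_sub_cancel_left, abs_sub_comm]; exact hlipS i x x'
  · intro i x h
    have h1 := hc i x h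
    have h2 := hlow i x h
    have h3 : infDist (c i) Z ≤ infDist x Z + dist (c i) x := infDist_le_infDist_add_dist
    have h4 := dist_triangle (z i) (c i) x
    rw [dist_comm (z i) (c i), ← hz i] at h4
    rw [dist_comm (c i) x] at h3 h4
    linarith
  · intro x hx
    have hd : 0 < infDist x Z := (hZ.isClosed.notMem_iff_infDist_pos hne).1 hx
    obtain ⟨k, hk1, hk2⟩ := exists_mem_Ico_zpow (by positivity : 0 < 4 / 3 * infDist x Z)
      (one_lt_two : (1:ℝ) < 2)
    refine ⟨(k, fun l => round ((2 : ℝ) ^ (-k) * x l)), ?_⟩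
    have p0 : (0:ℝ) < 2 ^ (-k) := zpow_pos two_pos _
    have h1 : 3 / 4 ≤ (2 : ℝ) ^ (-k) * infDist x Z := by
      have := mul_le_mul_of_nonneg_left hk1 p0.le
      rw [hinv] at this; linarith
    have h2 : (2 : ℝ) ^ (-k) * infDist x Z < 3 / 2 := by
      have := mul_lt_mul_of_pos_left hk2 p0
      rw [zpow_add_one₀ two_ne_zero, ← mul_assoc _ ((2:ℝ) ^ k), hinv] at this; linarith
    refine le_max_of_le_right (le_min (le_min ?_ ?_) ?_)
    · simp only; linarith
    · simp only; linarith
    · have : ‖S (k, fun l => round ((2 : ℝ) ^ (-k) * x l)) x‖ ≤ 1 / 2 := by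
        rw [pi_norm_le_iff_of_nonneg (by norm_num)]
        intro l
        exact abs_sub_round _
      linarith
  · intro i j j' x x' hix hjx hix' hjx' hcol
    have hlev : ∀ i j x, 0 < b i x → 0 < b j x → i.1 ≤ j.1 + 1 := by
      intro i j x hi hj
      have h1 : (2 : ℝ) ^ i.1 < 2 ^ (j.1 + 2) := by
        rw [zpow_add₀ two_ne_zero]
        have := hupp i x hi
        have := hlow j x hj
        norm_num; linarith
      have := (zpow_lt_zpow_iff_right₀ (one_lt_two : (1:ℝ) < 2)).1 h1
      omega
    have hk : j.1 = j'.1 := by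
      refine Int.eq_of_abs_sub_lt_of_cast_eq (congrArg Prod.fst hcol) ?_
      have h1 := hlev i j x hix hjx
      have h2 := hlev j i x hjx hix
      have h3 := hlev i j' x' hix' hjx'
      have h4 := hlev j' i x' hjx' hix'
      have : |j.1 - j'.1| < 3 := by rw [abs_lt]; constructor <;> omega
      exact_mod_cast this
    have hg : ∀ j x, 0 < b i x → 0 < b j x → ∀ l,
        |(2 : ℝ) ^ j.1 * j.2 l - 2 ^ i.1 * i.2 l| < 3 * 2 ^ j.1 := by
      intro j x hi hj l
      have h1 := abs_lt.1 (hcoord i x hi l)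
      have h2 := abs_lt.1 (hcoord j x hj l)
      have h3 : (2 : ℝ) ^ i.1 ≤ 2 * 2 ^ j.1 := by
        have := zpow_le_zpow_right₀ (one_le_two : (1:ℝ) ≤ 2) (hlev i j x hi hj)
        rw [zpow_add_one₀ two_ne_zero] at this; linarith
      rw [abs_lt]; constructor <;> linarith [h1.1, h1.2, h2.1, h2.2]
    refine Prod.ext hk (funext fun l => ?_)
    refine Int.eq_of_abs_sub_lt_of_cast_eq (congrFun (congrArg Prod.snd hcol) l) ?_
    have h1 := abs_lt.1 (hg j x hix hjx l)
    have h2 := abs_lt.1 (hg j' x' hix' hjx' l)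
    rw [← hk] at h2
    have p0 : (0:ℝ) < 2 ^ j.1 := zpow_pos two_pos _
    have h3 : (2 : ℝ) ^ j.1 * |(j.2 l : ℝ) - j'.2 l| < 2 ^ j.1 * 6 := by
      rw [← abs_of_pos p0, ← abs_mul, abs_of_pos p0, mul_sub, abs_lt]
      constructor <;> linarith [h1.1, h1.2, h2.1, h2.2]
    have := lt_of_mul_lt_mul_left h3 p0.le
    exact_mod_cast this

namespace Whitney

variable {m : ℕ} {Z : Set (Euc m)} {ι Col : Type} {K : ℝ} (W : Whitney m Z ι Col K)

lemma infDist_pos {i : ι} {x : Euc m} (h : 0 < W.b i x) : 0 < infDist x Z := by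
  have := W.r_pos i; have := W.r_lt i x h; linarith

lemma exists_neighbours [Fintype Col] (i : ι) : ∃ F : Finset ι, F.card ≤ Fintype.card Col ∧
    ∀ j x, 0 < W.b i x → 0 < W.b j x → j ∈ F := by
  classical
  let S : Set ι := {j | ∃ x, 0 < W.b i x ∧ 0 < W.b j x}
  have hinj : Set.InjOn W.col S := by
    rintro j ⟨x, hx, hj⟩ j' ⟨x', hx', hj'⟩ h
    exact W.col_inj i j j' x x' hx hj hx' hj' h
  have hfin : S.Finite := Set.Finite.of_finite_image (Set.toFinite _) hinj
  refine ⟨hfin.toFinset, ?_, fun j x h h' => hfin.mem_toFinset.2 ⟨x, h, h'⟩⟩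
  exact Finset.card_le_card_of_injOn W.col (fun _ _ => Finset.mem_coe.2 (Finset.mem_univ _))
    (fun j hj j' hj' h => hinj (hfin.mem_toFinset.1 hj) (hfin.mem_toFinset.1 hj') h)

/-- The bound for the dual vectors attached to a Whitney family with `N` colours. -/
def vertConst (K : ℝ) (N n : ℕ) : ℝ :=
  2 * dualConst (4 * (1 + K)) ((1 / 4) ^ 2 ^ N / 2) (n + 1)

lemma vertConst_nonneg {K : ℝ} (hK : 0 ≤ K) (N n : ℕ) : 0 ≤ vertConst K N n :=
  mul_nonneg two_pos.le (dualConst_nonneg (by positivity) (by positivity) _)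

open Classical in
lemma exists_vertices [Encodable ι] [Fintype Col] (hK : 0 ≤ K)
    {V : Type*} [NormedAddCommGroup V] [InnerProductSpace ℝ V] [FiniteDimensional ℝ V]
    (hV : 1 ≤ Module.finrank ℝ V) (X : Euc m → V)
    (hX : ∀ z ∈ Z, ∀ z' ∈ Z, dist (X z) (X z') ≤ dist z z') :
    ∃ (y : ι → V) (e : Finset ι → ι → V), (∀ i, ‖y i - X (W.z i)‖ ≤ W.r i) ∧
      ∀ τ : Finset ι, τ.card ≤ Module.finrank ℝ V + 1 → (∃ x, ∀ i ∈ τ, 0 < W.b i x) →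
        (τ.Nonempty → ∑ i ∈ τ, e τ i = 0) ∧
        (∀ i ∈ τ, ∀ j ∈ τ, ∀ k ∈ τ, inner ℝ (e τ i) (y j - y k)
          = (if i = j then (1 : ℝ) else 0) - (if i = k then 1 else 0)) ∧
        ∀ i ∈ τ, ∀ j ∈ τ,
          ‖e τ i‖ ≤ vertConst K (Fintype.card Col) (Module.finrank ℝ V) / W.r j := by
  set n := Module.finrank ℝ V with hn
  set N := Fintype.card Col with hN
  set c₀ : ℝ := (1 / 4) ^ 2 ^ N with hc₀
  have hc₀pos : 0 < c₀ := by positivity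
  let R : ι → (ι → V) → V → Prop := fun i y v => ‖v - X (W.z i)‖ ≤ W.r i ∧
    ∀ B : Finset ι, B.Nonempty → B.card ≤ n → (∀ j ∈ B, Encodable.encode j < Encodable.encode i) →
      (∃ x, 0 < W.b i x ∧ ∀ j ∈ B, 0 < W.b j x) →
      ∃ h : V, ‖h‖ = 1 ∧ (∀ j ∈ B, ∀ k ∈ B, inner ℝ h (y j - y k) = 0) ∧
        ∀ j ∈ B, c₀ * W.r i ≤ |inner ℝ h (v - y j)|
  have : Inhabited V := ⟨0⟩
  obtain ⟨y, hy⟩ : ∃ y : ι → V, ∀ i, R i y (y i) := by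
    refine exists_greedy (fun i => Encodable.encode i) R ?_ ?_
    · intro i y
      have hex : ∀ B : Finset ι, ∃ h : V, ‖h‖ = 1 ∧ (B.Nonempty → B.card ≤ n →
          ∀ j ∈ B, ∀ k ∈ B, inner ℝ h (y j - y k) = 0) := by
        intro B
        by_cases hB : B.Nonempty ∧ B.card ≤ n
        · obtain ⟨h, h1, h2⟩ := exists_unit_orthogonal y B hB.1 hB.2
          exact ⟨h, h1, fun _ _ => h2⟩
        · obtain ⟨h, h1, -⟩ := exists_unit_orthogonal y {i} (Finset.singleton_nonempty i)
            (by simpa using hV)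
          exact ⟨h, h1, fun h2 h3 => absurd ⟨h2, h3⟩ hB⟩
      choose h hh1 hh2 using hex
      obtain ⟨F, hF, hF'⟩ := W.exists_neighbours i
      obtain ⟨v, hv⟩ := exists_avoid_slabs h
        (fun B => if hB : B.Nonempty then inner ℝ (h B) (y hB.choose) else 0) hh1 (X (W.z i))
        (W.r_pos i) F.powerset
      obtain ⟨h1, h2⟩ := hv v (by simpa using (by have := W.r_pos i; positivity))
      refine ⟨v, h1, fun B hB hcard _ ⟨x, hx, hBx⟩ =>
        ⟨h B, hh1 B, hh2 B hB hcard, fun j hj => ?_⟩⟩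
      have h3 := h2 B (Finset.mem_powerset.2 fun k hk => hF' k x hx (hBx k hk))
      rw [dif_pos hB] at h3
      have e : inner ℝ (h B) (v - y j) = inner ℝ (h B) v - inner ℝ (h B) (y hB.choose) := by
        have := hh2 B hB hcard _ hB.choose_spec j hj
        rw [inner_sub_right] at this ⊢
        linarith
      rw [e]
      refine le_trans ?_ h3
      have := W.r_pos i
      gcongr
      rw [Finset.card_powerset, hc₀]
      exact pow_le_pow_of_le_one (by norm_num) (by norm_num)
        (Nat.pow_le_pow_right two_pos hF)
    · rintro i y y' v hyy ⟨h1, h2⟩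
      refine ⟨h1, fun B hB hcard hlt hx => ?_⟩
      obtain ⟨h, hh1, hh2, hh3⟩ := h2 B hB hcard hlt hx
      refine ⟨h, hh1, fun j hj k hk => ?_, fun j hj => ?_⟩
      · rw [← hyy j (hlt j hj), ← hyy k (hlt k hk)]; exact hh2 j hj k hk
      · rw [← hyy j (hlt j hj)]; exact hh3 j hj
  have hdual : ∀ τ : Finset ι, ∃ e : ι → V, τ.card ≤ n + 1 → (∃ x, ∀ i ∈ τ, 0 < W.b i x) →
        (τ.Nonempty → ∑ i ∈ τ, e i = 0) ∧
        (∀ i ∈ τ, ∀ j ∈ τ, ∀ k ∈ τ, inner ℝ (e i) (y j - y k)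
          = (if i = j then (1 : ℝ) else 0) - (if i = k then 1 else 0)) ∧
        ∀ i ∈ τ, ∀ j ∈ τ, ‖e i‖ ≤ vertConst K N n / W.r j := by
    intro τ
    by_cases hτ : τ.card ≤ n + 1 ∧ (∃ x, ∀ i ∈ τ, 0 < W.b i x)
    swap
    · exact ⟨0, fun h1 h2 => absurd ⟨h1, h2⟩ hτ⟩
    obtain ⟨hcard, x, hx⟩ := hτ
    rcases τ.eq_empty_or_nonempty with rfl | ⟨i₀, hi₀⟩
    · exact ⟨0, by simp⟩
    have hd : 0 < infDist x Z := W.infDist_pos (hx i₀ hi₀)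
    have hd1 : ∀ i ∈ τ, ∀ j ∈ τ, ‖y i - y j‖ ≤ 4 * (1 + K) * infDist x Z := by
      intro i hi j hj
      have e : y i - y j = (y i - X (W.z i)) + (X (W.z i) - X (W.z j)) - (y j - X (W.z j)) := by
        abel
      have h1 := hX _ (W.z_mem i) _ (W.z_mem j)
      have h2 := dist_triangle_right (W.z i) (W.z j) x
      have h3 := W.dist_z i x (hx i hi)
      have h4 := W.dist_z j x (hx j hj)
      have h5 := W.r_lt i x (hx i hi)
      have h6 := W.r_lt j x (hx j hj)
      rw [dist_eq_norm] at h1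
      rw [e]
      refine (norm_sub_le _ _).trans ?_
      have h7 := norm_add_le (y i - X (W.z i)) (X (W.z i) - X (W.z j))
      have h8 := (hy i).1
      have h9 := (hy j).1
      nlinarith
    have hd2 : ∀ i ∈ τ, ∀ B ⊆ τ, B.Nonempty →
        (∀ j ∈ B, Encodable.encode j < Encodable.encode i) → ∃ h : V, ‖h‖ = 1 ∧
          (∀ j ∈ B, ∀ k ∈ B, inner ℝ h (y j - y k) = 0) ∧
          ∀ j ∈ B, c₀ / 2 * infDist x Z ≤ |inner ℝ h (y i - y j)| := by
      intro i hi B hB hBne hlt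
      obtain ⟨h, hh1, hh2, hh3⟩ := (hy i).2 B hBne (by
        have : B.card < τ.card := Finset.card_lt_card ⟨hB, fun hc => by
          exact lt_irrefl _ (hlt i (hc hi))⟩
        omega) hlt ⟨x, hx i hi, fun j hj => hx j (hB hj)⟩
      refine ⟨h, hh1, hh2, fun j hj => le_trans ?_ (hh3 j hj)⟩
      have := W.lt_r i x (hx i hi)
      nlinarith
    obtain ⟨e, he1, he2, he3⟩ := exists_dual y (fun i => Encodable.encode i)
      Encodable.encode_injective (d := infDist x Z) (c := c₀ / 2) (G := 4 * (1 + K)) hd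
      (by positivity) (by positivity) τ hd1 hd2
    refine ⟨e, fun _ _ => ⟨he1, he2, fun i hi j hj => (he3 i hi).trans ?_⟩⟩
    have h1 : dualConst (4 * (1 + K)) (c₀ / 2) τ.card ≤ dualConst (4 * (1 + K)) (c₀ / 2) (n + 1) :=
      dualConst_mono (by positivity) (by positivity) hcard
    have h2 := W.r_pos j
    have h3 := W.r_lt j x (hx j hj)
    have h4 : 0 ≤ dualConst (4 * (1 + K)) (c₀ / 2) (n + 1) :=
      dualConst_nonneg (by positivity) (by positivity) _
    rw [vertConst, div_le_div_iff₀ hd h2]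
    nlinarith
  choose e he using hdual
  exact ⟨y, e, fun i => (hy i).1, he⟩

end Whitney

end WhitneyFamily

section Glue

lemma norm_sum_smul_sub_le {α E : Type*} [NormedAddCommGroup E] [NormedSpace ℝ E] (A : Finset α)
    (c c' : α → ℝ) (f f' : α → E) {η B δ : ℝ} (hη : 0 ≤ η) (hB : 0 ≤ B) (hδ : 0 ≤ δ)
    (h : ∀ i ∈ A, c i ≠ 0 ∨ c' i ≠ 0 →
      |c i - c' i| ≤ η ∧ |c' i| ≤ 1 ∧ ‖f i‖ ≤ B ∧ ‖f i - f' i‖ ≤ δ) :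
    ‖∑ i ∈ A, c i • f i - ∑ i ∈ A, c' i • f' i‖ ≤ A.card * (η * B + δ) := by
  rw [← Finset.sum_sub_distrib]
  refine (norm_sum_le _ _).trans ?_
  rw [← nsmul_eq_mul]
  refine Finset.sum_le_card_nsmul _ _ _ fun i hi => ?_
  by_cases hc : c i ≠ 0 ∨ c' i ≠ 0
  · obtain ⟨h1, h2, h3, h4⟩ := h i hi hc
    have e : c i • f i - c' i • f' i = (c i - c' i) • f i + c' i • (f i - f' i) := by
      rw [sub_smul, smul_sub]; abel
    rw [e]
    refine (norm_add_le _ _).trans ?_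
    rw [norm_smul, norm_smul, Real.norm_eq_abs, Real.norm_eq_abs]
    have := mul_le_mul h1 h3 (norm_nonneg _) hη
    have := mul_le_mul h2 h4 (norm_nonneg _) zero_le_one
    linarith
  · push Not at hc
    rw [hc.1, hc.2, zero_smul, zero_smul, sub_zero, norm_zero]
    positivity

lemma norm_sub_le_of_local {E F : Type*} [PseudoMetricSpace E] [SeminormedAddCommGroup F]
    {Z : Set E} {Φ : E → F} {C : ℝ} (hC : 0 ≤ C) (h1 : ∀ x, ‖Φ x‖ ≤ C * infDist x Z)
    (h2 : ∀ x x', 0 < infDist x Z → dist x x' ≤ infDist x Z / 2 →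
      ‖Φ x - Φ x'‖ ≤ C * dist x x') (x x' : E) : ‖Φ x - Φ x'‖ ≤ 4 * C * dist x x' := by
  have h0 : 0 ≤ C * dist x x' := mul_nonneg hC dist_nonneg
  by_cases hx : 0 < infDist x Z ∧ dist x x' ≤ infDist x Z / 2
  · have := h2 x x' hx.1 hx.2
    linarith
  by_cases hx' : 0 < infDist x' Z ∧ dist x x' ≤ infDist x' Z / 2
  · have := h2 x' x hx'.1 (by rw [dist_comm]; exact hx'.2)
    rw [norm_sub_rev, dist_comm] at this
    linarith
  have h3 : ∀ w, ¬ (0 < infDist w Z ∧ dist x x' ≤ infDist w Z / 2) →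
      infDist w Z ≤ 2 * dist x x' := by
    intro w hw
    by_contra! hcon
    have := dist_nonneg (x := x) (y := x')
    exact hw ⟨by linarith, by linarith⟩
  have h4 := h3 x hx
  have h5 := h3 x' hx'
  refine (norm_sub_le _ _).trans ?_
  have h6 := (h1 x).trans (mul_le_mul_of_nonneg_left h4 hC)
  have h7 := (h1 x').trans (mul_le_mul_of_nonneg_left h5 hC)
  linarith

end Glue

namespace Whitney

variable {m : ℕ} {Z : Set (Euc m)} {ι Col : Type} {K : ℝ} (W : Whitney m Z ι Col K)

/-- `i` is a neighbour of `x` up to the distance scale of `x`. -/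
def Near (i : ι) (x : Euc m) : Prop :=
  infDist x Z / 4 ≤ W.r i ∧ W.r i ≤ 3 * infDist x Z ∧
    dist (W.z i) x ≤ (3 * K + 1) * infDist x Z

lemma near_of_dist_le (hK : 0 ≤ K) {i : ι} {x x' : Euc m} (h : dist x x' ≤ infDist x Z / 2)
    (hb : 0 < W.b i x') : W.Near i x := by
  have h1 := W.lt_r i x' hb
  have h2 := W.r_lt i x' hb
  have h3 := W.dist_z i x' hb
  have h4 := infDist_le_infDist_add_dist (s := Z) (x := x) (y := x')
  have h5 := infDist_le_infDist_add_dist (s := Z) (x := x') (y := x)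
  rw [dist_comm] at h5
  have h6 := dist_triangle_right (W.z i) x x'
  have h7 : W.r i ≤ 3 * infDist x Z := by linarith
  refine ⟨by linarith, h7, ?_⟩
  have h8 := mul_le_mul_of_nonneg_left h7 hK
  linarith [infDist_nonneg (x := x) (s := Z)]

lemma near_of_pos (hK : 0 ≤ K) {i : ι} {x : Euc m} (hb : 0 < W.b i x) : W.Near i x :=
  W.near_of_dist_le hK (by rw [dist_self]; exact div_nonneg infDist_nonneg two_pos.le) hb

section Active

variable [Fintype Col]

lemma exists_active (x : Euc m) : ∃ F : Finset ι, F.card ≤ Fintype.card Col ∧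
    ∀ i, 0 < W.b i x → i ∈ F := by
  by_cases h : ∃ i, 0 < W.b i x
  · obtain ⟨i, hi⟩ := h
    obtain ⟨F, hF, hF'⟩ := W.exists_neighbours i
    exact ⟨F, hF, fun j hj => hF' j x hi hj⟩
  · exact ⟨∅, by simp, fun i hi => absurd ⟨i, hi⟩ h⟩

lemma finite_active (x : Euc m) : {i | 0 < W.b i x}.Finite := by
  obtain ⟨F, -, hF⟩ := W.exists_active x
  exact F.finite_toSet.subset hF

/-- The indices of the bump functions which are positive at `x`. -/
def act (x : Euc m) : Finset ι := (W.finite_active x).toFinset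

lemma mem_act {x : Euc m} {i : ι} : i ∈ W.act x ↔ 0 < W.b i x := by
  simp [act]

lemma card_act_le (x : Euc m) : (W.act x).card ≤ Fintype.card Col := by
  obtain ⟨F, hF, hF'⟩ := W.exists_active x
  exact (Finset.card_le_card fun i hi => hF' i (W.mem_act.1 hi)).trans hF

end Active

/-- The bump functions rescaled by the parameters attached to the colours. -/
def lam (ω : Col → ℝ) (x : Euc m) (i : ι) : ℝ := (1 + ω (W.col i)) * W.b i x

variable {ω : Col → ℝ}

lemma lam_le_two (hω : ∀ c, ω c ∈ Icc (0 : ℝ) 1) (x : Euc m) (i : ι) : W.lam ω x i ≤ 2 := by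
  have h1 := hω (W.col i)
  have h2 := W.b_le_one i x
  have h3 := W.b_nonneg i x
  rw [lam]; nlinarith [h1.1, h1.2]

lemma b_pos_of_lam_pos (hω : ∀ c, ω c ∈ Icc (0 : ℝ) 1) {x : Euc m} {i : ι}
    (h : 0 < W.lam ω x i) : 0 < W.b i x :=
  pos_of_mul_pos_right h (by linarith [(hω (W.col i)).1])

lemma finite_lam_pos [Fintype Col] (hω : ∀ c, ω c ∈ Icc (0 : ℝ) 1) (x : Euc m) :
    {i | 0 < W.lam ω x i}.Finite :=
  (W.finite_active x).subset fun _ h => W.b_pos_of_lam_pos hω h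

lemma abs_lam_sub_le (hK : 0 ≤ K) (hω : ∀ c, ω c ∈ Icc (0 : ℝ) 1) {x x' : Euc m}
    (hx : 0 < infDist x Z) (h : dist x x' ≤ infDist x Z / 2) (i : ι) :
    |W.lam ω x i - W.lam ω x' i| ≤ 8 * (dist x x' / infDist x Z) := by
  have hd := dist_nonneg (x := x) (y := x')
  by_cases hi : W.Near i x
  · have h1 := W.lip i x x'
    have h2 := hω (W.col i)
    rw [lam, lam, ← mul_sub, abs_mul, abs_of_nonneg (by linarith [h2.1])]
    have h3 : dist x x' / W.r i ≤ dist x x' / (infDist x Z / 4) := by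
      have := hi.1; gcongr
    have h4 : dist x x' / (infDist x Z / 4) = 4 * (dist x x' / infDist x Z) := by field_simp
    rw [h4] at h3
    nlinarith [h2.1, h2.2, abs_nonneg (W.b i x - W.b i x')]
  · have h1 : W.b i x = 0 := le_antisymm
      (not_lt.1 fun h' => hi (W.near_of_pos hK h')) (W.b_nonneg i x)
    have h2 : W.b i x' = 0 := le_antisymm
      (not_lt.1 fun h' => hi (W.near_of_dist_le hK h h')) (W.b_nonneg i x')
    rw [lam, lam, h1, h2, mul_zero, sub_zero, abs_zero]
    positivity

/-- The gap function which controls the derivatives of the extension. -/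
def gap (k : ℕ) (ω : Col → ℝ) (x : Euc m) : ℝ := gapStat k (W.lam ω x)

lemma gap_nonneg (k : ℕ) (hω : ∀ c, ω c ∈ Icc (0 : ℝ) 1) (x : Euc m) : 0 ≤ W.gap k ω x :=
  gapStat_nonneg two_pos.le (W.lam_le_two hω x)

lemma continuousAt_gap (hK : 0 ≤ K) (k : ℕ) (hω : ∀ c, ω c ∈ Icc (0 : ℝ) 1) {x : Euc m}
    (hx : 0 < infDist x Z) : ContinuousAt (W.gap k ω) x := by
  rw [Metric.continuousAt_iff]
  intro ε hε
  refine ⟨min (infDist x Z / 2) (ε * infDist x Z / 32), by positivity, fun {x'} hx' => ?_⟩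
  rw [dist_comm] at hx'
  have h1 := (lt_min_iff.1 hx').1.le
  have h2 := (lt_min_iff.1 hx').2
  have h3 := abs_ordStat_sub_le 0 two_pos.le (W.lam_le_two hω x) (W.lam_le_two hω x')
    (W.abs_lam_sub_le hK hω hx h1) (by positivity)
  have h4 := abs_ordStat_sub_le k two_pos.le (W.lam_le_two hω x) (W.lam_le_two hω x')
    (W.abs_lam_sub_le hK hω hx h1) (by positivity)
  have h5 : dist x x' / infDist x Z < ε / 32 := by
    rw [div_lt_div_iff₀ hx (by norm_num)]; linarith
  rw [dist_comm, Real.dist_eq, gap, gap, gapStat, gapStat]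
  have e : ordStat 0 (W.lam ω x) - ordStat k (W.lam ω x) -
      (ordStat 0 (W.lam ω x') - ordStat k (W.lam ω x')) =
      (ordStat 0 (W.lam ω x) - ordStat 0 (W.lam ω x')) -
      (ordStat k (W.lam ω x) - ordStat k (W.lam ω x')) := by ring
  rw [e]
  refine (abs_sub _ _).trans_lt ?_
  linarith

/-- The normalised coefficients. -/
def nu (k : ℕ) (ε : ℝ) (ω : Col → ℝ) (x : Euc m) : ι → ℝ := nuW k ε (W.lam ω x)

variable {k : ℕ} {ε : ℝ}

lemma nu_nonneg (hε : 0 < ε) (x : Euc m) (i : ι) : 0 ≤ W.nu k ε ω x i := nuW_nonneg hε i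

lemma b_pos_of_nu_pos (hω : ∀ c, ω c ∈ Icc (0 : ℝ) 1) {x : Euc m} {i : ι}
    (h : 0 < W.nu k ε ω x i) : 0 < W.b i x := W.b_pos_of_lam_pos hω (pos_of_nuW_pos h)

lemma nu_eq_zero [Fintype Col] (hε : 0 < ε) (hω : ∀ c, ω c ∈ Icc (0 : ℝ) 1) {x : Euc m} {i : ι}
    (h : i ∉ W.act x) : W.nu k ε ω x i = 0 :=
  le_antisymm (not_lt.1 fun h' => h (W.mem_act.2 (W.b_pos_of_nu_pos hω h'))) (W.nu_nonneg hε x i)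

lemma abs_nu_sub_le (hK : 0 ≤ K) (hε : 0 < ε) (hω : ∀ c, ω c ∈ Icc (0 : ℝ) 1) {x x' : Euc m}
    (hx : 0 < infDist x Z) (h : dist x x' ≤ infDist x Z / 2) (i : ι) :
    |W.nu k ε ω x i - W.nu k ε ω x' i| ≤ 32 / ε * (dist x x' / infDist x Z) := by
  refine (abs_nuW_sub_le hε two_pos.le (W.lam_le_two hω x) (W.lam_le_two hω x')
    (W.abs_lam_sub_le hK hω hx h) (by positivity) i).trans (le_of_eq ?_)
  field_simp; ring

/-- If a set of indices has nonzero weight at `x` then it is active at `x` and small. -/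
lemma of_wgtW_ne_zero (hε : 0 < ε) (hω : ∀ c, ω c ∈ Icc (0 : ℝ) 1) {x : Euc m} {A τ : Finset ι}
    (h : wgtW A (W.nu k ε ω x) τ ≠ 0) : (∀ i ∈ τ, 0 < W.b i x) ∧ τ.card ≤ k := by
  have h1 : ∀ i ∈ τ, 0 < W.nu k ε ω x i := fun i hi =>
    lt_of_le_of_ne (W.nu_nonneg hε x i) fun h0 => h (wgtW_eq_zero hi h0.symm)
  refine ⟨fun i hi => W.b_pos_of_nu_pos hω (h1 i hi), ?_⟩
  have h2 := encard_nuW_pos (k := k) (ε := ε) two_pos.le (W.lam_le_two hω x)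
  have h3 := (Set.encard_le_encard (s := (τ : Set ι)) h1).trans h2
  rw [Set.encard_coe_eq_coe_finsetCard] at h3
  exact_mod_cast h3

section Weights

variable [Fintype Col]

/-- The barycentric weights. -/
def kap (k : ℕ) (ε : ℝ) (ω : Col → ℝ) (x : Euc m) (i : ι) : ℝ := kapW (W.act x) (W.nu k ε ω x) i

/-- The weights of the sets of indices. -/
def wgt (k : ℕ) (ε : ℝ) (ω : Col → ℝ) (x : Euc m) (τ : Finset ι) : ℝ := wgtW (W.act x) (W.nu k ε ω x) τ

lemma kap_eq (hε : 0 < ε) (hω : ∀ c, ω c ∈ Icc (0 : ℝ) 1) {x : Euc m} {A : Finset ι}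
    (hA : W.act x ⊆ A) : W.kap k ε ω x = kapW A (W.nu k ε ω x) :=
  kapW_congr_finset hA fun _ _ h => (W.nu_eq_zero hε hω h).le

lemma kap_eq_zero (hε : 0 < ε) (hω : ∀ c, ω c ∈ Icc (0 : ℝ) 1) {x : Euc m} {i : ι}
    (h : i ∉ W.act x) : W.kap k ε ω x i = 0 :=
  kapW_eq_zero (by rw [W.nu_eq_zero hε hω h]; norm_num)

lemma kap_nonneg (x : Euc m) (i : ι) : 0 ≤ W.kap k ε ω x i := kapW_nonneg i

lemma abs_kap_le_one (hε : 0 < ε) (hω : ∀ c, ω c ∈ Icc (0 : ℝ) 1) (x : Euc m) (i : ι) :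
    |W.kap k ε ω x i| ≤ 1 := by
  rw [abs_of_nonneg (W.kap_nonneg x i)]
  by_cases hi : i ∈ W.act x
  · exact (Finset.single_le_sum (f := W.kap k ε ω x) (fun j _ => W.kap_nonneg x j) hi).trans
      sum_kapW_le_one
  · rw [W.kap_eq_zero hε hω hi]; exact zero_le_one

lemma sum_kap_smul {E : Type*} [AddCommGroup E] [Module ℝ E] (hε : 0 < ε)
    (hω : ∀ c, ω c ∈ Icc (0 : ℝ) 1) {x : Euc m} {A : Finset ι} (hA : W.act x ⊆ A) (f : ι → E) :
    ∑ i ∈ W.act x, W.kap k ε ω x i • f i = ∑ i ∈ A, W.kap k ε ω x i • f i :=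
  Finset.sum_subset hA fun i _ hi => by rw [W.kap_eq_zero hε hω hi, zero_smul]

lemma sum_wgt_smul {E : Type*} [AddCommGroup E] [Module ℝ E] (hε : 0 < ε)
    (hω : ∀ c, ω c ∈ Icc (0 : ℝ) 1) {x : Euc m} {A : Finset ι} (hA : W.act x ⊆ A)
    (f : Finset ι → E) :
    ∑ τ ∈ (W.act x).powerset, W.wgt k ε ω x τ • f τ =
      ∑ τ ∈ A.powerset, wgtW A (W.nu k ε ω x) τ • f τ :=
  sum_wgtW_smul_congr_finset hA (fun _ _ h => W.nu_eq_zero hε hω h) f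

lemma sum_kap_eq_one (hε : 0 < ε) (hω : ∀ c, ω c ∈ Icc (0 : ℝ) 1) {x : Euc m}
    (h : ε ≤ W.gap k ω x) : ∑ i ∈ W.act x, W.kap k ε ω x i = 1 := by
  obtain ⟨i, hi⟩ := exists_nuW_eq_one hε two_pos.le (W.lam_le_two hω x) (W.finite_lam_pos hω x) h
  refine sum_kapW_eq_one (i := i) (W.mem_act.2 (W.b_pos_of_nu_pos (k := k) (ε := ε) hω ?_)) hi
  rw [nu, hi]; exact one_pos

end Weights

end Whitney

section Construction

open Classical in
/-- A jet on `Z` satisfying the quantitative contact condition, extended to the whole space by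
Lipschitz functions, with vertices and dual vectors attached to a Whitney family. -/
structure Frame {m : ℕ} {Z : Set (Euc m)} {ι Col : Type} {K : ℝ} (W : Whitney m Z ι Col K)
    (V : Type) [NormedAddCommGroup V] [InnerProductSpace ℝ V] (n : ℕ) (c E : ℝ) where
  X : Euc m → V
  P : Euc m → V
  U : Euc m → ℝ
  y : ι → V
  e : Finset ι → ι → V
  lip_X : ∀ x x', ‖X x - X x'‖ ≤ c * dist x x'
  lip_P : ∀ x x', ‖P x - P x'‖ ≤ c * dist x x'
  lip_U : ∃ c', 0 ≤ c' ∧ ∀ x x', |U x - U x'| ≤ c' * dist x x'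
  bdd_P : ∃ M, 0 ≤ M ∧ ∀ z ∈ Z, ‖P z‖ ≤ M
  quad : ∀ z ∈ Z, ∀ z' ∈ Z, |U z' - U z - inner ℝ (P z) (X z' - X z)| ≤ 2 * dist z z' ^ 2
  y_near : ∀ i, ‖y i - X (W.z i)‖ ≤ W.r i
  sum_e : ∀ τ : Finset ι, τ.card ≤ n + 1 → (∃ x, ∀ i ∈ τ, 0 < W.b i x) → τ.Nonempty →
    ∑ i ∈ τ, e τ i = 0
  dual : ∀ τ : Finset ι, τ.card ≤ n + 1 → (∃ x, ∀ i ∈ τ, 0 < W.b i x) →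
    ∀ i ∈ τ, ∀ j ∈ τ, ∀ l ∈ τ, inner ℝ (e τ i) (y j - y l)
      = (if i = j then (1 : ℝ) else 0) - (if i = l then 1 else 0)
  norm_e : ∀ τ : Finset ι, τ.card ≤ n + 1 → (∃ x, ∀ i ∈ τ, 0 < W.b i x) →
    ∀ i ∈ τ, ∀ j ∈ τ, ‖e τ i‖ ≤ E / W.r j

namespace Frame

variable {m : ℕ} {Z : Set (Euc m)} {ι Col : Type} {K : ℝ} {W : Whitney m Z ι Col K}
  {V : Type} [NormedAddCommGroup V] [InnerProductSpace ℝ V] {n : ℕ} {c E : ℝ}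
  (Φ : Frame W V n c E)

/-- The Taylor polynomial of the jet at the `i`-th reference point. -/
def T (i : ι) (ξ : V) : ℝ := Φ.U (W.z i) + inner ℝ (Φ.P (W.z i)) (ξ - Φ.X (W.z i))

/-- The affine correction attached to a set of indices. -/
def S (τ : Finset ι) (ξ : V) : V := ∑ i ∈ τ, Φ.T i ξ • Φ.e τ i

lemma T_sub (i : ι) (ξ ξ' : V) : Φ.T i ξ - Φ.T i ξ' = inner ℝ (Φ.P (W.z i)) (ξ - ξ') := by
  simp only [T, inner_sub_right]
  ring

/-- Auxiliary bound on the vertices. -/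
def cY (K c : ℝ) : ℝ := 3 + c * (3 * K + 1)

lemma norm_y_sub_le (hc : 0 ≤ c) {i : ι} {x : Euc m} (h : W.Near i x) :
    ‖Φ.y i - Φ.X x‖ ≤ cY K c * infDist x Z := by
  have h1 := Φ.y_near i
  have h2 := Φ.lip_X (W.z i) x
  have h3 := mul_le_mul_of_nonneg_left h.2.2 hc
  have h4 := norm_sub_le_norm_sub_add_norm_sub (Φ.y i) (Φ.X (W.z i)) (Φ.X x)
  have h5 := h.2.1
  rw [cY]; linarith

lemma dist_z_le {i j : ι} {x : Euc m} (hi : W.Near i x) (hj : W.Near j x) :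
    dist (W.z i) (W.z j) ≤ (6 * K + 2) * infDist x Z := by
  have := dist_triangle_right (W.z i) (W.z j) x
  linarith [hi.2.2, hj.2.2]

lemma abs_T_sub_T_le (hK : 0 ≤ K) (hc : 0 ≤ c) {B : ℝ} {i j : ι} {x : Euc m} {ξ : V}
    (hi : W.Near i x) (hj : W.Near j x)
    (hξ : ‖ξ - Φ.X (W.z i)‖ ≤ B * infDist x Z) :
    |Φ.T i ξ - Φ.T j ξ| ≤
      (2 * (6 * K + 2) ^ 2 + c * (6 * K + 2) * B) * infDist x Z ^ 2 := by
  have e : Φ.T i ξ - Φ.T j ξ =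
      (Φ.U (W.z i) - Φ.U (W.z j) - inner ℝ (Φ.P (W.z j)) (Φ.X (W.z i) - Φ.X (W.z j))) +
      inner ℝ (Φ.P (W.z i) - Φ.P (W.z j)) (ξ - Φ.X (W.z i)) := by
    rw [T, T, inner_sub_left,
      show ξ - Φ.X (W.z j) = (ξ - Φ.X (W.z i)) + (Φ.X (W.z i) - Φ.X (W.z j)) by abel,
      inner_add_right]
    ring
  have hd : 0 ≤ infDist x Z := infDist_nonneg
  have h1 := dist_z_le hi hj
  have h2 := Φ.quad _ (W.z_mem j) _ (W.z_mem i)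
  rw [dist_comm] at h2
  have h3 : dist (W.z i) (W.z j) ^ 2 ≤ ((6 * K + 2) * infDist x Z) ^ 2 := by gcongr
  have h4 := (Φ.lip_P (W.z i) (W.z j)).trans (mul_le_mul_of_nonneg_left h1 hc)
  have h5 := abs_real_inner_le_norm (Φ.P (W.z i) - Φ.P (W.z j)) (ξ - Φ.X (W.z i))
  have h6 := mul_le_mul h4 hξ (norm_nonneg _) (by positivity)
  rw [e]
  refine (abs_add_le _ _).trans ?_
  linarith

/-- The bound for the corrections. -/
def cS (K c E B : ℝ) (n : ℕ) : ℝ :=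
  (n + 1) * ((2 * (6 * K + 2) ^ 2 + c * (6 * K + 2) * B) * (4 * E))

/-- The Lipschitz constant of the corrections. -/
def lS (K c E : ℝ) (n : ℕ) : ℝ := (n + 1) * (c * (6 * K + 2) * (4 * E))

lemma norm_e_le (hE : 0 ≤ E) {τ : Finset ι} {x : Euc m} (hd : 0 < infDist x Z)
    (hcard : τ.card ≤ n + 1) (hτ : ∃ x, ∀ i ∈ τ, 0 < W.b i x) (hnear : ∀ i ∈ τ, W.Near i x)
    {i : ι} (hi : i ∈ τ) : ‖Φ.e τ i‖ ≤ 4 * E / infDist x Z := by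
  refine (Φ.norm_e τ hcard hτ i hi i hi).trans ?_
  rw [div_le_div_iff₀ (W.r_pos i) hd]
  have := (hnear i hi).1
  nlinarith

lemma norm_S_le (hK : 0 ≤ K) (hc : 0 ≤ c) (hE : 0 ≤ E) {B : ℝ} (hB : 0 ≤ B) {τ : Finset ι}
    {x : Euc m} (hd : 0 < infDist x Z) (hcard : τ.card ≤ n + 1)
    (hτ : ∃ x, ∀ i ∈ τ, 0 < W.b i x) (hnear : ∀ i ∈ τ, W.Near i x) {ξ : V}
    (hξ : ∀ i ∈ τ, ‖ξ - Φ.X (W.z i)‖ ≤ B * infDist x Z) :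
    ‖Φ.S τ ξ‖ ≤ cS K c E B n * infDist x Z := by
  rcases τ.eq_empty_or_nonempty with rfl | ⟨j, hj⟩
  · rw [S, Finset.sum_empty, norm_zero, cS]; positivity
  have e : Φ.S τ ξ = ∑ i ∈ τ, (Φ.T i ξ - Φ.T j ξ) • Φ.e τ i := by
    simp only [sub_smul, Finset.sum_sub_distrib, S]
    rw [← Finset.smul_sum, Φ.sum_e τ hcard hτ ⟨j, hj⟩, smul_zero, sub_zero]
  rw [e]
  refine (norm_sum_le _ _).trans ?_
  have h1 : ∀ i ∈ τ, ‖(Φ.T i ξ - Φ.T j ξ) • Φ.e τ i‖ ≤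
      (2 * (6 * K + 2) ^ 2 + c * (6 * K + 2) * B) * (4 * E) * infDist x Z := by
    intro i hi
    rw [norm_smul, Real.norm_eq_abs]
    refine (mul_le_mul (Φ.abs_T_sub_T_le hK hc (hnear i hi) (hnear j hj) (hξ i hi))
      (Φ.norm_e_le hE hd hcard hτ hnear hi) (norm_nonneg _) (by positivity)).trans (le_of_eq ?_)
    field_simp
  refine (Finset.sum_le_card_nsmul _ _ _ h1).trans ?_
  rw [nsmul_eq_mul, cS]
  have h2 : (τ.card : ℝ) ≤ n + 1 := by exact_mod_cast hcard
  have h3 := mul_le_mul_of_nonneg_right h2 (show 0 ≤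
    (2 * (6 * K + 2) ^ 2 + c * (6 * K + 2) * B) * (4 * E) * infDist x Z by positivity)
  linarith

lemma norm_S_sub_le (hK : 0 ≤ K) (hc : 0 ≤ c) (hE : 0 ≤ E) {τ : Finset ι}
    {x : Euc m} (hd : 0 < infDist x Z) (hcard : τ.card ≤ n + 1)
    (hτ : ∃ x, ∀ i ∈ τ, 0 < W.b i x) (hnear : ∀ i ∈ τ, W.Near i x) (ξ ξ' : V) :
    ‖Φ.S τ ξ - Φ.S τ ξ'‖ ≤ lS K c E n * ‖ξ - ξ'‖ := by
  rcases τ.eq_empty_or_nonempty with rfl | ⟨j, hj⟩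
  · simp only [S, Finset.sum_empty, sub_self, norm_zero, lS]; positivity
  have e : Φ.S τ ξ - Φ.S τ ξ' =
      ∑ i ∈ τ, inner ℝ (Φ.P (W.z i) - Φ.P (W.z j)) (ξ - ξ') • Φ.e τ i := by
    simp only [inner_sub_left (Φ.P _), sub_smul, Finset.sum_sub_distrib, S]
    rw [← Finset.smul_sum, Φ.sum_e τ hcard hτ ⟨j, hj⟩, smul_zero, sub_zero,
      ← Finset.sum_sub_distrib]
    refine Finset.sum_congr rfl fun i _ => ?_
    rw [← sub_smul, T_sub]
  rw [e]
  refine (norm_sum_le _ _).trans ?_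
  have h1 : ∀ i ∈ τ, ‖inner ℝ (Φ.P (W.z i) - Φ.P (W.z j)) (ξ - ξ') • Φ.e τ i‖ ≤
      c * (6 * K + 2) * (4 * E) * ‖ξ - ξ'‖ := by
    intro i hi
    rw [norm_smul, Real.norm_eq_abs]
    have h4 := (Φ.lip_P (W.z i) (W.z j)).trans
      (mul_le_mul_of_nonneg_left (dist_z_le (hnear i hi) (hnear j hj)) hc)
    have h5 := (abs_real_inner_le_norm (Φ.P (W.z i) - Φ.P (W.z j)) (ξ - ξ')).trans
      (mul_le_mul_of_nonneg_right h4 (norm_nonneg _))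
    refine (mul_le_mul h5 (Φ.norm_e_le hE hd hcard hτ hnear hi) (norm_nonneg _)
      (by positivity)).trans (le_of_eq ?_)
    field_simp
  refine (Finset.sum_le_card_nsmul _ _ _ h1).trans ?_
  rw [nsmul_eq_mul, lS]
  have h2 : (τ.card : ℝ) ≤ n + 1 := by exact_mod_cast hcard
  have h3 := mul_le_mul_of_nonneg_right h2 (show 0 ≤
    c * (6 * K + 2) * (4 * E) * ‖ξ - ξ'‖ by positivity)
  linarith

section Extension

variable [Fintype Col]

/-- The deviation of the first component from `X`. -/
def devX (ε : ℝ) (ω : Col → ℝ) (x : Euc m) : V :=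
  ∑ i ∈ W.act x, W.kap (n + 1) ε ω x i • (Φ.y i - Φ.X x)

/-- The first component of the extension. -/
def extX (ε : ℝ) (ω : Col → ℝ) (x : Euc m) : V := Φ.X x + Φ.devX ε ω x

/-- The deviation of the second component from `P`. -/
def devP (ε : ℝ) (ω : Col → ℝ) (x : Euc m) : V :=
  ∑ i ∈ W.act x, W.kap (n + 1) ε ω x i • (Φ.P (W.z i) - Φ.P x) +
    ∑ τ ∈ (W.act x).powerset, W.wgt (n + 1) ε ω x τ • Φ.S τ (Φ.extX ε ω x)

/-- The second component of the extension. -/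
def extP (ε : ℝ) (ω : Col → ℝ) (x : Euc m) : V := Φ.P x + Φ.devP ε ω x

/-- The deviation of the third component from `U`. -/
def devU (ε : ℝ) (ω : Col → ℝ) (x : Euc m) : ℝ :=
  ∑ i ∈ W.act x, W.kap (n + 1) ε ω x i • (Φ.T i (Φ.extX ε ω x) - Φ.U x)

/-- The third component of the extension. -/
def extU (ε : ℝ) (ω : Col → ℝ) (x : Euc m) : ℝ := Φ.U x + Φ.devU ε ω x

variable {ε : ℝ} {ω : Col → ℝ}

omit [InnerProductSpace ℝ V] in
lemma norm_sum_smul_le [NormedSpace ℝ V] {α : Type} (A : Finset α) (c : α → ℝ) (f : α → V) {B : ℝ}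
    (hB : 0 ≤ B) (h : ∀ i ∈ A, c i ≠ 0 → |c i| ≤ 1 ∧ ‖f i‖ ≤ B) :
    ‖∑ i ∈ A, c i • f i‖ ≤ A.card * B := by
  have := norm_sum_smul_sub_le A c (fun _ => 0) f f zero_le_one hB le_rfl (fun i hi hc => by
    obtain ⟨h1, h2⟩ := h i hi (by simpa using hc)
    simpa using ⟨h1, h2⟩)
  simpa using this

/-- A local Lipschitz estimate for sums with barycentric weights. -/
lemma norm_sum_kap_sub_le {F : Type*} [NormedAddCommGroup F] [NormedSpace ℝ F]
    (hK : 0 ≤ K) (hε : 0 < ε) (hω : ∀ c, ω c ∈ Icc (0 : ℝ) 1) {x x' : Euc m}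
    (hx : 0 < infDist x Z) (h : dist x x' ≤ infDist x Z / 2) (f f' : ι → F) {B δ : ℝ}
    (hB : 0 ≤ B) (hδ : 0 ≤ δ) (h1 : ∀ i, W.Near i x → ‖f i‖ ≤ B * infDist x Z)
    (h2 : ∀ i, W.Near i x → ‖f i - f' i‖ ≤ δ * dist x x') :
    ‖∑ i ∈ W.act x, W.kap (n + 1) ε ω x i • f i - ∑ i ∈ W.act x', W.kap (n + 1) ε ω x' i • f' i‖
      ≤ 2 * Fintype.card Col *
        (64 * (1 + 2 * Fintype.card Col) / ε * B + δ) * dist x x' := by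
  classical
  set N := Fintype.card Col
  set A := W.act x ∪ W.act x' with hA
  have hcard : (A.card : ℝ) ≤ 2 * N := by
    have h1 : A.card ≤ _ := Finset.card_union_le (W.act x) (W.act x')
    have h2 := W.card_act_le x
    have h3 := W.card_act_le x'
    have : A.card ≤ 2 * N := by omega
    exact_mod_cast this
  have hnear : ∀ i ∈ A, W.Near i x := by
    intro i hi
    rcases Finset.mem_union.1 hi with hi | hi
    · exact W.near_of_pos hK (W.mem_act.1 hi)
    · exact W.near_of_dist_le hK h (W.mem_act.1 hi)
  have hη := W.abs_nu_sub_le (k := n + 1) hK hε hω hx h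
  set η := 32 / ε * (dist x x' / infDist x Z) with hη'
  have hη0 : 0 ≤ η := by positivity
  rw [W.sum_kap_smul hε hω Finset.subset_union_left (A := A),
    W.sum_kap_smul hε hω Finset.subset_union_right (A := A)]
  refine (norm_sum_smul_sub_le A _ _ f f' (η := 2 * (1 + 2 * N) * η) (B := B * infDist x Z)
    (δ := δ * dist x x') (by positivity) (by positivity) (by positivity) ?_).trans ?_
  · intro i hi _
    refine ⟨?_, W.abs_kap_le_one hε hω x' i, h1 i (hnear i hi), h2 i (hnear i hi)⟩
    rw [W.kap_eq hε hω (A := A) Finset.subset_union_left,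
      W.kap_eq hε hω (A := A) Finset.subset_union_right]
    refine (abs_kapW_sub_le hη hi).trans ?_
    gcongr
  · have e : 2 * (1 + 2 * (N : ℝ)) * η * (B * infDist x Z) + δ * dist x x' =
        (64 * (1 + 2 * N) / ε * B + δ) * dist x x' := by
      rw [hη']; field_simp; ring
    rw [e, mul_assoc]
    gcongr

/-- A local Lipschitz estimate for sums over sets of indices. -/
lemma norm_sum_wgt_sub_le {F : Type*} [NormedAddCommGroup F] [NormedSpace ℝ F]
    (hK : 0 ≤ K) (hε : 0 < ε) (hω : ∀ c, ω c ∈ Icc (0 : ℝ) 1) {x x' : Euc m}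
    (hx : 0 < infDist x Z) (h : dist x x' ≤ infDist x Z / 2) (f f' : Finset ι → F) {B δ : ℝ}
    (hB : 0 ≤ B) (hδ : 0 ≤ δ)
    (h1 : ∀ τ : Finset ι, τ.card ≤ n + 1 → (∃ x, ∀ i ∈ τ, 0 < W.b i x) → (∀ i ∈ τ, W.Near i x) →
      ‖f τ‖ ≤ B * infDist x Z ∧ ‖f τ - f' τ‖ ≤ δ * dist x x') :
    ‖∑ τ ∈ (W.act x).powerset, W.wgt (n + 1) ε ω x τ • f τ -
        ∑ τ ∈ (W.act x').powerset, W.wgt (n + 1) ε ω x' τ • f' τ‖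
      ≤ 2 ^ (2 * Fintype.card Col) *
        (128 * Fintype.card Col / ε * B + δ) * dist x x' := by
  classical
  set N := Fintype.card Col
  set A := W.act x ∪ W.act x' with hA
  have hcard' : A.card ≤ 2 * N := by
    have h1 : A.card ≤ _ := Finset.card_union_le (W.act x) (W.act x')
    have h2 := W.card_act_le x
    have h3 := W.card_act_le x'
    omega
  have hcard : (A.card : ℝ) ≤ 2 * N := by exact_mod_cast hcard'
  have hnear : ∀ i ∈ A, W.Near i x := by
    intro i hi
    rcases Finset.mem_union.1 hi with hi | hi
    · exact W.near_of_pos hK (W.mem_act.1 hi)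
    · exact W.near_of_dist_le hK h (W.mem_act.1 hi)
  have hη := W.abs_nu_sub_le (k := n + 1) hK hε hω hx h
  set η := 32 / ε * (dist x x' / infDist x Z) with hη'
  have hη0 : 0 ≤ η := by positivity
  rw [W.sum_wgt_smul hε hω Finset.subset_union_left (A := A),
    W.sum_wgt_smul hε hω Finset.subset_union_right (A := A)]
  refine (norm_sum_smul_sub_le A.powerset _ _ f f' (η := 2 * (2 * N) * η) (B := B * infDist x Z)
    (δ := δ * dist x x') (by positivity) (by positivity) (by positivity) ?_).trans ?_
  · intro τ hτ hne
    have hτA := Finset.mem_powerset.1 hτ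
    have hn : ∀ i ∈ τ, W.Near i x := fun i hi => hnear i (hτA hi)
    have h3 : τ.card ≤ n + 1 ∧ ∃ x, ∀ i ∈ τ, 0 < W.b i x := by
      rcases hne with hne | hne
      · obtain ⟨h4, h5⟩ := W.of_wgtW_ne_zero hε hω hne
        exact ⟨h5, x, h4⟩
      · obtain ⟨h4, h5⟩ := W.of_wgtW_ne_zero hε hω hne
        exact ⟨h5, x', h4⟩
    obtain ⟨h4, h5⟩ := h1 τ h3.1 h3.2 hn
    refine ⟨?_, ?_, h4, h5⟩
    · refine (abs_wgtW_sub_le (W.nu_nonneg hε x) (W.nu_nonneg hε x') hη hτA).trans ?_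
      gcongr
    · rw [abs_of_nonneg (wgtW_nonneg (W.nu_nonneg hε x') τ)]
      exact wgtW_le_one (W.nu_nonneg hε x') τ
  · have e : 2 * (2 * (N : ℝ)) * η * (B * infDist x Z) + δ * dist x x' =
        (128 * N / ε * B + δ) * dist x x' := by
      rw [hη']; field_simp; ring
    rw [e, mul_assoc, Finset.card_powerset]
    push_cast
    gcongr
    norm_num

end Extension

end Frame

end Construction

namespace Frame

variable {m : ℕ} {Z : Set (Euc m)} {ι Col : Type} {K : ℝ} {W : Whitney m Z ι Col K}
  {V : Type} [NormedAddCommGroup V] [InnerProductSpace ℝ V] {n : ℕ} {c E : ℝ}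
  (Φ : Frame W V n c E)

/-- The constant for the deviation of the first component. -/
def cDevX (N : ℕ) (K c : ℝ) : ℝ := 2 * N * (64 * (1 + 2 * N) * cY K c + c)

/-- The Lipschitz constant of the first component. -/
def cX (N : ℕ) (K c : ℝ) : ℝ := c + 4 * cDevX N K c

/-- The bound for the distance of the first component to the jet. -/
def cB (N : ℕ) (K c : ℝ) : ℝ := c * (3 * K + 1) + cDevX N K c

/-- The constant for the deviation of the second component. -/
def cDevP (N : ℕ) (K c E : ℝ) (n : ℕ) : ℝ :=
  2 * N * (64 * (1 + 2 * N) * (c * (3 * K + 1)) + c) +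
    2 ^ (2 * N) * ((128 * N + 1) * cS K c E (cB N K c) n + lS K c E n * cX N K c)

/-- The Lipschitz constant of the second component. -/
def cP (N : ℕ) (K c E : ℝ) (n : ℕ) : ℝ := c + 4 * cDevP N K c E n

lemma cY_nonneg (hK : 0 ≤ K) (hc : 0 ≤ c) : 0 ≤ cY K c := by rw [cY]; positivity

lemma cDevX_nonneg (N : ℕ) (hK : 0 ≤ K) (hc : 0 ≤ c) : 0 ≤ cDevX N K c := by
  have := cY_nonneg hK hc
  rw [cDevX]; positivity

lemma cX_nonneg (N : ℕ) (hK : 0 ≤ K) (hc : 0 ≤ c) : 0 ≤ cX N K c := by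
  have := cDevX_nonneg N hK hc
  rw [cX]; positivity

lemma cB_nonneg (N : ℕ) (hK : 0 ≤ K) (hc : 0 ≤ c) : 0 ≤ cB N K c := by
  have := cDevX_nonneg N hK hc
  rw [cB]; positivity

lemma cS_nonneg {B : ℝ} (n : ℕ) (hK : 0 ≤ K) (hc : 0 ≤ c) (hE : 0 ≤ E) (hB : 0 ≤ B) :
    0 ≤ cS K c E B n := by
  rw [cS]; positivity

lemma lS_nonneg (n : ℕ) (hK : 0 ≤ K) (hc : 0 ≤ c) (hE : 0 ≤ E) : 0 ≤ lS K c E n := by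
  rw [lS]; positivity

lemma cDevP_nonneg (N n : ℕ) (hK : 0 ≤ K) (hc : 0 ≤ c) (hE : 0 ≤ E) : 0 ≤ cDevP N K c E n := by
  have := cX_nonneg N hK hc
  have := cS_nonneg n hK hc hE (cB_nonneg N hK hc)
  have := lS_nonneg n hK hc hE
  rw [cDevP]; positivity

lemma cP_nonneg (N n : ℕ) (hK : 0 ≤ K) (hc : 0 ≤ c) (hE : 0 ≤ E) : 0 ≤ cP N K c E n := by
  have := cDevP_nonneg N n hK hc hE
  rw [cP]; positivity

variable [Fintype Col] {ε : ℝ} {ω : Col → ℝ}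

lemma add_div_le {a b ε : ℝ} (ha : 0 ≤ a) (hε : 0 < ε) (hε1 : ε ≤ 1) :
    a + b / ε ≤ (a + b) / ε := by
  rw [add_div]
  have := le_div_self ha hε hε1
  linarith

lemma norm_devX_le (hK : 0 ≤ K) (hc : 0 ≤ c) (hε : 0 < ε) (hω : ∀ c, ω c ∈ Icc (0 : ℝ) 1)
    (x : Euc m) : ‖Φ.devX ε ω x‖ ≤ cDevX (Fintype.card Col) K c * infDist x Z := by
  have hd : 0 ≤ infDist x Z := infDist_nonneg
  have hY := cY_nonneg hK hc
  refine (norm_sum_smul_le _ _ _ (B := cY K c * infDist x Z) (by positivity)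
    fun i hi _ => ⟨W.abs_kap_le_one hε hω x i,
      Φ.norm_y_sub_le hc (W.near_of_pos hK (W.mem_act.1 hi))⟩).trans ?_
  have h1 : ((W.act x).card : ℝ) ≤ Fintype.card Col := by exact_mod_cast W.card_act_le x
  have h2 : 0 ≤ (Fintype.card Col : ℝ) := by positivity
  rw [cDevX, ← mul_assoc]
  gcongr ?_ * _
  have h3 := mul_le_mul_of_nonneg_right h1 hY
  have h4 := mul_nonneg h2 hY
  have h5 := mul_nonneg h2 h4
  have h6 := mul_nonneg h2 hc
  nlinarith

lemma norm_devX_sub_le (hK : 0 ≤ K) (hc : 0 ≤ c) (hε : 0 < ε) (hε1 : ε ≤ 1)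
    (hω : ∀ c, ω c ∈ Icc (0 : ℝ) 1) (x x' : Euc m) :
    ‖Φ.devX ε ω x - Φ.devX ε ω x'‖ ≤ 4 * (cDevX (Fintype.card Col) K c / ε) * dist x x' := by
  have hY := cY_nonneg hK hc
  have hD := cDevX_nonneg (Fintype.card Col) hK hc
  refine norm_sub_le_of_local (Z := Z) (by positivity) (fun x => ?_) (fun x x' hx h => ?_) x x'
  · refine (Φ.norm_devX_le hK hc hε hω x).trans ?_
    have hd : 0 ≤ infDist x Z := infDist_nonneg
    have := le_div_self hD hε hε1
    gcongr
  · refine (norm_sum_kap_sub_le (n := n) hK hε hω hx h _ (fun i => Φ.y i - Φ.X x')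
      (B := cY K c) (δ := c) hY hc (fun i hi => Φ.norm_y_sub_le hc hi) (fun i _ => ?_)).trans ?_
    · rw [sub_sub_sub_cancel_left, norm_sub_rev]; exact Φ.lip_X x x'
    · gcongr
      have e0 : cDevX (Fintype.card Col) K c / ε = 2 * Fintype.card Col *
        ((64 * (1 + 2 * Fintype.card Col) * cY K c + c) / ε) := by rw [cDevX, mul_div_assoc]
      rw [e0]
      gcongr
      rw [add_div]
      have := le_div_self hc hε hε1
      have e : 64 * (1 + 2 * (Fintype.card Col : ℝ)) / ε * cY K c =
        64 * (1 + 2 * (Fintype.card Col : ℝ)) * cY K c / ε := by ring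
      linarith

lemma norm_extX_sub_le (hK : 0 ≤ K) (hc : 0 ≤ c) (hε : 0 < ε) (hε1 : ε ≤ 1)
    (hω : ∀ c, ω c ∈ Icc (0 : ℝ) 1) (x x' : Euc m) :
    ‖Φ.extX ε ω x - Φ.extX ε ω x'‖ ≤ cX (Fintype.card Col) K c / ε * dist x x' := by
  have h1 := Φ.norm_devX_sub_le hK hc hε hε1 hω x x'
  have h2 := Φ.lip_X x x'
  rw [extX, extX, add_sub_add_comm]
  refine (norm_add_le _ _).trans ?_
  refine le_trans (add_le_add h2 h1) ?_
  rw [← add_mul, cX, ← mul_div_assoc]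
  gcongr
  exact add_div_le hc hε hε1

lemma norm_extX_sub_X_le (hK : 0 ≤ K) (hc : 0 ≤ c) (hε : 0 < ε)
    (hω : ∀ c, ω c ∈ Icc (0 : ℝ) 1) {x : Euc m} {i : ι} (hi : W.Near i x) :
    ‖Φ.extX ε ω x - Φ.X (W.z i)‖ ≤ cB (Fintype.card Col) K c * infDist x Z := by
  have h1 := Φ.norm_devX_le hK hc hε hω x
  have h2 := Φ.lip_X x (W.z i)
  have h3 := mul_le_mul_of_nonneg_left hi.2.2 hc
  rw [dist_comm] at h3
  rw [extX, add_sub_right_comm, cB]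
  refine (norm_add_le _ _).trans ?_
  linarith

omit [Fintype Col] in
lemma norm_P_sub_le (hc : 0 ≤ c) {x : Euc m} {i : ι} (hi : W.Near i x) :
    ‖Φ.P (W.z i) - Φ.P x‖ ≤ c * (3 * K + 1) * infDist x Z := by
  have h2 := Φ.lip_P (W.z i) x
  have h3 := mul_le_mul_of_nonneg_left hi.2.2 hc
  linarith

lemma norm_devP_le (hK : 0 ≤ K) (hc : 0 ≤ c) (hE : 0 ≤ E) (hε : 0 < ε)
    (hω : ∀ c, ω c ∈ Icc (0 : ℝ) 1) (x : Euc m) :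
    ‖Φ.devP ε ω x‖ ≤ cDevP (Fintype.card Col) K c E n * infDist x Z := by
  have hd : 0 ≤ infDist x Z := infDist_nonneg
  have hX := cX_nonneg (Fintype.card Col) hK hc
  have hS := cS_nonneg n hK hc hE (cB_nonneg (Fintype.card Col) hK hc)
  have hL := lS_nonneg n hK hc hE
  have h1 : ((W.act x).card : ℝ) ≤ Fintype.card Col := by exact_mod_cast W.card_act_le x
  have h2 : 0 ≤ (Fintype.card Col : ℝ) := by positivity
  have b1 : ‖∑ i ∈ W.act x, W.kap (n + 1) ε ω x i • (Φ.P (W.z i) - Φ.P x)‖ ≤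
      (W.act x).card * (c * (3 * K + 1) * infDist x Z) :=
    norm_sum_smul_le _ _ _ (by positivity) fun i hi _ => ⟨W.abs_kap_le_one hε hω x i,
      Φ.norm_P_sub_le hc (W.near_of_pos hK (W.mem_act.1 hi))⟩
  have b2 : ‖∑ τ ∈ (W.act x).powerset, W.wgt (n + 1) ε ω x τ • Φ.S τ (Φ.extX ε ω x)‖ ≤
      (W.act x).powerset.card * (cS K c E (cB (Fintype.card Col) K c) n * infDist x Z) := by
    refine norm_sum_smul_le _ _ _ (by positivity) fun τ hτ hne => ⟨?_, ?_⟩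
    · rw [Whitney.wgt, abs_of_nonneg (wgtW_nonneg (W.nu_nonneg hε x) τ)]
      exact wgtW_le_one (W.nu_nonneg hε x) τ
    · obtain ⟨h4, h5⟩ := W.of_wgtW_ne_zero hε hω hne
      rcases τ.eq_empty_or_nonempty with rfl | ⟨j, hj⟩
      · rw [S, Finset.sum_empty, norm_zero]; positivity
      · exact Φ.norm_S_le hK hc hE (cB_nonneg _ hK hc) (W.infDist_pos (h4 j hj)) h5 ⟨x, h4⟩
          (fun i hi => W.near_of_pos hK (h4 i hi))
          fun i hi => Φ.norm_extX_sub_X_le hK hc hε hω (W.near_of_pos hK (h4 i hi))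
  have h3 : ((W.act x).powerset.card : ℝ) ≤ 2 ^ (2 * Fintype.card Col) := by
    rw [Finset.card_powerset]; push_cast
    exact pow_le_pow_right₀ one_le_two (by have := W.card_act_le x; omega)
  refine (norm_add_le _ _).trans ((add_le_add b1 b2).trans ?_)
  rw [cDevP, add_mul]
  refine add_le_add ?_ ?_
  · rw [← mul_assoc]
    gcongr ?_ * _
    have h0 : 0 ≤ c * (3 * K + 1) := by positivity
    have h3 := mul_le_mul_of_nonneg_right h1 h0
    have h4 := mul_nonneg h2 h0
    have h5 := mul_nonneg h2 h4
    have h6 := mul_nonneg h2 hc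
    nlinarith
  · rw [mul_assoc (2 ^ _)]
    gcongr
    have h7 := mul_nonneg h2 hS
    have h8 := mul_nonneg hL hX
    linarith

lemma norm_devP_sub_le (hK : 0 ≤ K) (hc : 0 ≤ c) (hE : 0 ≤ E) (hε : 0 < ε) (hε1 : ε ≤ 1)
    (hω : ∀ c, ω c ∈ Icc (0 : ℝ) 1) (x x' : Euc m) :
    ‖Φ.devP ε ω x - Φ.devP ε ω x'‖ ≤
      4 * (cDevP (Fintype.card Col) K c E n / ε) * dist x x' := by
  have hX := cX_nonneg (Fintype.card Col) hK hc
  have hS := cS_nonneg n hK hc hE (cB_nonneg (Fintype.card Col) hK hc)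
  have hL := lS_nonneg n hK hc hE
  have hD := cDevP_nonneg (Fintype.card Col) n hK hc hE
  refine norm_sub_le_of_local (Z := Z) (by positivity) (fun x => ?_) (fun x x' hx h => ?_) x x'
  · refine (Φ.norm_devP_le hK hc hE hε hω x).trans ?_
    have hd : 0 ≤ infDist x Z := infDist_nonneg
    have := le_div_self hD hε hε1
    gcongr
  · rw [devP, devP, add_sub_add_comm]
    have b1 := norm_sum_kap_sub_le (n := n) hK hε hω hx h (fun i => Φ.P (W.z i) - Φ.P x)
      (fun i => Φ.P (W.z i) - Φ.P x') (B := c * (3 * K + 1)) (δ := c) (by positivity) hc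
      (fun i hi => Φ.norm_P_sub_le hc hi)
      (fun i _ => by rw [sub_sub_sub_cancel_left, norm_sub_rev]; exact Φ.lip_P x x')
    have b2 := norm_sum_wgt_sub_le (n := n) hK hε hω hx h (fun τ => Φ.S τ (Φ.extX ε ω x))
      (fun τ => Φ.S τ (Φ.extX ε ω x')) (B := cS K c E (cB (Fintype.card Col) K c) n)
      (δ := lS K c E n * (cX (Fintype.card Col) K c / ε)) hS (by positivity)
      (fun τ hcard hτ hnear => ⟨Φ.norm_S_le hK hc hE (cB_nonneg _ hK hc) hx hcard hτ hnear
        fun i hi => Φ.norm_extX_sub_X_le hK hc hε hω (hnear i hi), by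
        refine (Φ.norm_S_sub_le hK hc hE hx hcard hτ hnear _ _).trans ?_
        rw [mul_assoc]
        exact mul_le_mul_of_nonneg_left (Φ.norm_extX_sub_le hK hc hε hε1 hω x x') hL⟩)
    refine (norm_add_le _ _).trans ((add_le_add b1 b2).trans ?_)
    rw [← add_mul]
    gcongr
    have e0 : cDevP (Fintype.card Col) K c E n / ε =
        2 * Fintype.card Col *
          ((64 * (1 + 2 * Fintype.card Col) * (c * (3 * K + 1)) + c) / ε) +
        2 ^ (2 * Fintype.card Col) *
          (((128 * Fintype.card Col + 1) * cS K c E (cB (Fintype.card Col) K c) n +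
            lS K c E n * cX (Fintype.card Col) K c) / ε) := by
      rw [cDevP, add_div, mul_div_assoc, mul_div_assoc]
    rw [e0]
    have h1 := le_div_self hc hε hε1
    have h2 := div_nonneg hS hε.le
    gcongr ?_ * ?_ + ?_ * ?_
    · rw [add_div]
      have e : 64 * (1 + 2 * (Fintype.card Col : ℝ)) / ε * (c * (3 * K + 1)) =
        64 * (1 + 2 * (Fintype.card Col : ℝ)) * (c * (3 * K + 1)) / ε := by ring
      linarith
    · rw [add_div]
      have e : 128 * (Fintype.card Col : ℝ) / ε * cS K c E (cB (Fintype.card Col) K c) n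
        + cS K c E (cB (Fintype.card Col) K c) n / ε =
        (128 * (Fintype.card Col : ℝ) + 1) * cS K c E (cB (Fintype.card Col) K c) n / ε := by ring
      rw [← mul_div_assoc]
      linarith

lemma norm_extP_sub_le (hK : 0 ≤ K) (hc : 0 ≤ c) (hE : 0 ≤ E) (hε : 0 < ε) (hε1 : ε ≤ 1)
    (hω : ∀ c, ω c ∈ Icc (0 : ℝ) 1) (x x' : Euc m) :
    ‖Φ.extP ε ω x - Φ.extP ε ω x'‖ ≤ cP (Fintype.card Col) K c E n / ε * dist x x' := by
  have h1 := Φ.norm_devP_sub_le hK hc hE hε hε1 hω x x'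
  have h2 := Φ.lip_P x x'
  rw [extP, extP, add_sub_add_comm]
  refine (norm_add_le _ _).trans ?_
  refine le_trans (add_le_add h2 h1) ?_
  rw [← add_mul, cP, ← mul_div_assoc]
  gcongr
  exact add_div_le hc hε hε1

lemma exists_extU_bound (hK : 0 ≤ K) (hc : 0 ≤ c) :
    ∃ C, 0 ≤ C ∧ ∀ ε ω, 0 < ε → ε ≤ 1 → (∀ c, ω c ∈ Icc (0 : ℝ) 1) →
      (∀ x, |Φ.devU ε ω x| ≤ C * infDist x Z) ∧
      ∀ x x', |Φ.extU ε ω x - Φ.extU ε ω x'| ≤ C / ε * dist x x' := by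
  obtain ⟨a, ha, hU⟩ := Φ.lip_U
  obtain ⟨M, hM, hP⟩ := Φ.bdd_P
  set N := Fintype.card Col
  have hX := cX_nonneg N hK hc
  have hB := cB_nonneg N hK hc
  set B := a * (3 * K + 1) + M * cB N K c with hBdef
  have hB0 : 0 ≤ B := by positivity
  set D := 2 * N * (64 * (1 + 2 * N) * B + (M * cX N K c + a)) with hD
  have hD0 : 0 ≤ D := by positivity
  have hT : ∀ ε ω, 0 < ε → (∀ c, ω c ∈ Icc (0 : ℝ) 1) → ∀ x i, W.Near i x →
      ‖Φ.T i (Φ.extX ε ω x) - Φ.U x‖ ≤ B * infDist x Z := by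
    intro ε ω hε hω x i hi
    have e : Φ.T i (Φ.extX ε ω x) - Φ.U x = (Φ.U (W.z i) - Φ.U x) +
      inner ℝ (Φ.P (W.z i)) (Φ.extX ε ω x - Φ.X (W.z i)) := by rw [T]; ring
    have h1 := (hU (W.z i) x).trans (mul_le_mul_of_nonneg_left hi.2.2 ha)
    have h2 := (abs_real_inner_le_norm (Φ.P (W.z i)) (Φ.extX ε ω x - Φ.X (W.z i))).trans
      (mul_le_mul (hP _ (W.z_mem i)) (Φ.norm_extX_sub_X_le hK hc hε hω hi) (norm_nonneg _) hM)
    rw [e, Real.norm_eq_abs]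
    refine (abs_add_le _ _).trans ?_
    rw [hBdef]
    linarith
  have hdev : ∀ ε ω, 0 < ε → (∀ c, ω c ∈ Icc (0 : ℝ) 1) → ∀ x,
      ‖Φ.devU ε ω x‖ ≤ D * infDist x Z := by
    intro ε ω hε hω x
    have hd : 0 ≤ infDist x Z := infDist_nonneg
    refine (norm_sum_smul_le _ _ _ (B := B * infDist x Z) (by positivity) fun i hi _ =>
      ⟨W.abs_kap_le_one hε hω x i,
        hT ε ω hε hω x i (W.near_of_pos hK (W.mem_act.1 hi))⟩).trans ?_
    have h1 : ((W.act x).card : ℝ) ≤ N := by exact_mod_cast W.card_act_le x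
    have h2 : 0 ≤ (N : ℝ) := by positivity
    rw [hD, ← mul_assoc]
    gcongr ?_ * _
    have h3 := mul_le_mul_of_nonneg_right h1 hB0
    have h4 := mul_nonneg h2 hB0
    have h5 := mul_nonneg h2 h4
    have h6 := mul_nonneg h2 (show 0 ≤ M * cX N K c + a by positivity)
    nlinarith
  refine ⟨a + 4 * D, by positivity, fun ε ω hε hε1 hω => ⟨fun x => ?_, fun x x' => ?_⟩⟩
  · refine (hdev ε ω hε hω x).trans ?_
    gcongr
    · exact infDist_nonneg
    · linarith
  have key : ‖Φ.devU ε ω x - Φ.devU ε ω x'‖ ≤ 4 * (D / ε) * dist x x' := by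
    refine norm_sub_le_of_local (Z := Z) (by positivity) (fun x => ?_) (fun x x' hx h => ?_) x x'
    · refine (hdev ε ω hε hω x).trans ?_
      have hd : 0 ≤ infDist x Z := infDist_nonneg
      have := le_div_self hD0 hε hε1
      gcongr
    · refine (norm_sum_kap_sub_le (n := n) hK hε hω hx h _
        (fun i => Φ.T i (Φ.extX ε ω x') - Φ.U x')
        (B := B) (δ := (M * cX N K c + a) / ε) hB0 (by positivity)
        (fun i hi => hT ε ω hε hω x i hi) (fun i _ => ?_)).trans ?_
      · rw [sub_sub_sub_comm, T_sub]
        have h1 := hU x x'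
        have h2 := (abs_real_inner_le_norm (Φ.P (W.z i)) (Φ.extX ε ω x - Φ.extX ε ω x')).trans
          (mul_le_mul (hP _ (W.z_mem i)) (Φ.norm_extX_sub_le hK hc hε hε1 hω x x')
            (norm_nonneg _) hM)
        refine (norm_sub_le _ _).trans ?_
        rw [Real.norm_eq_abs, Real.norm_eq_abs]
        have h3 : a * dist x x' ≤ a / ε * dist x x' := by
          have := le_div_self ha hε hε1
          gcongr
        have e : (M * cX N K c + a) / ε * dist x x' =
          M * (cX N K c / ε * dist x x') + a / ε * dist x x' := by ring
        rw [e]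
        linarith
      · gcongr
        have e0 : D / ε = 2 * N * ((64 * (1 + 2 * N) * B + (M * cX N K c + a)) / ε) := by
          rw [hD, mul_div_assoc]
        rw [e0]
        gcongr
        rw [add_div]
        apply le_of_eq
        ring
  rw [extU, extU, add_sub_add_comm]
  refine (abs_add_le _ _).trans ?_
  refine le_trans (add_le_add (hU x x') key) ?_
  rw [← add_mul, ← mul_div_assoc]
  gcongr
  exact add_div_le ha hε hε1

end Frame

namespace Frame

variable {m : ℕ} {Z : Set (Euc m)} {ι Col : Type} {K : ℝ} {W : Whitney m Z ι Col K}
  {V : Type} [NormedAddCommGroup V] [InnerProductSpace ℝ V] {n : ℕ} {c E : ℝ}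
  (Φ : Frame W V n c E) [Fintype Col] {ε ε' : ℝ} {ω : Col → ℝ}

omit [NormedAddCommGroup V] [InnerProductSpace ℝ V] in
lemma act_eq_empty {x : Euc m} (hx : x ∈ Z) : W.act x = ∅ := by
  refine Finset.eq_empty_of_forall_notMem fun i hi => ?_
  have := W.infDist_pos (W.mem_act.1 hi)
  rw [infDist_zero_of_mem hx] at this
  exact lt_irrefl _ this

lemma extX_of_mem {x : Euc m} (hx : x ∈ Z) : Φ.extX ε ω x = Φ.X x := by
  rw [extX, devX, act_eq_empty hx, Finset.sum_empty, add_zero]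

lemma extP_of_mem {x : Euc m} (hx : x ∈ Z) : Φ.extP ε ω x = Φ.P x := by
  have h : Φ.S ∅ (Φ.extX ε ω x) = 0 := by rw [S, Finset.sum_empty]
  rw [extP, devP, act_eq_empty hx, Finset.sum_empty, Finset.powerset_empty,
    Finset.sum_singleton, h, smul_zero, add_zero, add_zero]

lemma extU_of_mem {x : Euc m} (hx : x ∈ Z) : Φ.extU ε ω x = Φ.U x := by
  rw [extU, devU, act_eq_empty hx, Finset.sum_empty, add_zero]

omit [NormedAddCommGroup V] [InnerProductSpace ℝ V] [Fintype Col] in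
lemma nu_congr {k : ℕ} {x : Euc m} (h : ε ≤ W.gap k ω x) (h' : ε' ≤ W.gap k ω x) :
    W.nu k ε ω x = W.nu k ε' ω x := by
  funext i
  rw [Whitney.gap] at h h'
  rw [Whitney.nu, Whitney.nu, nuW, nuW, max_eq_left h, max_eq_left h']

lemma ext_congr {x : Euc m} (h : ε ≤ W.gap (n + 1) ω x) (h' : ε' ≤ W.gap (n + 1) ω x) :
    Φ.extX ε ω x = Φ.extX ε' ω x ∧ Φ.extP ε ω x = Φ.extP ε' ω x ∧
      Φ.extU ε ω x = Φ.extU ε' ω x := by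
  have h1 : W.kap (n + 1) ε ω x = W.kap (n + 1) ε' ω x := by
    funext i; rw [Whitney.kap, Whitney.kap, nu_congr h h']
  have h2 : W.wgt (n + 1) ε ω x = W.wgt (n + 1) ε' ω x := by
    funext i; rw [Whitney.wgt, Whitney.wgt, nu_congr h h']
  have h3 : Φ.extX ε ω x = Φ.extX ε' ω x := by rw [extX, extX, devX, devX, h1]
  refine ⟨h3, ?_, ?_⟩
  · rw [extP, extP, devP, devP, h1, h2, h3]
  · rw [extU, extU, devU, devU, h1, h3]

open Classical in
lemma inner_sum_eq {α : Type} {τ : Finset α} {e y : α → V}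
    (hdual : ∀ i ∈ τ, ∀ j ∈ τ, ∀ l ∈ τ, inner ℝ (e i) (y j - y l)
      = (if i = j then (1 : ℝ) else 0) - (if i = l then 1 else 0))
    (a : α → ℝ) (ha : ∑ j ∈ τ, a j = 0) {i : α} (hi : i ∈ τ) :
    inner ℝ (e i) (∑ j ∈ τ, a j • y j) = a i := by
  have h1 : ∑ j ∈ τ, a j • y j = ∑ j ∈ τ, a j • (y j - y i) := by
    simp only [smul_sub, Finset.sum_sub_distrib]
    rw [← Finset.sum_smul, ha, zero_smul, sub_zero]
  rw [h1, inner_sum]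
  have h2 : ∀ j ∈ τ, inner ℝ (e i) (a j • (y j - y i)) =
      a j * (if i = j then (1 : ℝ) else 0) - a j := by
    intro j hj
    rw [inner_smul_right, hdual i hi j hj i hi, if_pos rfl]; ring
  rw [Finset.sum_congr rfl h2, Finset.sum_sub_distrib, ha]
  simp [hi]

omit [Fintype Col] in
/-- The affine correction produces the derivative of the third component. -/
lemma inner_S_eq {τ : Finset ι} (hcard : τ.card ≤ n + 1) (hτ : ∃ x, ∀ i ∈ τ, 0 < W.b i x)
    (a : ι → ℝ) (ha : ∑ j ∈ τ, a j = 0) (ξ : V) :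
    inner ℝ (Φ.S τ ξ) (∑ j ∈ τ, a j • Φ.y j) = ∑ i ∈ τ, a i * Φ.T i ξ := by
  rw [S, sum_inner]
  refine Finset.sum_congr rfl fun i hi => ?_
  rw [inner_smul_left, inner_sum_eq (Φ.dual τ hcard hτ) a ha hi]
  simp [mul_comm]

lemma extX_eq (hε : 0 < ε) (hω : ∀ c, ω c ∈ Icc (0 : ℝ) 1) {x : Euc m}
    (h : ε ≤ W.gap (n + 1) ω x) {A : Finset ι} (hA : W.act x ⊆ A) :
    Φ.extX ε ω x = ∑ i ∈ A, W.kap (n + 1) ε ω x i • Φ.y i := by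
  rw [← W.sum_kap_smul hε hω hA, extX, devX]
  simp only [smul_sub, Finset.sum_sub_distrib]
  rw [← Finset.sum_smul, W.sum_kap_eq_one hε hω h, one_smul]
  abel

lemma extU_eq (hε : 0 < ε) (hω : ∀ c, ω c ∈ Icc (0 : ℝ) 1) {x : Euc m}
    (h : ε ≤ W.gap (n + 1) ω x) {A : Finset ι} (hA : W.act x ⊆ A) :
    Φ.extU ε ω x = ∑ i ∈ A, W.kap (n + 1) ε ω x i * Φ.T i (Φ.extX ε ω x) := by
  have := W.sum_kap_smul (k := n + 1) hε hω hA fun i => Φ.T i (Φ.extX ε ω x)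
  simp only [smul_eq_mul] at this
  rw [← this, extU, devU]
  simp only [smul_sub, Finset.sum_sub_distrib]
  rw [← Finset.sum_smul, W.sum_kap_eq_one hε hω h, one_smul]
  simp only [smul_eq_mul]
  ring

lemma extP_eq (hε : 0 < ε) (hω : ∀ c, ω c ∈ Icc (0 : ℝ) 1) {x : Euc m}
    (h : ε ≤ W.gap (n + 1) ω x) :
    Φ.extP ε ω x = ∑ i ∈ W.act x, W.kap (n + 1) ε ω x i • Φ.P (W.z i) +
      ∑ τ ∈ (W.act x).powerset, W.wgt (n + 1) ε ω x τ • Φ.S τ (Φ.extX ε ω x) := by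
  rw [extP, devP]
  simp only [smul_sub, Finset.sum_sub_distrib]
  rw [← Finset.sum_smul, W.sum_kap_eq_one hε hω h, one_smul]
  abel

omit [NormedAddCommGroup V] [InnerProductSpace ℝ V] in
lemma exists_half_gap (hε : 0 < ε) (hω : ∀ c, ω c ∈ Icc (0 : ℝ) 1) (k : ℕ) (x : Euc m) :
    ∃ g > 0, ∀ i, 1 / 2 - g < W.nu k ε ω x i → 1 / 2 ≤ W.nu k ε ω x i := by
  classical
  set B := (W.act x).filter fun i => W.nu k ε ω x i < 1 / 2 with hB
  rcases B.eq_empty_or_nonempty with h | h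
  · refine ⟨1 / 2, by norm_num, fun i hi => ?_⟩
    by_contra! hcon
    have hact : i ∈ W.act x := by
      by_contra h'
      rw [W.nu_eq_zero hε hω h'] at hi
      norm_num at hi
    have : i ∈ B := Finset.mem_filter.2 ⟨hact, hcon⟩
    rw [h] at this
    exact absurd this (Finset.notMem_empty _)
  · obtain ⟨i₀, hi₀, hmin⟩ := B.exists_max_image (W.nu k ε ω x) h
    have h0 := (Finset.mem_filter.1 hi₀).2
    refine ⟨1 / 2 - W.nu k ε ω x i₀, by linarith, fun i hi => ?_⟩
    by_contra! hcon
    have hact : i ∈ W.act x := by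
      by_contra h'
      rw [W.nu_eq_zero hε hω h'] at hi
      have := W.nu_nonneg (k := k) (ω := ω) hε x i₀
      linarith
    have := hmin i (Finset.mem_filter.2 ⟨hact, hcon⟩)
    linarith

/-- The contact condition holds to second order at the points where the gap is large. -/
lemma eventually_contact (hK : 0 ≤ K) (hc : 0 ≤ c) (hε : 0 < ε) (hε1 : ε ≤ 1)
    (hω : ∀ c, ω c ∈ Icc (0 : ℝ) 1) {x : Euc m} (hx : 0 < infDist x Z)
    (hgap : ε < W.gap (n + 1) ω x) :
    ∃ C, ∀ᶠ x' in nhds x, |Φ.extU ε ω x' - Φ.extU ε ω x -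
      inner ℝ (Φ.extP ε ω x) (Φ.extX ε ω x' - Φ.extX ε ω x)| ≤ C * dist x x' ^ 2 := by
  classical
  obtain ⟨M, hM, hP⟩ := Φ.bdd_P
  obtain ⟨g, hg, hg'⟩ := exists_half_gap (W := W) hε hω (n + 1) x
  set N := Fintype.card Col
  refine ⟨2 * N * (64 * (1 + 2 * N) / ε * (M / infDist x Z) + 0) * (cX N K c / ε), ?_⟩
  have e1 : ∀ᶠ x' in nhds x, ε < W.gap (n + 1) ω x' :=
    (W.continuousAt_gap hK (n + 1) hω hx).eventually (lt_mem_nhds hgap)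
  have e2 : ∀ᶠ x' in nhds x, dist x' x < min (infDist x Z / 2) (g * ε * infDist x Z / 32) :=
    Metric.eventually_nhds_iff.2 ⟨_, by positivity, fun _ h => h⟩
  filter_upwards [e1, e2] with x' hgap' hdist
  rw [dist_comm] at hdist
  have hd1 := (lt_min_iff.1 hdist).1.le
  have hd2 := (lt_min_iff.1 hdist).2
  set A := W.act x ∪ W.act x' with hA
  have hAx : W.act x ⊆ A := Finset.subset_union_left
  have hAx' : W.act x' ⊆ A := Finset.subset_union_right
  set κ := W.kap (n + 1) ε ω x with hκ
  set κ' := W.kap (n + 1) ε ω x' with hκ'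
  have hs : ∑ i ∈ A, κ i = 1 := by
    rw [← Finset.sum_subset hAx fun i _ hi => W.kap_eq_zero hε hω hi]
    exact W.sum_kap_eq_one hε hω hgap.le
  have hs' : ∑ i ∈ A, κ' i = 1 := by
    rw [← Finset.sum_subset hAx' fun i _ hi => W.kap_eq_zero hε hω hi]
    exact W.sum_kap_eq_one hε hω hgap'.le
  have hsupp : ∀ i, κ i ≠ 0 ∨ κ' i ≠ 0 → i ∈ W.act x ∧ 1 / 2 ≤ W.nu (n + 1) ε ω x i := by
    have hbig : ∀ i, 1 / 2 ≤ W.nu (n + 1) ε ω x i →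
        i ∈ W.act x ∧ 1 / 2 ≤ W.nu (n + 1) ε ω x i := by
      refine fun i hi => ⟨?_, hi⟩
      by_contra h'
      rw [W.nu_eq_zero hε hω h'] at hi
      norm_num at hi
    rintro i (hi | hi)
    · refine hbig i (not_lt.1 fun h' => hi (kapW_eq_zero h'.le))
    · have h1 : 1 / 2 < W.nu (n + 1) ε ω x' i := not_le.1 fun h' => hi (kapW_eq_zero h')
      have h2 := (abs_le.1 (W.abs_nu_sub_le (k := n + 1) hK hε hω hx hd1 i)).1
      have h3 : 32 / ε * (dist x x' / infDist x Z) < g := by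
        rw [div_mul_div_comm, div_lt_iff₀ (by positivity)]
        linarith
      exact hbig i (hg' i (by linarith))
  set δ : ι → ℝ := fun i => κ' i - κ i with hδ
  have hδ0 : ∀ i, δ i ≠ 0 → κ i ≠ 0 ∨ κ' i ≠ 0 := by
    intro i hi
    by_contra! h
    exact hi (by rw [hδ]; simp [h.1, h.2])
  set ξ := Φ.extX ε ω x with hξ
  set ξ' := Φ.extX ε ω x' with hξ'
  have hΔ : ξ' - ξ = ∑ i ∈ A, δ i • Φ.y i := by
    rw [hξ, hξ', Φ.extX_eq hε hω hgap.le hAx, Φ.extX_eq hε hω hgap'.le hAx',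
      ← Finset.sum_sub_distrib]
    exact Finset.sum_congr rfl fun i _ => (sub_smul _ _ _).symm
  have hS : ∀ τ ∈ (W.act x).powerset, W.wgt (n + 1) ε ω x τ * inner ℝ (Φ.S τ ξ) (ξ' - ξ) =
      W.wgt (n + 1) ε ω x τ * ∑ i ∈ A, δ i * Φ.T i ξ := by
    intro τ hτ
    by_cases hw : W.wgt (n + 1) ε ω x τ = 0
    · rw [hw, zero_mul, zero_mul]
    congr 1
    obtain ⟨h1, h2⟩ := W.of_wgtW_ne_zero hε hω hw
    have hτA : τ ⊆ A := (Finset.mem_powerset.1 hτ).trans hAx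
    have hmem : ∀ i, i ∉ τ → δ i = 0 := by
      intro i hi
      by_contra h
      obtain ⟨h3, h4⟩ := hsupp i (hδ0 i h)
      exact hi (mem_of_wgtW_ne_zero hw h3 h4)
    have h5 : ∑ i ∈ τ, δ i = 0 := by
      rw [Finset.sum_subset hτA fun i _ hi => hmem i hi, hδ, Finset.sum_sub_distrib, hs, hs',
        sub_self]
    rw [hΔ, ← Finset.sum_subset hτA fun i _ hi => by rw [hmem i hi, zero_smul],
      ← Finset.sum_subset hτA fun i _ hi => by rw [hmem i hi, zero_mul]]
    exact Φ.inner_S_eq h2 ⟨x, h1⟩ δ h5 ξ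
  have hPin : inner ℝ (Φ.extP ε ω x) (ξ' - ξ) =
      inner ℝ (∑ i ∈ A, κ i • Φ.P (W.z i)) (ξ' - ξ) + ∑ i ∈ A, δ i * Φ.T i ξ := by
    rw [Φ.extP_eq hε hω hgap.le, inner_add_left, sum_inner (W.act x).powerset,
      W.sum_kap_smul hε hω hAx]
    congr 1
    simp only [inner_smul_left, conj_trivial]
    rw [Finset.sum_congr rfl hS, ← Finset.sum_mul]
    have : ∑ τ ∈ (W.act x).powerset, W.wgt (n + 1) ε ω x τ = 1 := sum_wgtW
    rw [this, one_mul]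
  have hUin : Φ.extU ε ω x' - Φ.extU ε ω x =
      inner ℝ (∑ i ∈ A, κ' i • Φ.P (W.z i)) (ξ' - ξ) + ∑ i ∈ A, δ i * Φ.T i ξ := by
    rw [Φ.extU_eq hε hω hgap.le hAx, Φ.extU_eq hε hω hgap'.le hAx', sum_inner,
      ← Finset.sum_add_distrib, ← Finset.sum_sub_distrib]
    refine Finset.sum_congr rfl fun i _ => ?_
    rw [inner_smul_left, conj_trivial, ← Φ.T_sub, hδ]
    ring
  rw [hUin, hPin, add_sub_add_right_eq_sub, ← inner_sub_left]
  refine (abs_real_inner_le_norm _ _).trans ?_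
  have b1 := norm_sum_kap_sub_le (W := W) (n := n) hK hε hω hx hd1 (fun i => Φ.P (W.z i))
    (fun i => Φ.P (W.z i)) (B := M / infDist x Z) (δ := 0) (by positivity) le_rfl
    (fun i _ => by
      rw [div_mul_cancel₀ _ hx.ne']; exact hP _ (W.z_mem i))
    (fun i _ => by simp)
  rw [W.sum_kap_smul hε hω hAx, W.sum_kap_smul hε hω hAx', norm_sub_rev] at b1
  have b2 := Φ.norm_extX_sub_le hK hc hε hε1 hω x x'
  rw [norm_sub_rev] at b2
  refine (mul_le_mul b1 b2 (norm_nonneg _) (by positivity)).trans (le_of_eq ?_)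
  ring

/-- The contact condition holds to second order along `Z`. -/
lemma eventually_contact_of_mem {x : Euc m} (hx : x ∈ Z) :
    ∃ C, ∀ᶠ x' in nhdsWithin x Z, |Φ.extU ε ω x' - Φ.extU ε ω x -
      inner ℝ (Φ.extP ε ω x) (Φ.extX ε ω x' - Φ.extX ε ω x)| ≤ C * dist x x' ^ 2 := by
  refine ⟨2, eventually_mem_nhdsWithin.mono fun x' hx' => ?_⟩
  rw [Φ.extU_of_mem hx, Φ.extU_of_mem hx', Φ.extX_of_mem hx, Φ.extX_of_mem hx',
    Φ.extP_of_mem hx]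
  exact Φ.quad x hx x' hx'

end Frame

section Integrals

open scoped ENNReal

/-- A bound for the integral over an interval of length one of a negative power of the distance to
a point. -/
def lineConst (α : ℝ) : ℝ≥0∞ := (∫⁻ u in Icc (-1 : ℝ) 1, ENNReal.ofReal |u| ^ (-α)) + 1

lemma lineConst_lt_top {α : ℝ} (hα : α < 1) : lineConst α < ⊤ := by
  refine ENNReal.add_lt_top.2 ⟨?_, ENNReal.one_lt_top⟩
  have h1 : IntegrableOn (fun y : ℝ => y ^ (-α)) (Ioc 0 1) := by
    have := intervalIntegral.intervalIntegrable_rpow' (a := 0) (b := 1) (r := -α) (by linarith)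
    rwa [intervalIntegrable_iff_integrableOn_Ioc_of_le zero_le_one] at this
  have h2 : ∫⁻ u in Ioc (0 : ℝ) 1, ENNReal.ofReal |u| ^ (-α) < ⊤ := by
    refine lt_of_le_of_lt (le_of_eq ?_) h1.lintegral_lt_top
    refine setLIntegral_congr_fun measurableSet_Ioc fun u hu => ?_
    rw [abs_of_pos hu.1, ENNReal.ofReal_rpow_of_pos hu.1]
  have h3 : ∫⁻ u in Ico (-1 : ℝ) 0, ENNReal.ofReal |u| ^ (-α) < ⊤ := by
    have := (Measure.measurePreserving_neg (volume : Measure ℝ)).setLIntegral_comp_preimage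
      (s := Ioc (0 : ℝ) 1) (f := fun u => ENNReal.ofReal |u| ^ (-α)) measurableSet_Ioc
      (by fun_prop)
    simp only [abs_neg] at this
    rw [← this] at h2
    convert h2 using 3
    ext u; simp only [mem_Ico, mem_preimage, mem_Ioc]
    constructor <;> rintro ⟨h, h'⟩ <;> constructor <;> linarith
  rw [restrict_Ico_eq_restrict_Icc] at h3
  rw [← Icc_union_Ioc_eq_Icc (by norm_num : (-1 : ℝ) ≤ 0) zero_le_one]
  exact (lintegral_union_le _ _ _).trans_lt (ENNReal.add_lt_top.2 ⟨h3, h2⟩)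

lemma lintegral_rpow_abs_sub_le {α : ℝ} (hα : 0 < α) (a : ℝ) :
    ∫⁻ t in Icc (0 : ℝ) 1, ENNReal.ofReal |t - a| ^ (-α) ≤ lineConst α := by
  set f : ℝ → ℝ≥0∞ := (Icc (-1 : ℝ) 1).indicator fun u => ENNReal.ofReal |u| ^ (-α) with hf
  have h1 : ∀ t, ENNReal.ofReal |t - a| ^ (-α) ≤ f (t - a) + 1 := by
    intro t
    by_cases ht : t - a ∈ Icc (-1 : ℝ) 1
    · rw [hf, indicator_of_mem ht]; exact le_self_add
    · refine le_add_left ?_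
      refine ENNReal.rpow_le_one_of_one_le_of_neg ?_ (neg_lt_zero.2 hα)
      rw [ENNReal.one_le_ofReal]
      by_contra! h
      exact ht (abs_le.1 h.le)
  calc ∫⁻ t in Icc (0 : ℝ) 1, ENNReal.ofReal |t - a| ^ (-α)
      ≤ ∫⁻ t in Icc (0 : ℝ) 1, (f (t - a) + 1) := lintegral_mono h1
    _ = (∫⁻ t in Icc (0 : ℝ) 1, f (t - a)) + 1 := by
        rw [lintegral_add_right _ measurable_const]; simp
    _ ≤ (∫⁻ t, f (t - a)) + 1 := by gcongr; exact Measure.restrict_le_self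
    _ = lineConst α := by
        rw [lintegral_sub_right_eq_self f a, hf, lintegral_indicator measurableSet_Icc, lineConst]

lemma lintegral_rpow_abs_affine_le {α : ℝ} (hα : 0 < α) {b : ℝ} (hb : 1 / 16 ≤ b) (a : ℝ) :
    ∫⁻ t in Icc (0 : ℝ) 1, ENNReal.ofReal |(1 + t) * b - a| ^ (-α) ≤
      16 ^ α * lineConst α := by
  have h1 : ∀ t, ENNReal.ofReal |(1 + t) * b - a| ^ (-α) ≤
      16 ^ α * ENNReal.ofReal |t - (a / b - 1)| ^ (-α) := by
    intro t
    have h2 : (1 + t) * b - a = b * (t - (a / b - 1)) := by field_simp; ring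
    have h3 : (16 : ℝ≥0∞) ^ α = (ENNReal.ofReal (1 / 16)) ^ (-α) := by
      rw [ENNReal.rpow_neg, ← ENNReal.inv_rpow, ← ENNReal.ofReal_inv_of_pos (by norm_num)]
      norm_num
    rw [h3, ← ENNReal.mul_rpow_of_ne_top, ← ENNReal.ofReal_mul (by norm_num), h2, abs_mul,
      ENNReal.rpow_neg, ENNReal.rpow_neg]
    · rw [ENNReal.inv_le_inv]
      gcongr
      exact hb.trans (le_abs_self b)
    · exact ENNReal.ofReal_ne_top
    · exact ENNReal.ofReal_ne_top
  refine (lintegral_mono h1).trans ?_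
  rw [lintegral_const_mul _ (by fun_prop)]
  gcongr
  exact lintegral_rpow_abs_sub_le hα _

/-- The uniform probability measure on the cube of parameters. -/
def cubeMeasure (Col : Type) [Fintype Col] : Measure (Col → ℝ) :=
  Measure.pi fun _ => volume.restrict (Icc (0 : ℝ) 1)

instance : IsProbabilityMeasure (volume.restrict (Icc (0 : ℝ) 1)) := ⟨by simp⟩

instance (Col : Type) [Fintype Col] : IsProbabilityMeasure (cubeMeasure Col) := by
  unfold cubeMeasure; infer_instance

variable {Col : Type} [Fintype Col]

lemma cubeMeasure_compl : cubeMeasure Col {ω | ¬ ∀ c, ω c ∈ Icc (0 : ℝ) 1} = 0 := by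
  have : ∀ᵐ ω ∂cubeMeasure Col, ∀ c, ω c ∈ Icc (0 : ℝ) 1 := by
    rw [ae_all_iff]
    intro c
    have := Measure.quasiMeasurePreserving_eval
      (μ := fun _ : Col => volume.restrict (Icc (0 : ℝ) 1)) c
    exact this.ae (ae_restrict_mem measurableSet_Icc)
  exact this

lemma lintegral_prod_rpow_le {α : ℝ} (hα : 0 < α) {b : Col → ℝ} {c₀ : Col} (J : Finset Col)
    (hJ : c₀ ∉ J) (hb : ∀ c ∈ J, 1 / 16 ≤ b c) :
    ∫⁻ ω, ∏ c ∈ J, ENNReal.ofReal |(1 + ω c) * b c - (1 + ω c₀) * b c₀| ^ (-α) ∂cubeMeasure Col ≤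
      (16 ^ α * lineConst α) ^ J.card := by
  classical
  induction J using Finset.induction_on with
  | empty => simp
  | insert c J hc ih =>
    have ih' := ih (fun h => hJ (Finset.mem_insert_of_mem h))
      (fun c hc => hb c (Finset.mem_insert_of_mem hc))
    have hc0 : c₀ ≠ c := fun h => hJ (h ▸ Finset.mem_insert_self _ _)
    have hm : ∀ I : Finset Col, Measurable fun ω : Col → ℝ =>
        ∏ c ∈ I, ENNReal.ofReal |(1 + ω c) * b c - (1 + ω c₀) * b c₀| ^ (-α) := fun I => by
      fun_prop
    rw [Finset.card_insert_of_notMem hc, pow_succ']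
    refine le_trans ?_ (mul_le_mul_right ih' _)
    rw [← lintegral_const_mul _ (hm J)]
    refine lintegral_le_of_lmarginal_le {c} (hm _) ((hm J).const_mul _) fun ω => ?_
    rw [lmarginal_singleton, lmarginal_singleton]
    have h1 : ∀ t, ∏ i ∈ J, ENNReal.ofReal |(1 + Function.update ω c t i) * b i -
        (1 + Function.update ω c t c₀) * b c₀| ^ (-α) =
        ∏ i ∈ J, ENNReal.ofReal |(1 + ω i) * b i - (1 + ω c₀) * b c₀| ^ (-α) := by
      intro t
      refine Finset.prod_congr rfl fun i hi => ?_
      rw [Function.update_of_ne (fun h => hc (by rwa [← h])), Function.update_of_ne hc0]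
    simp only [Finset.prod_insert hc]
    simp_rw [h1]
    simp only [lintegral_const, measure_univ, mul_one, Function.update_self,
      Function.update_of_ne hc0]
    rw [lintegral_mul_const _ (by fun_prop)]
    gcongr
    exact lintegral_rpow_abs_affine_le hα (hb c (Finset.mem_insert_self _ _)) _

end Integrals

section GapIntegral

open scoped ENNReal

lemma ordStat_le_iff {ι : Type*} {k : ℕ} {a : ι → ℝ} {B t : ℝ} (hB : 0 ≤ B)
    (ha : ∀ i, a i ≤ B) :
    ordStat k a ≤ t ↔ 0 ≤ t ∧ ∀ J : Finset ι, J.card = k + 1 → ∃ i ∈ J, a i ≤ t := by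
  constructor
  · refine fun h => ⟨(ordStat_nonneg k a).trans h, fun J hJ => ?_⟩
    by_contra! hcon
    have h1 := (Set.encard_le_encard (s := (J : Set ι)) fun i hi =>
      h.trans_lt (hcon i hi)).trans (encard_ordStat_lt k hB ha)
    rw [Set.encard_coe_eq_coe_finsetCard, hJ] at h1
    have : k + 1 ≤ k := by exact_mod_cast h1
    omega
  · rintro ⟨ht, h⟩
    refine ordStat_le ht ?_
    by_contra! hcon
    have h1 : ((k + 1 : ℕ) : ℕ∞) ≤ {i | t < a i}.encard := by
      have := Order.add_one_le_of_lt hcon; exact_mod_cast this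
    obtain ⟨s, hs, hcard⟩ := Set.exists_subset_encard_eq h1
    have hfin : s.Finite := Set.finite_of_encard_eq_coe hcard
    obtain ⟨i, hi, hle⟩ := h hfin.toFinset (by
      rw [hfin.encard_eq_coe_toFinset_card] at hcard; exact_mod_cast hcard)
    exact absurd (hs (hfin.mem_toFinset.1 hi)) (not_lt.2 hle)

lemma measurable_ordStat {ι β : Type*} [Countable ι] [MeasurableSpace β] (k : ℕ)
    {a : β → ι → ℝ} (ha : ∀ i, Measurable fun s => a s i)
    (hb : ∀ s, ∃ B, 0 ≤ B ∧ ∀ i, a s i ≤ B) : Measurable fun s => ordStat k (a s) := by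
  refine measurable_of_Iic fun t => ?_
  have h1 : (fun s => ordStat k (a s)) ⁻¹' Iic t =
      {s | 0 ≤ t ∧ ∀ J : Finset ι, J.card = k + 1 → ∃ i ∈ J, a s i ≤ t} := by
    ext s
    obtain ⟨B, hB, hB'⟩ := hb s
    exact ordStat_le_iff hB hB'
  rw [h1]
  refine MeasurableSet.inter (MeasurableSet.const _) ?_
  have h2 : {s | ∀ J : Finset ι, J.card = k + 1 → ∃ i ∈ J, a s i ≤ t} =
      ⋂ J : Finset ι, ⋂ _ : J.card = k + 1, ⋃ i ∈ J, {s | a s i ≤ t} := by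
    ext s; simp
  change MeasurableSet {s | ∀ J : Finset ι, J.card = k + 1 → ∃ i ∈ J, a s i ≤ t}
  rw [h2]
  exact MeasurableSet.iInter fun J => MeasurableSet.iInter fun _ =>
    J.measurableSet_biUnion fun i _ => measurableSet_le (ha i) measurable_const

namespace Whitney

variable {m : ℕ} {Z : Set (Euc m)} {ι Col : Type} {K : ℝ} (W : Whitney m Z ι Col K)

lemma continuous_b (i : ι) : Continuous (W.b i) := by
  refine (LipschitzWith.of_dist_le_mul (K := (1 / W.r i).toNNReal) fun x x' => ?_).continuous
  rw [Real.coe_toNNReal _ (one_div_pos.2 (W.r_pos i)).le, Real.dist_eq, one_div_mul_eq_div]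
  exact W.lip i x x'

lemma measurable_gap [Countable ι] [Fintype Col] (k : ℕ) :
    Measurable fun s : (Col → ℝ) × Euc m => W.gap k s.1 s.2 := by
  have h1 : ∀ i, Measurable fun s : (Col → ℝ) × Euc m => W.lam s.1 s.2 i := by
    intro i
    have := (W.continuous_b i).measurable
    unfold lam
    fun_prop
  have h2 : ∀ s : (Col → ℝ) × Euc m, ∃ B, 0 ≤ B ∧ ∀ i, W.lam s.1 s.2 i ≤ B := by
    intro s
    have h0 : 0 ≤ ∑ c, |s.1 c| := Finset.sum_nonneg fun c _ => abs_nonneg _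
    refine ⟨1 + ∑ c, |s.1 c|, by linarith, fun i => ?_⟩
    have h3 := Finset.single_le_sum (f := fun c => |s.1 c|) (fun c _ => abs_nonneg _)
      (Finset.mem_univ (W.col i))
    have h4 := le_abs_self (s.1 (W.col i))
    have h5 := W.b_nonneg i s.2
    have h6 := W.b_le_one i s.2
    rw [lam]
    nlinarith
  exact (measurable_ordStat 0 h1 h2).sub (measurable_ordStat k h1 h2)

variable [Fintype Col]

open Classical in
/-- The value at `x` of the bump function of a given colour which is active at `x`. -/
def colB (x : Euc m) (c : Col) : ℝ := ∑ i ∈ (W.act x).filter (fun i => W.col i = c), W.b i x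

lemma colB_col {x : Euc m} {i : ι} (hi : 0 < W.b i x) : W.colB x (W.col i) = W.b i x := by
  classical
  rw [colB]
  have : (W.act x).filter (fun j => W.col j = W.col i) = {i} := by
    ext j
    rw [Finset.mem_filter, W.mem_act, Finset.mem_singleton]
    constructor
    · rintro ⟨h1, h2⟩
      exact W.col_inj i j i x x hi h1 hi hi h2
    · rintro rfl
      exact ⟨hi, rfl⟩
  rw [this, Finset.sum_singleton]

open Classical in
lemma rpow_gap_le {k : ℕ} (hk : 1 ≤ k) {p : ℝ} (hp : 0 < p) {ω : Col → ℝ}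
    (hω : ∀ c, ω c ∈ Icc (0 : ℝ) 1) {x : Euc m} (hx : x ∉ Z) :
    ENNReal.ofReal (W.gap k ω x) ^ (-p) ≤ 8 ^ p +
      ∑ q ∈ (Finset.univ : Finset (Col × Finset Col)).filter
        (fun q => q.1 ∉ q.2 ∧ q.2.card = k ∧ ∀ c ∈ q.2, 1 / 16 ≤ W.colB x c),
        ∏ c ∈ q.2, ENNReal.ofReal
          |(1 + ω c) * W.colB x c - (1 + ω q.1) * W.colB x q.1| ^ (-(p / k)) := by
  have hk0 : (0 : ℝ) < k := by exact_mod_cast hk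
  have hanti : ∀ {q s t : ℝ}, 0 < q → s ≤ t →
      ENNReal.ofReal t ^ (-q) ≤ ENNReal.ofReal s ^ (-q) := by
    intro q s t hq hst
    rw [ENNReal.rpow_neg, ENNReal.rpow_neg, ENNReal.inv_le_inv]
    gcongr
  obtain ⟨i₁, hi₁⟩ := W.exists_b x hx
  have h0 : 1 / 4 ≤ ordStat 0 (W.lam ω x) := by
    refine le_trans ?_ (le_ordStat_zero two_pos.le (W.lam_le_two hω x) i₁)
    rw [lam]
    nlinarith [(hω (W.col i₁)).1]
  rcases lt_or_ge (ordStat k (W.lam ω x)) (1 / 8) with h | h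
  · refine le_add_right ?_
    have h1 : 1 / 8 ≤ W.gap k ω x := by rw [gap, gapStat]; linarith
    refine (hanti hp h1).trans (le_of_eq ?_)
    rw [ENNReal.rpow_neg, ← ENNReal.inv_rpow, ← ENNReal.ofReal_inv_of_pos (by norm_num)]
    norm_num
  · obtain ⟨J, hJ, hJ'⟩ := exists_card_ordStat_le (by linarith) (W.finite_lam_pos hω x)
    have hpos : ∀ i ∈ J, 0 < W.b i x := fun i hi =>
      W.b_pos_of_lam_pos hω (by linarith [hJ' i hi])
    have hinj : Set.InjOn W.col J := fun i hi j hj hij =>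
      W.col_inj i i j x x (hpos i hi) (hpos i hi) (hpos i hi) (hpos j hj) hij
    obtain ⟨i₀, hi₀⟩ := Finset.card_pos.1 (by omega : 0 < J.card)
    have hsub : ∀ i ∈ J.erase i₀, i ∈ J := fun i hi => Finset.mem_of_mem_erase hi
    have hinj' : Set.InjOn W.col (J.erase i₀) := hinj.mono fun i hi => hsub i hi
    refine le_add_left ?_
    refine le_trans ?_ (Finset.single_le_sum (f := fun q : Col × Finset Col =>
      ∏ c ∈ q.2, ENNReal.ofReal
          |(1 + ω c) * W.colB x c - (1 + ω q.1) * W.colB x q.1| ^ (-(p / k)))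
      (fun _ _ => zero_le) (a := (W.col i₀, (J.erase i₀).image W.col)) ?_)
    · rw [Finset.prod_image hinj']
      have h1 : ENNReal.ofReal (W.gap k ω x) ^ (-p) =
          ∏ _i ∈ J.erase i₀, ENNReal.ofReal (W.gap k ω x) ^ (-(p / k)) := by
        rw [Finset.prod_const, Finset.card_erase_of_mem hi₀, hJ, Nat.add_sub_cancel,
          ← ENNReal.rpow_natCast, ← ENNReal.rpow_mul]
        congr 1
        field_simp
      rw [h1]
      refine Finset.prod_le_prod' fun i hi => hanti (by positivity) ?_
      rw [W.colB_col (hpos i (hsub i hi)), W.colB_col (hpos i₀ hi₀)]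
      change |W.lam ω x i - W.lam ω x i₀| ≤ _
      have e1 := hJ' i (hsub i hi)
      have e2 := hJ' i₀ hi₀
      have e3 := le_ordStat_zero two_pos.le (W.lam_le_two hω x) i
      have e4 := le_ordStat_zero two_pos.le (W.lam_le_two hω x) i₀
      rw [gap, gapStat, abs_le]
      constructor <;> linarith
    · simp only [Finset.mem_filter, Finset.mem_univ, true_and]
      refine ⟨?_, ?_, ?_⟩
      · intro hmem
        obtain ⟨i, hi, hii⟩ := Finset.mem_image.1 hmem
        exact Finset.ne_of_mem_erase hi (hinj (hsub i hi) hi₀ hii)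
      · rw [Finset.card_image_of_injOn hinj', Finset.card_erase_of_mem hi₀, hJ,
          Nat.add_sub_cancel]
      · intro c hc
        obtain ⟨i, hi, rfl⟩ := Finset.mem_image.1 hc
        rw [W.colB_col (hpos i (hsub i hi))]
        have h1 := hJ' i (hsub i hi)
        have h2 := hω (W.col i)
        have h3 := W.b_nonneg i x
        rw [lam] at h1
        nlinarith [h2.1, h2.2]

/-- The constant bounding the mean value of a negative power of the gap. -/
def gapConst (N k : ℕ) (p : ℝ) : ℝ≥0∞ :=
  8 ^ p + (N * 2 ^ N : ℕ) * (16 ^ (p / k) * lineConst (p / k)) ^ k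

lemma gapConst_lt_top (N : ℕ) {k : ℕ} {p : ℝ} (hp : 0 < p) (hpk : p < k) :
    gapConst N k p < ⊤ := by
  have hk0 : (0 : ℝ) < k := hp.trans hpk
  refine ENNReal.add_lt_top.2 ⟨ENNReal.rpow_lt_top_of_nonneg hp.le (by norm_num), ?_⟩
  refine ENNReal.mul_lt_top (ENNReal.natCast_lt_top _) (ENNReal.pow_lt_top ?_)
  refine ENNReal.mul_lt_top (ENNReal.rpow_lt_top_of_nonneg (by positivity) (by norm_num)) ?_
  exact lineConst_lt_top ((div_lt_one hk0).2 hpk)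

lemma lintegral_rpow_gap_le {k : ℕ} (hk : 1 ≤ k) {p : ℝ} (hp : 0 < p) {x : Euc m} (hx : x ∉ Z) :
    ∫⁻ ω, ENNReal.ofReal (W.gap k ω x) ^ (-p) ∂cubeMeasure Col ≤
      gapConst (Fintype.card Col) k p := by
  classical
  have hk0 : (0 : ℝ) < k := by exact_mod_cast hk
  have hcube : ∀ᵐ ω ∂cubeMeasure Col, ∀ c, ω c ∈ Icc (0 : ℝ) 1 := cubeMeasure_compl
  refine (lintegral_mono_ae (hcube.mono fun ω hω => W.rpow_gap_le hk hp hω hx)).trans ?_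
  rw [lintegral_add_left measurable_const, lintegral_finsetSum _ fun q _ => by fun_prop]
  rw [lintegral_const, measure_univ, mul_one, gapConst]
  gcongr
  refine (Finset.sum_le_card_nsmul _ _ ((16 ^ (p / k) * lineConst (p / k)) ^ k)
    fun q hq => ?_).trans ?_
  · obtain ⟨-, h1, h2, h3⟩ := Finset.mem_filter.1 hq
    exact (lintegral_prod_rpow_le (by positivity) q.2 h1 h3).trans (by rw [h2])
  · rw [nsmul_eq_mul]
    gcongr
    refine (Finset.card_filter_le _ _).trans ?_
    rw [Finset.card_univ, Fintype.card_prod, Fintype.card_finset]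

lemma exists_param [Countable ι] {k : ℕ} (hk : 1 ≤ k) {p : ℝ} (hp : 0 < p) {A : Set (Euc m)}
    (hAZ : ∀ x ∈ A, x ∉ Z) :
    ∃ ω : Col → ℝ, (∀ c, ω c ∈ Icc (0 : ℝ) 1) ∧
      ∫⁻ x in A, ENNReal.ofReal (W.gap k ω x) ^ (-p) ≤
        gapConst (Fintype.card Col) k p * volume A := by
  have hm : Measurable fun s : (Col → ℝ) × Euc m => ENNReal.ofReal (W.gap k s.1 s.2) ^ (-p) := by
    have := W.measurable_gap k
    fun_prop
  obtain ⟨ω, hω, hle⟩ := exists_notMem_null_le_lintegral (μ := cubeMeasure Col)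
    (f := fun ω => ∫⁻ x in A, ENNReal.ofReal (W.gap k ω x) ^ (-p))
    hm.lintegral_prod_right'.aemeasurable cubeMeasure_compl
  refine ⟨ω, by simpa using hω, hle.trans ?_⟩
  rw [lintegral_lintegral_swap hm.aemeasurable]
  refine (setLIntegral_mono measurable_const fun x hx =>
    W.lintegral_rpow_gap_le hk hp (hAZ x hx)).trans ?_
  rw [setLIntegral_const]

end Whitney

end GapIntegral

section SobolevLimit

open scoped ENNReal NNReal

lemma lipschitzOnWith_of_abs_sub_le {m : ℕ} {Ω : Set (Euc m)} {g : Euc m → ℝ} {C : ℝ} (hC : 0 ≤ C)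
    (h : ∀ x ∈ Ω, ∀ y ∈ Ω, |g x - g y| ≤ C * dist x y) : LipschitzOnWith C.toNNReal g Ω :=
  LipschitzOnWith.of_dist_le_mul fun x hx y hy => by
    rw [Real.coe_toNNReal _ hC, Real.dist_eq]; exact h x hx y hy

lemma exists_lipschitzWith_of_hasCompactSupport {m : ℕ} {φ : Euc m → ℝ} (hφ : ContDiff ℝ (⊤ : ℕ∞) φ)
    (hc : HasCompactSupport φ) : ∃ D : ℝ≥0, LipschitzWith D φ := by
  have h1 : Continuous (fderiv ℝ φ) := hφ.continuous_fderiv (by simp)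
  obtain ⟨D, hD⟩ := h1.bounded_above_of_compact_support (hc.fderiv ℝ)
  refine ⟨D.toNNReal, lipschitzWith_of_nnnorm_fderiv_le (hφ.differentiable (by simp)) fun x => ?_⟩
  rw [← NNReal.coe_le_coe, coe_nnnorm]
  exact (hD x).trans (Real.le_coe_toNNReal D)

lemma isWeakPartialDeriv_of_lipschitzOn {m : ℕ} {Ω : Set (Euc m)} (hΩ : IsOpen Ω)
    {g : Euc m → ℝ} {C : ℝ≥0} (h : LipschitzOnWith C g Ω) (k : Fin m) :
    IsWeakPartialDeriv m Ω g k fun x => fderiv ℝ g x (EuclideanSpace.single k 1) := by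
  intro φ hφ hc hs
  obtain ⟨g', hg', hgg'⟩ := h.extend_real
  obtain ⟨D, hD⟩ := exists_lipschitzWith_of_hasCompactSupport hφ hc
  have h0 : ∀ x, x ∉ Ω → φ x = 0 := fun x hx => image_eq_zero_of_notMem_tsupport fun hx' =>
    hx (hs hx')
  have h0' : ∀ x, x ∉ Ω → fderiv ℝ φ x = 0 := fun x hx =>
    image_eq_zero_of_notMem_tsupport fun hx' => hx (hs (tsupport_fderiv_subset ℝ hx'))
  set e : Euc m := EuclideanSpace.single k 1
  have h1 := LipschitzWith.integral_lineDeriv_mul_eq (μ := volume) hg' hD hc e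
  have h2 : ∫ x in Ω, g x * fderiv ℝ φ x e = ∫ x, g' x * fderiv ℝ φ x e := by
    refine Eq.trans (setIntegral_congr_fun hΩ.measurableSet fun x hx => ?_)
      (setIntegral_eq_integral_of_forall_compl_eq_zero fun x hx => ?_)
    · simp only [hgg' hx]
    · rw [h0' x hx]; simp
  have h3 : ∫ x in Ω, fderiv ℝ g x e * φ x = ∫ x, lineDeriv ℝ g' x e * φ x := by
    refine Eq.trans (setIntegral_congr_ae hΩ.measurableSet ?_)
      (setIntegral_eq_integral_of_forall_compl_eq_zero fun x hx => by rw [h0 x hx, mul_zero])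
    filter_upwards [hg'.ae_differentiableAt (μ := volume)] with x hx hxΩ
    have h4 : g =ᶠ[nhds x] g' := Filter.eventually_of_mem (hΩ.mem_nhds hxΩ) hgg'
    rw [h4.fderiv_eq, hx.lineDeriv_eq_fderiv]
  rw [h2, h3, h1, ← integral_neg]
  refine integral_congr_ae (Filter.Eventually.of_forall fun x => ?_)
  have h5 : DifferentiableAt ℝ φ x := (hφ.differentiable (by simp)) x
  simp only [h5.lineDeriv_eq_fderiv, map_neg]
  ring

/-- A function which agrees, off small sets, with Lipschitz functions whose constants are
controlled in `L^p` is a Sobolev function. -/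
lemma memW1pWith_of_locally_eventually_const {m : ℕ} {Ω : Set (Euc m)} (hΩ : IsOpen Ω)
    (hb : Bornology.IsBounded Ω) {p : ℝ} (hp : 1 ≤ p) {G : ℕ → Euc m → ℝ} {C B : ℝ} (hC : 0 ≤ C)
    (hlip : ∀ k, ∀ x ∈ Ω, ∀ y ∈ Ω, |G k x - G k y| ≤ C * (k + 1) * dist x y)
    (hB : ∀ k, ∀ x ∈ Ω, |G k x| ≤ B) {N : Euc m → ℕ} (hN : Measurable N)
    (heq : ∀ᵐ x ∂volume.restrict Ω, ∀ k, N x ≤ k →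
      G k x = G (N x) x ∧ fderiv ℝ (G k) x = fderiv ℝ (G (N x)) x)
    {I : ℝ≥0∞} (hI : I < ⊤) (hNI : ∫⁻ x in Ω, ((N x + 1 : ℕ) : ℝ≥0∞) ^ p ≤ I) :
    MemW1pWith m p Ω (fun x => G (N x) x)
      (fun k x => fderiv ℝ (G (N x)) x (EuclideanSpace.single k 1)) ∧
    ∀ k : Fin m, eLpNorm (fun x => fderiv ℝ (G (N x)) x (EuclideanSpace.single k 1))
      (ENNReal.ofReal p) (volume.restrict Ω) ≤ ENNReal.ofReal C * I ^ (1 / p) := by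
  have hp0 : 0 < p := by linarith
  have hpe0 : ENNReal.ofReal p ≠ 0 := by simpa using hp0
  have hfin : volume Ω < ⊤ := hb.measure_lt_top
  have : IsFiniteMeasure (volume.restrict Ω) := ⟨by simpa using hfin⟩
  have hL : ∀ k : ℕ, LipschitzOnWith (C * (k + 1)).toNNReal (G k) Ω := fun k =>
    lipschitzOnWith_of_abs_sub_le (by positivity) (hlip k)
  have hfd : ∀ k : ℕ, ∀ x ∈ Ω, ∀ i : Fin m,
      |fderiv ℝ (G k) x (EuclideanSpace.single i 1)| ≤ C * (k + 1) := by
    intro k x hx i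
    have h1 := norm_fderiv_le_of_lipschitzOn ℝ (hΩ.mem_nhds hx) (hL k)
    rw [Real.coe_toNNReal _ (by positivity)] at h1
    have h2 := (fderiv ℝ (G k) x).le_opNorm (EuclideanSpace.single i 1)
    rw [PiLp.norm_single, norm_one, mul_one, Real.norm_eq_abs] at h2
    exact h2.trans h1
  have hae : ∀ᵐ x ∂volume.restrict Ω, x ∈ Ω := ae_restrict_mem hΩ.measurableSet
  -- the limits
  have hlim : ∀ᵐ x ∂volume.restrict Ω,
      Filter.Tendsto (fun k => G k x) Filter.atTop (nhds (G (N x) x)) :=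
    heq.mono fun x hx => tendsto_const_nhds.congr' (Filter.eventually_atTop.2
      ⟨N x, fun k hk => ((hx k hk).1).symm⟩)
  have hlim' : ∀ i : Fin m, ∀ᵐ x ∂volume.restrict Ω,
      Filter.Tendsto (fun k => fderiv ℝ (G k) x (EuclideanSpace.single i 1)) Filter.atTop
        (nhds (fderiv ℝ (G (N x)) x (EuclideanSpace.single i 1))) := fun i =>
    heq.mono fun x hx => tendsto_const_nhds.congr' (Filter.eventually_atTop.2
      ⟨N x, fun k hk => by simp only [(hx k hk).2]⟩)
  have hmG : ∀ k, AEStronglyMeasurable (G k) (volume.restrict Ω) := fun k =>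
    (hL k).continuousOn.aestronglyMeasurable hΩ.measurableSet
  have hmd : ∀ k, ∀ i : Fin m, AEStronglyMeasurable
      (fun x => fderiv ℝ (G k) x (EuclideanSpace.single i 1)) (volume.restrict Ω) := fun k i =>
    (measurable_fderiv_apply_const ℝ (G k) _).aestronglyMeasurable
  have hmF : AEStronglyMeasurable (fun x => G (N x) x) (volume.restrict Ω) :=
    aestronglyMeasurable_of_tendsto_ae Filter.atTop hmG hlim
  have hmv : ∀ i : Fin m, AEStronglyMeasurable
      (fun x => fderiv ℝ (G (N x)) x (EuclideanSpace.single i 1)) (volume.restrict Ω) := fun i =>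
    aestronglyMeasurable_of_tendsto_ae Filter.atTop (fun k => hmd k i) (hlim' i)
  -- the dominating function
  have hmN : Measurable fun x => (N x : ℝ) + 1 :=
    (measurable_from_top (f := fun k : ℕ => (k : ℝ) + 1)).comp hN
  have hcast : ∀ x, ‖(N x : ℝ) + 1‖ₑ = ((N x + 1 : ℕ) : ℝ≥0∞) := by
    intro x
    rw [Real.enorm_eq_ofReal (by positivity), ← Nat.cast_add_one, ENNReal.ofReal_natCast]
  have hNLp : eLpNorm (fun x => (N x : ℝ) + 1) (ENNReal.ofReal p) (volume.restrict Ω) ≤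
      I ^ (1 / p) := by
    rw [eLpNorm_eq_lintegral_rpow_enorm_toReal hpe0 ENNReal.ofReal_ne_top,
      ENNReal.toReal_ofReal hp0.le]
    simp only [hcast]
    gcongr
  have hIp : I ^ (1 / p) < ⊤ := ENNReal.rpow_lt_top_of_nonneg (by positivity) hI.ne
  have hNmem : MemLp (fun x => (N x : ℝ) + 1) (ENNReal.ofReal p) (volume.restrict Ω) :=
    ⟨hmN.aestronglyMeasurable, hNLp.trans_lt hIp⟩
  have hNint : Integrable (fun x => (N x : ℝ) + 1) (volume.restrict Ω) :=
    hNmem.integrable (by rw [← ENNReal.ofReal_one]; exact ENNReal.ofReal_le_ofReal hp)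
  have hbd : ∀ i : Fin m, eLpNorm (fun x => fderiv ℝ (G (N x)) x (EuclideanSpace.single i 1))
      (ENNReal.ofReal p) (volume.restrict Ω) ≤ ENNReal.ofReal C * I ^ (1 / p) := by
    intro i
    refine (eLpNorm_le_mul_eLpNorm_of_ae_le_mul (c := C)
      (g := fun x => (N x : ℝ) + 1) ?_ _).trans (by gcongr)
    filter_upwards [hae] with x hx
    rw [Real.norm_eq_abs, Real.norm_eq_abs, abs_of_nonneg (by positivity : (0 : ℝ) ≤ N x + 1)]
    exact hfd _ x hx i
  refine ⟨⟨?_, fun i => ⟨⟨hmv i, (hbd i).trans_lt (ENNReal.mul_lt_top ENNReal.ofReal_lt_top hIp)⟩,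
    ?_⟩⟩, hbd⟩
  · exact MemLp.of_bound hmF B (hae.mono fun x hx => hB _ x hx)
  · intro φ hφ hc hs
    have hw := fun k => isWeakPartialDeriv_of_lipschitzOn hΩ (hL k) i φ hφ hc hs
    obtain ⟨M, hM⟩ := hφ.continuous.bounded_above_of_compact_support hc
    have hcd : Continuous fun x => fderiv ℝ φ x (EuclideanSpace.single i 1) :=
      (hφ.continuous_fderiv (by simp)).clm_apply continuous_const
    obtain ⟨M', hM'⟩ := hcd.bounded_above_of_compact_support (hc.fderiv_apply ℝ _)
    have t1 : Filter.Tendsto (fun k => ∫ x in Ω, G k x * fderiv ℝ φ x (EuclideanSpace.single i 1))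
        Filter.atTop
        (nhds (∫ x in Ω, G (N x) x * fderiv ℝ φ x (EuclideanSpace.single i 1))) := by
      refine tendsto_integral_of_dominated_convergence (fun _ => B * M')
        (fun k => (hmG k).mul hcd.aestronglyMeasurable) (integrable_const _) (fun k => ?_)
        (hlim.mono fun x hx => hx.mul_const _)
      filter_upwards [hae] with x hx
      rw [norm_mul]
      exact mul_le_mul (hB k x hx) (hM' x) (norm_nonneg _) ((abs_nonneg _).trans (hB k x hx))
    have t2 : Filter.Tendsto (fun k => ∫ x in Ω, fderiv ℝ (G k) x (EuclideanSpace.single i 1) * φ x)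
        Filter.atTop
        (nhds (∫ x in Ω, fderiv ℝ (G (N x)) x (EuclideanSpace.single i 1) * φ x)) := by
      refine tendsto_integral_of_dominated_convergence (fun x => C * (N x + 1) * M)
        (fun k => (hmd k i).mul hφ.continuous.aestronglyMeasurable)
        ((hNint.const_mul C).mul_const M) (fun k => ?_)
        ((hlim' i).mono fun x hx => hx.mul_const _)
      filter_upwards [hae, heq] with x hx hxe
      rw [norm_mul]
      refine mul_le_mul ?_ (hM x) (norm_nonneg _) (by positivity)
      rw [Real.norm_eq_abs]
      rcases le_total (N x) k with h | h
      · rw [(hxe k h).2]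
        exact hfd _ x hx i
      · refine (hfd k x hx i).trans ?_
        gcongr
    exact tendsto_nhds_unique t1 (t2.neg.congr fun k => (hw k).symm)

end SobolevLimit

section Density

open scoped Pointwise

/-- At almost every point of a measurable set, a differentiable function which vanishes to second
order along the set has vanishing derivative. -/
lemma ae_fderiv_eq_zero_of_sq {m : ℕ} {A : Set (Euc m)} (hA : MeasurableSet A) :
    ∀ᵐ x ∂volume.restrict A, ∀ u : Euc m → ℝ, DifferentiableAt ℝ u x →
      (∃ C : ℝ, ∀ᶠ y in nhdsWithin x A, |u y - u x| ≤ C * dist x y ^ 2) → fderiv ℝ u x = 0 := by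
  filter_upwards [Besicovitch.ae_tendsto_measure_inter_div volume A,
    ae_restrict_mem hA] with x hx hxA u hu ⟨C, hC⟩
  set l := fderiv ℝ u x with hl
  -- the derivative is negligible along the set
  have h1 : ∀ ε > 0, ∀ᶠ y in nhdsWithin x A, |l (y - x)| ≤ ε * ‖y - x‖ := by
    intro ε hε
    have h2 := hu.hasFDerivAt.hasFDerivWithinAt (s := A)
    have h3 := h2.isLittleO.def (half_pos hε)
    have h4 : ∀ᶠ y in nhdsWithin x A, |C| * ‖y - x‖ ≤ ε / 2 := by
      have : Filter.Tendsto (fun y => |C| * ‖y - x‖) (nhdsWithin x A) (nhds (|C| * ‖x - x‖)) :=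
        (Continuous.tendsto (by fun_prop) x).mono_left nhdsWithin_le_nhds
      rw [sub_self, norm_zero, mul_zero] at this
      exact (this.eventually_lt_const (half_pos hε)).mono fun y hy => hy.le
    filter_upwards [h3, h4, hC] with y e1 e2 e3
    rw [Real.norm_eq_abs] at e1
    have e4 : |u y - u x| ≤ ε / 2 * ‖y - x‖ := by
      refine e3.trans ?_
      rw [dist_comm, dist_eq_norm]
      have := norm_nonneg (y - x)
      have := le_abs_self C
      calc C * ‖y - x‖ ^ 2 ≤ |C| * ‖y - x‖ ^ 2 := by gcongr
        _ = |C| * ‖y - x‖ * ‖y - x‖ := by ring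
        _ ≤ ε / 2 * ‖y - x‖ := by gcongr
    have e5 : |l (y - x)| ≤ |u y - u x - l (y - x)| + |u y - u x| := by
      have := abs_sub_abs_le_abs_sub (l (y - x)) (u y - u x)
      rw [abs_sub_comm (l (y - x))] at this
      linarith
    linarith
  ext v
  rw [_root_.zero_apply]
  have key : ∀ ε, 0 < ε → |l v| ≤ ε * (‖v‖ + ε) + ‖l‖ * ε := by
    intro ε hε
    have B₁ : ∀ᶠ r in nhdsWithin (0 : ℝ) (Ioi 0), (A ∩ ({x} + r • closedBall v ε)).Nonempty :=
      Measure.eventually_nonempty_inter_smul_of_density_one volume A x hx _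
        measurableSet_closedBall (measure_closedBall_pos volume v hε).ne'
    obtain ⟨ρ, ρpos, hρ⟩ := mem_nhdsWithin_iff.1 (h1 ε hε)
    have B₂ : ∀ᶠ r in nhdsWithin (0 : ℝ) (Ioi 0), {x} + r • closedBall v ε ⊆ ball x ρ := by
      apply nhdsWithin_le_nhds
      exact eventually_singleton_add_smul_subset isBounded_closedBall (ball_mem_nhds x ρpos)
    obtain ⟨r, ⟨y, ⟨ys, hy⟩⟩, rρ, rpos⟩ :
      ∃ r : ℝ,
        (A ∩ ({x} + r • closedBall v ε)).Nonempty ∧ {x} + r • closedBall v ε ⊆ ball x ρ ∧ 0 < r :=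
      (B₁.and (B₂.and self_mem_nhdsWithin)).exists
    have hy' : |l (y - x)| ≤ ε * ‖y - x‖ := hρ ⟨rρ hy, ys⟩
    obtain ⟨w, hw, rfl⟩ : ∃ w ∈ closedBall v ε, x + r • w = y := by
      obtain ⟨_, rfl, _, ⟨w, hw, rfl⟩, h⟩ := hy
      exact ⟨w, hw, h⟩
    rw [add_sub_cancel_left, map_smul, smul_eq_mul, abs_mul, norm_smul, Real.norm_eq_abs,
      abs_of_pos rpos, mul_left_comm] at hy'
    have h5 := le_of_mul_le_mul_left hy' rpos
    have hwv : ‖w - v‖ ≤ ε := by rw [← dist_eq_norm]; exact hw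
    have h6 : |l w - l v| ≤ ‖l‖ * ε := by
      rw [← map_sub, ← Real.norm_eq_abs]
      exact (l.le_opNorm _).trans (by gcongr)
    have h7 : ‖w‖ ≤ ‖v‖ + ε := (norm_le_norm_add_norm_sub' w v).trans (by linarith)
    have h8 : ε * ‖w‖ ≤ ε * (‖v‖ + ε) := by gcongr
    have h9 := abs_sub_abs_le_abs_sub (l v) (l w)
    rw [abs_sub_comm] at h9
    linarith
  have hlim : Filter.Tendsto (fun ε : ℝ => ε * (‖v‖ + ε) + ‖l‖ * ε) (nhdsWithin 0 (Ioi 0))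
      (nhds (0 * (‖v‖ + 0) + ‖l‖ * 0)) :=
    Filter.Tendsto.mono_left (Continuous.tendsto (by fun_prop) 0) nhdsWithin_le_nhds
  rw [zero_mul, mul_zero, add_zero] at hlim
  refine abs_nonpos_iff.1 (ge_of_tendsto hlim ?_)
  filter_upwards [self_mem_nhdsWithin] with ε hε using key ε hε

lemma ae_differentiableAt_of_lipschitzOn {m : ℕ} {Ω : Set (Euc m)} (hΩ : IsOpen Ω)
    {g : Euc m → ℝ} {C : NNReal} (h : LipschitzOnWith C g Ω) :
    ∀ᵐ x ∂volume.restrict Ω, DifferentiableAt ℝ g x := by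
  obtain ⟨g', hg', hgg'⟩ := h.extend_real
  filter_upwards [ae_restrict_mem hΩ.measurableSet,
    ae_restrict_of_ae (hg'.ae_differentiableAt (μ := volume))] with x hx hd
  exact hd.congr_of_eventuallyEq (Filter.eventually_of_mem (hΩ.mem_nhds hx) hgg')

/-- A sequence of locally Lipschitz functions which is eventually constant near almost every point
off a closed set, and constant on this set, has eventually constant derivatives. -/
lemma ae_eventually_const {m : ℕ} {Ω Z : Set (Euc m)} (hΩ : IsOpen Ω) (hZ : IsClosed Z)
    {G : ℕ → Euc m → ℝ} {C : ℕ → NNReal} (hlip : ∀ k, LipschitzOnWith (C k) (G k) Ω)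
    {N : Euc m → ℕ}
    (hoff : ∀ᵐ x ∂volume.restrict Ω, x ∉ Z → ∀ k, N x ≤ k → ∀ᶠ x' in nhds x, G k x' = G (N x) x')
    (hon : ∀ x ∈ Z, ∀ k l, G k x = G l x) :
    ∀ᵐ x ∂volume.restrict Ω, ∀ k, N x ≤ k →
      G k x = G (N x) x ∧ fderiv ℝ (G k) x = fderiv ℝ (G (N x)) x := by
  have hd : ∀ᵐ x ∂volume.restrict Ω, ∀ k, DifferentiableAt ℝ (G k) x := by
    rw [ae_all_iff]
    exact fun k => ae_differentiableAt_of_lipschitzOn hΩ (hlip k)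
  have hz := ae_restrict_of_ae (s := Ω)
    ((ae_restrict_iff' hZ.measurableSet).1 (ae_fderiv_eq_zero_of_sq hZ.measurableSet))
  filter_upwards [hoff, hd, hz] with x h1 h2 h3 k hk
  by_cases hx : x ∈ Z
  · refine ⟨hon x hx _ _, ?_⟩
    have h4 := h3 hx (fun y => G k y - G (N x) y) ((h2 k).sub (h2 (N x)))
      ⟨0, eventually_mem_nhdsWithin.mono fun y hy => by
        rw [hon y hy k (N x), hon x hx k (N x)]; simp⟩
    rw [fderiv_fun_sub (h2 k) (h2 (N x))] at h4
    exact sub_eq_zero.1 h4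
  · have h4 := h1 hx k hk
    exact ⟨h4.self_of_nhds, Filter.EventuallyEq.fderiv_eq h4⟩

end Density

section Index

open scoped ENNReal

namespace Whitney

/-- The constant bounding the mean value of the powers of the truncation index. -/
def indexConst (N k : ℕ) (p : ℝ) : ℝ≥0∞ := 3 ^ p * (1 + gapConst N k p)

lemma indexConst_lt_top (N : ℕ) {k : ℕ} {p : ℝ} (hp : 0 < p) (hpk : p < k) :
    indexConst N k p < ⊤ :=
  ENNReal.mul_lt_top (ENNReal.rpow_lt_top_of_nonneg hp.le (by norm_num))
    (ENNReal.add_lt_top.2 ⟨ENNReal.one_lt_top, gapConst_lt_top N hp hpk⟩)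

lemma ceil_add_one_rpow_le {g p : ℝ} (hg : 0 ≤ g) (hp : 0 < p) :
    ((⌈1 / g⌉₊ + 1 : ℕ) : ℝ≥0∞) ^ p ≤ 3 ^ p * (1 + ENNReal.ofReal g ^ (-p)) := by
  have h1 : ((⌈1 / g⌉₊ + 1 : ℕ) : ℝ≥0∞) ≤ 3 * max 1 (ENNReal.ofReal g)⁻¹ := by
    rcases hg.eq_or_lt with rfl | hg
    · simp
    rw [← ENNReal.ofReal_inv_of_pos hg, ← ENNReal.ofReal_one, ← ENNReal.ofReal_max,
      show (3 : ℝ≥0∞) = ENNReal.ofReal 3 by simp, ← ENNReal.ofReal_mul (by norm_num),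
      ← ENNReal.ofReal_natCast]
    refine ENNReal.ofReal_le_ofReal ?_
    have h2 := (Nat.ceil_lt_add_one (one_div_pos.2 hg).le).le
    rw [one_div] at h2 ⊢
    push_cast
    have h3 := le_max_left 1 g⁻¹
    have h4 := le_max_right 1 g⁻¹
    linarith
  refine (ENNReal.rpow_le_rpow h1 hp.le).trans ?_
  rw [ENNReal.mul_rpow_of_nonneg _ _ hp.le, ENNReal.rpow_neg, ← ENNReal.inv_rpow]
  gcongr
  rcases le_total 1 (ENNReal.ofReal g)⁻¹ with h | h
  · rw [max_eq_right h]; exact le_add_self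
  · rw [max_eq_left h, ENNReal.one_rpow]; exact le_self_add

variable {m : ℕ} {Z : Set (Euc m)} {ι Col : Type} {K : ℝ} (W : Whitney m Z ι Col K)

lemma exists_index [Countable ι] [Fintype Col] {k : ℕ} (hk : 1 ≤ k) {p : ℝ}
    (hp : 0 < p) (hpk : p < k) (hZ : IsClosed Z) {Ω : Set (Euc m)} (hΩ : MeasurableSet Ω)
    (hfin : volume Ω < ⊤) :
    ∃ (ω : Col → ℝ) (N : Euc m → ℕ), (∀ c, ω c ∈ Icc (0 : ℝ) 1) ∧ Measurable N ∧
      ∫⁻ x in Ω, ((N x + 1 : ℕ) : ℝ≥0∞) ^ p ≤ indexConst (Fintype.card Col) k p * volume Ω ∧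
      ∀ᵐ x ∂volume.restrict Ω, x ∉ Z → ∀ l : ℕ, N x ≤ l → 1 / ((l : ℝ) + 1) < W.gap k ω x := by
  classical
  obtain ⟨ω, hω, hint⟩ := W.exists_param hk hp (A := Ω \ Z) fun x hx => hx.2
  have hgm : Measurable (W.gap k ω) := 
    Measurable.of_uncurry_left (f := W.gap k) (W.measurable_gap k)
  have hG : Measurable fun x => ENNReal.ofReal (W.gap k ω x) ^ (-p) := by fun_prop
  set N : Euc m → ℕ := fun x => if x ∈ Z then 0 else ⌈1 / W.gap k ω x⌉₊ 
  have hZm := hZ.measurableSet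
  refine ⟨ω, N, hω, Measurable.ite hZm measurable_const
    (Nat.measurable_ceil.comp (measurable_const.div hgm)), ?_, ?_⟩
  · have h1 : ∀ x, ((N x + 1 : ℕ) : ℝ≥0∞) ^ p ≤
        3 ^ p * (1 + Zᶜ.indicator (fun x => ENNReal.ofReal (W.gap k ω x) ^ (-p)) x) := by
      intro x
      by_cases hx : x ∈ Z
      · have : N x = 0 := if_pos hx
        rw [this, indicator_of_notMem (by simpa using hx), add_zero, mul_one]
        exact ENNReal.rpow_le_rpow (by norm_num) hp.le
      · have : N x = ⌈1 / W.gap k ω x⌉₊ := if_neg hx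
        rw [this, indicator_of_mem (by simpa using hx)]
        exact ceil_add_one_rpow_le (W.gap_nonneg k hω x) hp
    refine (lintegral_mono h1).trans ?_
    have h2 := hG.indicator hZm.compl
    rw [lintegral_const_mul _ (by fun_prop), lintegral_add_left measurable_const, lintegral_indicator hZm.compl,
      Measure.restrict_restrict hZm.compl, setLIntegral_const, one_mul, indexConst, mul_assoc,
      add_mul, one_mul, inter_comm, ← sdiff_eq]
    gcongr
    exact hint.trans (by gcongr; exact sdiff_subset)
  · have hlt : ∫⁻ x in Ω \ Z, ENNReal.ofReal (W.gap k ω x) ^ (-p) < ⊤ :=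
      hint.trans_lt (ENNReal.mul_lt_top (gapConst_lt_top _ hp hpk)
        ((measure_mono sdiff_subset).trans_lt hfin))
    have h1 := (ae_restrict_iff' (hΩ.diff hZm)).1 (ae_lt_top hG hlt.ne)
    rw [ae_restrict_iff' hΩ]
    filter_upwards [h1] with x hx hxΩ hxZ l hl
    have h2 := hx ⟨hxΩ, hxZ⟩
    have h3 : 0 < W.gap k ω x := by
      refine (W.gap_nonneg k hω x).lt_of_ne fun h => ?_
      rw [← h, ENNReal.ofReal_zero, ENNReal.zero_rpow_of_neg (by linarith)] at h2
      exact lt_irrefl _ h2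
    have h4 : N x = ⌈1 / W.gap k ω x⌉₊ := if_neg hxZ
    rw [h4] at hl
    have h5 := Nat.ceil_le.1 hl
    rw [one_div_lt (by positivity) h3]
    linarith

end Whitney

end Index

section FrameSobolev

open scoped ENNReal

lemma fderiv_contact {m n : ℕ} {x : Euc m} {X P : Fin n → Euc m → ℝ} {U : Euc m → ℝ}
    (hX : ∀ j, DifferentiableAt ℝ (X j) x) (hP : ∀ j, DifferentiableAt ℝ (P j) x)
    (hU : DifferentiableAt ℝ U x)
    (h : fderiv ℝ (fun x' => U x' - ∑ j, P j x * X j x') x = 0) (v : Euc m) :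
    fderiv ℝ (fun x' => 4 * U x' - 2 * ∑ j, X j x' * P j x') x v =
      2 * ∑ j, (P j x * fderiv ℝ (X j) x v - X j x * fderiv ℝ (P j) x v) := by
  have h1 : HasFDerivAt (fun x' => U x' - ∑ j, P j x * X j x')
      (fderiv ℝ U x - ∑ j, P j x • fderiv ℝ (X j) x) x :=
    hU.hasFDerivAt.sub (HasFDerivAt.fun_sum fun j _ => (hX j).hasFDerivAt.const_mul (P j x))
  have h2 : HasFDerivAt (fun x' => 4 * U x' - 2 * ∑ j, X j x' * P j x')
      ((4 : ℝ) • fderiv ℝ U x - (2 : ℝ) •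
        ∑ j, (X j x • fderiv ℝ (P j) x + P j x • fderiv ℝ (X j) x)) x :=
    (hU.hasFDerivAt.const_mul 4).sub ((HasFDerivAt.fun_sum fun j _ =>
      (hX j).hasFDerivAt.mul (hP j).hasFDerivAt).const_mul 2)
  rw [h1.fderiv, sub_eq_zero] at h
  rw [h2.fderiv, h]
  simp only [sub_apply, smul_apply, sum_apply, add_apply,
    smul_eq_mul, Finset.sum_add_distrib, Finset.sum_sub_distrib]
  ring

lemma abs_apply_le_norm {n : ℕ} (a : Euc n) (j : Fin n) : |a j| ≤ ‖a‖ :=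
  PiLp.norm_apply_le a j

lemma inner_eq_sum {n : ℕ} (a b : Euc n) : inner ℝ a b = ∑ j, a j * b j := by
  rw [PiLp.inner_apply]
  exact Finset.sum_congr rfl fun j _ => by simp [mul_comm]

/-- The Leibniz rule for increments of bounded functions. -/
lemma abs_mul_sub_mul_le {a a' b b' A B s t d : ℝ} (ha : |a| ≤ A) (hb : |b'| ≤ B)
    (h1 : |a - a'| ≤ s * d) (h2 : |b - b'| ≤ t * d) :
    |a * b - a' * b'| ≤ (A * t + B * s) * d := by
  have e : a * b - a' * b' = a * (b - b') + (a - a') * b' := by ring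
  rw [e]
  refine (abs_add_le _ _).trans ?_
  rw [abs_mul, abs_mul]
  have h3 := mul_le_mul ha h2 (abs_nonneg _) ((abs_nonneg a).trans ha)
  have h4 := mul_le_mul h1 hb (abs_nonneg _) ((abs_nonneg _).trans h1)
  linarith

variable {m : ℕ} {Z : Set (Euc m)} {ι Col : Type} {K : ℝ} {W : Whitney m Z ι Col K}
  {n : ℕ} {c E : ℝ}

/-- The extension of a frame to a Sobolev map satisfying the contact equation. -/
theorem Frame.exists_sobolev [Countable ι] [Fintype Col] (Φ : Frame W (Euc n) n c E)
    (hK : 0 ≤ K) (hc : 0 ≤ c) (hE : 0 ≤ E) (hZ : IsClosed Z) (hne : Z.Nonempty)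
    {Ω : Set (Euc m)} (hΩ : IsOpen Ω) (hb : Bornology.IsBounded Ω)
    {p : ℝ} (hp1 : 1 ≤ p) (hp2 : p < n + 1) :
    ∃ (X P : Fin n → Euc m → ℝ) (T : Euc m → ℝ) (vX vP : Fin n → Fin m → Euc m → ℝ)
      (vT : Fin m → Euc m → ℝ),
      (∀ j, MemW1pWith m p Ω (X j) (vX j)) ∧ (∀ j, MemW1pWith m p Ω (P j) (vP j)) ∧
      MemW1pWith m p Ω T vT ∧
      (∀ᵐ x ∂volume.restrict Ω, ∀ k, vT k x =
        2 * ∑ j, (P j x * vX j k x - X j x * vP j k x)) ∧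
      (∀ z ∈ Z, (∀ j, X j z = Φ.X z j) ∧ (∀ j, P j z = Φ.P z j) ∧
        T z = 4 * Φ.U z - 2 * ∑ j, Φ.X z j * Φ.P z j) ∧
      (∀ j k, eLpNorm (vX j k) (ENNReal.ofReal p) (volume.restrict Ω) ≤
        ENNReal.ofReal (Frame.cX (Fintype.card Col) K c) *
          (Whitney.indexConst (Fintype.card Col) (n + 1) p * volume Ω) ^ (1 / p)) ∧
      (∀ j k, eLpNorm (vP j k) (ENNReal.ofReal p) (volume.restrict Ω) ≤
        ENNReal.ofReal (Frame.cP (Fintype.card Col) K c E n) *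
          (Whitney.indexConst (Fintype.card Col) (n + 1) p * volume Ω) ^ (1 / p)) := by
  have hp0 : 0 < p := by linarith
  have hpk : p < ((n + 1 : ℕ) : ℝ) := by push_cast; exact hp2
  have hfin : volume Ω < ⊤ := hb.measure_lt_top
  obtain ⟨ω, N, hω, hNm, hNI, hgap⟩ := W.exists_index (k := n + 1) (by omega) hp0 hpk hZ
    hΩ.measurableSet hfin
  set I := Whitney.indexConst (Fintype.card Col) (n + 1) p * volume Ω
  have hI : I < ⊤ := ENNReal.mul_lt_top (Whitney.indexConst_lt_top _ hp0 hpk) hfin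
  obtain ⟨z₀, hz₀⟩ := hne
  obtain ⟨R, hR⟩ := hb.subset_closedBall z₀
  replace hR : ∀ x ∈ Ω, dist x z₀ ≤ R := fun x hx => hR hx
  have hd : ∀ x ∈ Ω, infDist x Z ≤ R := fun x hx => (infDist_le_dist_of_mem hz₀).trans (hR x hx)
  have hε : ∀ k : ℕ, 0 < 1 / ((k : ℝ) + 1) := fun k => by positivity
  have hε1 : ∀ k : ℕ, 1 / ((k : ℝ) + 1) ≤ 1 := fun k => by
    rw [div_le_one (by positivity)]; linarith [(k.cast_nonneg : (0 : ℝ) ≤ k)]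
  have hdiv : ∀ (a : ℝ) (k : ℕ), a / (1 / ((k : ℝ) + 1)) = a * (k + 1) := fun a k => by
    field_simp
  -- the basic principle for sequences indexed by the truncation parameter
  have key : ∀ (G : ℝ → Euc m → ℝ) (C B : ℝ), 0 ≤ C →
      (∀ k : ℕ, ∀ x ∈ Ω, ∀ y ∈ Ω, |G (1 / ((k : ℝ) + 1)) x - G (1 / ((k : ℝ) + 1)) y| ≤
        C * (k + 1) * dist x y) →
      (∀ k : ℕ, ∀ x ∈ Ω, |G (1 / ((k : ℝ) + 1)) x| ≤ B) →
      (∀ ε ε' x, ε ≤ W.gap (n + 1) ω x → ε' ≤ W.gap (n + 1) ω x → G ε x = G ε' x) →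
      (∀ x ∈ Z, ∀ ε ε', G ε x = G ε' x) →
      (MemW1pWith m p Ω (fun x => G (1 / ((N x : ℝ) + 1)) x)
        (fun k x => fderiv ℝ (G (1 / ((N x : ℝ) + 1))) x (EuclideanSpace.single k 1)) ∧
      ∀ k : Fin m, eLpNorm
        (fun x => fderiv ℝ (G (1 / ((N x : ℝ) + 1))) x (EuclideanSpace.single k 1))
        (ENNReal.ofReal p) (volume.restrict Ω) ≤ ENNReal.ofReal C * I ^ (1 / p)) ∧
      ∀ᵐ x ∂volume.restrict Ω, DifferentiableAt ℝ (G (1 / ((N x : ℝ) + 1))) x := by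
    intro G C B hC hlip hB hoff hon
    have hlip' : ∀ k : ℕ, LipschitzOnWith (C * (k + 1)).toNNReal (G (1 / ((k : ℝ) + 1))) Ω :=
      fun k => lipschitzOnWith_of_abs_sub_le (by positivity) (hlip k)
    refine ⟨memW1pWith_of_locally_eventually_const hΩ hb hp1
      (G := fun k => G (1 / ((k : ℝ) + 1))) hC hlip hB hNm ?_ hI hNI, ?_⟩
    · refine ae_eventually_const hΩ hZ hlip' ?_ fun x hx k l => hon x hx _ _
      filter_upwards [hgap] with x hx hxZ k hk
      have hpos : 0 < infDist x Z := (hZ.notMem_iff_infDist_pos ⟨z₀, hz₀⟩).1 hxZ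
      have hcont := W.continuousAt_gap hK (n + 1) hω hpos
      filter_upwards [hcont.eventually_const_lt (hx hxZ k hk),
        hcont.eventually_const_lt (hx hxZ (N x) le_rfl)] with y h1 h2
      exact hoff _ _ y h1.le h2.le
    · have : ∀ᵐ x ∂volume.restrict Ω, ∀ k : ℕ, DifferentiableAt ℝ (G (1 / ((k : ℝ) + 1))) x := by
        rw [ae_all_iff]
        exact fun k => ae_differentiableAt_of_lipschitzOn hΩ (hlip' k)
      exact this.mono fun x hx => hx _
  -- bounds for the components
  have hcX := cX_nonneg (Fintype.card Col) hK hc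
  have hcP := cP_nonneg (Fintype.card Col) n hK hc hE
  have hcDX := cDevX_nonneg (Fintype.card Col) hK hc
  have hcDP := cDevP_nonneg (Fintype.card Col) n hK hc hE
  obtain ⟨CU, hCU, hU⟩ := Φ.exists_extU_bound hK hc
  obtain ⟨aU, haU, hlU⟩ := Φ.lip_U
  have lipX : ∀ k : ℕ, ∀ x y, ‖Φ.extX (1 / ((k : ℝ) + 1)) ω x - Φ.extX (1 / ((k : ℝ) + 1)) ω y‖ ≤
      cX (Fintype.card Col) K c * (k + 1) * dist x y := fun k x y => by
    rw [← hdiv]; exact Φ.norm_extX_sub_le hK hc (hε k) (hε1 k) hω x y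
  have lipP : ∀ k : ℕ, ∀ x y, ‖Φ.extP (1 / ((k : ℝ) + 1)) ω x - Φ.extP (1 / ((k : ℝ) + 1)) ω y‖ ≤
      cP (Fintype.card Col) K c E n * (k + 1) * dist x y := fun k x y => by
    rw [← hdiv]; exact Φ.norm_extP_sub_le hK hc hE (hε k) (hε1 k) hω x y
  have lipU : ∀ k : ℕ, ∀ x y, |Φ.extU (1 / ((k : ℝ) + 1)) ω x - Φ.extU (1 / ((k : ℝ) + 1)) ω y| ≤
      CU * (k + 1) * dist x y := fun k x y => by
    rw [← hdiv]; exact (hU _ ω (hε k) (hε1 k) hω).2 x y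
  set BX := ‖Φ.X z₀‖ + c * R + cDevX (Fintype.card Col) K c * R
  set BP := ‖Φ.P z₀‖ + c * R + cDevP (Fintype.card Col) K c E n * R
  set BU := |Φ.U z₀| + aU * R + CU * R
  have bddX : ∀ k : ℕ, ∀ x ∈ Ω, ‖Φ.extX (1 / ((k : ℝ) + 1)) ω x‖ ≤ BX := fun k x hx => by
    have h1 := (Φ.norm_devX_le hK hc (hε k) hω x).trans (mul_le_mul_of_nonneg_left (hd x hx) hcDX)
    have h2 := (Φ.lip_X x z₀).trans (mul_le_mul_of_nonneg_left (hR x hx) hc)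
    have h3 := norm_le_norm_add_norm_sub' (Φ.X x) (Φ.X z₀)
    refine (norm_add_le _ _).trans ?_
    linarith
  have bddP : ∀ k : ℕ, ∀ x ∈ Ω, ‖Φ.extP (1 / ((k : ℝ) + 1)) ω x‖ ≤ BP := fun k x hx => by
    have h1 := (Φ.norm_devP_le hK hc hE (hε k) hω x).trans
      (mul_le_mul_of_nonneg_left (hd x hx) hcDP)
    have h2 := (Φ.lip_P x z₀).trans (mul_le_mul_of_nonneg_left (hR x hx) hc)
    have h3 := norm_le_norm_add_norm_sub' (Φ.P x) (Φ.P z₀)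
    refine (norm_add_le _ _).trans ?_
    linarith
  have bddU : ∀ k : ℕ, ∀ x ∈ Ω, |Φ.extU (1 / ((k : ℝ) + 1)) ω x| ≤ BU := fun k x hx => by
    have h1 := ((hU _ ω (hε k) (hε1 k) hω).1 x).trans (mul_le_mul_of_nonneg_left (hd x hx) hCU)
    have h2 := (hlU x z₀).trans (mul_le_mul_of_nonneg_left (hR x hx) haU)
    have h3 := abs_sub_abs_le_abs_sub (Φ.U x) (Φ.U z₀)
    refine (abs_add_le _ _).trans ?_
    linarith
  have kX := fun j : Fin n => key (fun ε x => Φ.extX ε ω x j) _ BX hcX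
    (fun k x _ y _ => (abs_apply_le_norm (_ - _ : Euc n) j).trans (lipX k x y))
    (fun k x hx => (abs_apply_le_norm _ j).trans (bddX k x hx))
    (fun ε ε' x h h' => by rw [(Φ.ext_congr h h').1])
    (fun x hx ε ε' => by rw [Φ.extX_of_mem hx, Φ.extX_of_mem hx])
  have kP := fun j : Fin n => key (fun ε x => Φ.extP ε ω x j) _ BP hcP
    (fun k x _ y _ => (abs_apply_le_norm (_ - _ : Euc n) j).trans (lipP k x y))
    (fun k x hx => (abs_apply_le_norm _ j).trans (bddP k x hx))
    (fun ε ε' x h h' => by rw [(Φ.ext_congr h h').2.1])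
    (fun x hx ε ε' => by rw [Φ.extP_of_mem hx, Φ.extP_of_mem hx])
  have kU := key (fun ε x => Φ.extU ε ω x) CU BU hCU
    (fun k x _ y _ => lipU k x y) bddU
    (fun ε ε' x h h' => (Φ.ext_congr h h').2.2)
    (fun x hx ε ε' => by rw [Φ.extU_of_mem hx, Φ.extU_of_mem hx])
  have hn0 : (0 : ℝ) ≤ n := n.cast_nonneg
  have hBX : ∀ x ∈ Ω, 0 ≤ BX := fun x hx => (norm_nonneg _).trans (bddX 0 x hx)
  have hBP : ∀ x ∈ Ω, 0 ≤ BP := fun x hx => (norm_nonneg _).trans (bddP 0 x hx)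
  have kT := key (fun ε x => 4 * Φ.extU ε ω x - 2 * ∑ j, Φ.extX ε ω x j * Φ.extP ε ω x j)
    (4 * CU + 2 * (n * (|BX| * cP (Fintype.card Col) K c E n + |BP| * cX (Fintype.card Col) K c)))
    (4 * BU + 2 * (n * (BX * BP))) (by positivity)
    (fun k x hx y hy => by
      have h1 : |∑ j, (Φ.extX (1 / ((k : ℝ) + 1)) ω x j * Φ.extP (1 / ((k : ℝ) + 1)) ω x j -
          Φ.extX (1 / ((k : ℝ) + 1)) ω y j * Φ.extP (1 / ((k : ℝ) + 1)) ω y j)| ≤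
          ∑ _j : Fin n, (|BX| * (cP (Fintype.card Col) K c E n * (k + 1)) +
            |BP| * (cX (Fintype.card Col) K c * (k + 1))) * dist x y := by
        refine (Finset.abs_sum_le_sum_abs _ _).trans (Finset.sum_le_sum fun j _ => ?_)
        exact abs_mul_sub_mul_le
          (((abs_apply_le_norm _ j).trans (bddX k x hx)).trans (le_abs_self _))
          (((abs_apply_le_norm _ j).trans (bddP k y hy)).trans (le_abs_self _))
          ((abs_apply_le_norm (_ - _ : Euc n) j).trans (lipX k x y))
          ((abs_apply_le_norm (_ - _ : Euc n) j).trans (lipP k x y))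
      rw [Finset.sum_const, Finset.card_univ, Fintype.card_fin, nsmul_eq_mul,
        Finset.sum_sub_distrib] at h1
      have h2 := lipU k x y
      rw [abs_le] at h1 h2 ⊢
      constructor <;> linarith [h1.1, h1.2, h2.1, h2.2])
    (fun k x hx => by
      have h1 : |∑ j, Φ.extX (1 / ((k : ℝ) + 1)) ω x j * Φ.extP (1 / ((k : ℝ) + 1)) ω x j| ≤
          ∑ _j : Fin n, BX * BP := by
        refine (Finset.abs_sum_le_sum_abs _ _).trans (Finset.sum_le_sum fun j _ => ?_)
        rw [abs_mul]
        exact mul_le_mul ((abs_apply_le_norm _ j).trans (bddX k x hx))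
          ((abs_apply_le_norm _ j).trans (bddP k x hx)) (abs_nonneg _) (hBX x hx)
      rw [Finset.sum_const, Finset.card_univ, Fintype.card_fin, nsmul_eq_mul] at h1
      have h2 := bddU k x hx
      rw [abs_le] at h1 h2 ⊢
      constructor <;> linarith [h1.1, h1.2, h2.1, h2.2])
    (fun ε ε' x h h' => by
      rw [(Φ.ext_congr h h').1, (Φ.ext_congr h h').2.1, (Φ.ext_congr h h').2.2])
    (fun x hx ε ε' => by
      rw [Φ.extU_of_mem hx, Φ.extU_of_mem hx, Φ.extX_of_mem hx, Φ.extX_of_mem hx,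
        Φ.extP_of_mem hx, Φ.extP_of_mem hx])
  refine ⟨_, _, _, _, _, _, fun j => (kX j).1.1, fun j => (kP j).1.1, kT.1.1, ?_, ?_,
    fun j k => (kX j).1.2 k, fun j k => (kP j).1.2 k⟩
  · have dX := ae_all_iff.2 fun j => (kX j).2
    have dP := ae_all_iff.2 fun j => (kP j).2
    have hz := ae_restrict_of_ae (s := Ω)
      ((ae_restrict_iff' hZ.measurableSet).1 (ae_fderiv_eq_zero_of_sq hZ.measurableSet))
    have hu := ae_restrict_of_ae (s := Ω)
      ((ae_restrict_iff' MeasurableSet.univ).1 (ae_fderiv_eq_zero_of_sq (m := m) .univ))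
    filter_upwards [dX, dP, kU.2, hz, hu, hgap] with x hX hP hU hz hu hg k
    refine fderiv_contact hX hP hU ?_ _
    set ε := 1 / ((N x : ℝ) + 1)
    have hdiff : DifferentiableAt ℝ
        (fun x' => Φ.extU ε ω x' - ∑ j, Φ.extP ε ω x j * Φ.extX ε ω x' j) x :=
      hU.sub (DifferentiableAt.fun_sum fun j _ => (hX j).const_mul _)
    have e : ∀ x', Φ.extU ε ω x' - ∑ j, Φ.extP ε ω x j * Φ.extX ε ω x' j -
        (Φ.extU ε ω x - ∑ j, Φ.extP ε ω x j * Φ.extX ε ω x j) =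
        Φ.extU ε ω x' - Φ.extU ε ω x -
          inner ℝ (Φ.extP ε ω x) (Φ.extX ε ω x' - Φ.extX ε ω x) := by
      intro x'
      rw [inner_sub_right, inner_eq_sum, inner_eq_sum]
      ring
    by_cases hxZ : x ∈ Z
    · refine hz hxZ _ hdiff ?_
      simp only [e]
      exact Φ.eventually_contact_of_mem hxZ
    · refine hu (mem_univ x) _ hdiff ?_
      simp only [e, nhdsWithin_univ]
      exact Φ.eventually_contact hK hc (hε _) (hε1 _) hω
        ((hZ.notMem_iff_infDist_pos ⟨z₀, hz₀⟩).1 hxZ) (hg hxZ _ le_rfl)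
  · intro z hz
    refine ⟨fun j => ?_, fun j => ?_, ?_⟩
    · simp only [Φ.extX_of_mem hz]
    · simp only [Φ.extP_of_mem hz]
    · simp only [Φ.extX_of_mem hz, Φ.extP_of_mem hz, Φ.extU_of_mem hz]

end FrameSobolev

section Assembly

open scoped ENNReal

lemma norm_le_of_abs_apply_le {n : ℕ} {a : Euc n} {D : ℝ} (hD : 0 ≤ D) (h : ∀ j, |a j| ≤ D) :
    ‖a‖ ≤ n * D := by
  rcases n.eq_zero_or_pos with rfl | hn
  · rw [Subsingleton.elim a 0]; simp
  have hn1 : (1 : ℝ) ≤ n := by exact_mod_cast hn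
  refine abs_le_of_sq_le_sq' ?_ (by positivity) |>.2
  rw [EuclideanSpace.norm_sq_eq]
  calc ∑ j, ‖a j‖ ^ 2 ≤ ∑ _j : Fin n, D ^ 2 :=
        Finset.sum_le_sum fun j _ => pow_le_pow_left₀ (norm_nonneg _) (h j) 2
    _ = n * D ^ 2 := by simp
    _ ≤ n * (n * D ^ 2) := le_mul_of_one_le_left (by positivity) hn1
    _ = (n * D) ^ 2 := by ring

section Jet

variable {m : ℕ} {Z : Set (Euc m)} {ι Col : Type} {K : ℝ}

/-- A jet on a compact set satisfying the quantitative contact condition extends to a frame. -/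
lemma exists_frame (W : Whitney m Z ι Col K) [Encodable ι] [Fintype Col] (hK : 0 ≤ K)
    (hZ : IsCompact Z) {n : ℕ} (hn : 1 ≤ n) {X P : Euc m → Euc n} {U : Euc m → ℝ}
    (hX : ∀ z ∈ Z, ∀ z' ∈ Z, dist (X z) (X z') ≤ dist z z')
    (hP : ∀ z ∈ Z, ∀ z' ∈ Z, dist (P z) (P z') ≤ dist z z')
    (hU : ∀ z ∈ Z, ∀ z' ∈ Z, |U z' - U z - inner ℝ (P z) (X z' - X z)| ≤ 2 * dist z z' ^ 2) :
    ∃ Φ : Frame W (Euc n) n (lipschitzExtensionConstant (Euc n))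
      (Whitney.vertConst K (Fintype.card Col) n),
      ∀ z ∈ Z, Φ.X z = X z ∧ Φ.P z = P z ∧ Φ.U z = U z := by
  classical
  have hfin : Module.finrank ℝ (Euc n) = n := by simp
  have lX : LipschitzOnWith 1 X Z := LipschitzOnWith.of_dist_le_mul fun z hz z' hz' => by
    simpa using hX z hz z' hz'
  have lP : LipschitzOnWith 1 P Z := LipschitzOnWith.of_dist_le_mul fun z hz z' hz' => by
    simpa using hP z hz z' hz'
  obtain ⟨M, hM⟩ := hZ.exists_bound_of_continuousOn lP.continuousOn
  obtain ⟨X', hX', eX⟩ := lX.extend_finite_dimension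
  obtain ⟨P', hP', eP⟩ := lP.extend_finite_dimension
  have lU : LipschitzOnWith (|M| + 2 * diam Z).toNNReal U Z := by
    refine lipschitzOnWith_of_abs_sub_le (by positivity) fun z hz z' hz' => ?_
    have h1 := hU z hz z' hz'
    have h2 := abs_real_inner_le_norm (P z) (X z' - X z)
    have h3 : ‖P z‖ * ‖X z' - X z‖ ≤ |M| * dist z z' := by
      have := hX z hz z' hz'
      rw [dist_comm, dist_eq_norm] at this
      exact mul_le_mul ((hM z hz).trans (le_abs_self M)) this (norm_nonneg _) (abs_nonneg _)
    have h4 : dist z z' ^ 2 ≤ diam Z * dist z z' := by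
      rw [pow_two]
      exact mul_le_mul_of_nonneg_right (dist_le_diam_of_mem hZ.isBounded hz hz') dist_nonneg
    have h5 := h2.trans h3
    rw [abs_le] at h1 h5 ⊢
    constructor <;> linarith [h1.1, h1.2, h5.1, h5.2]
  obtain ⟨U', hU', eU⟩ := lU.extend_real
  obtain ⟨y, e, hy, he⟩ := W.exists_vertices hK (by rw [hfin]; exact hn) X hX
  rw [hfin] at he
  let Φ : Frame W (Euc n) n (lipschitzExtensionConstant (Euc n))
      (Whitney.vertConst K (Fintype.card Col) n) :=
    { X := X'
      P := P'
      U := U'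
      y := y
      e := e
      lip_X := fun x x' => by simpa [dist_eq_norm] using hX'.dist_le_mul x x'
      lip_P := fun x x' => by simpa [dist_eq_norm] using hP'.dist_le_mul x x'
      lip_U := ⟨_, NNReal.coe_nonneg _, fun x x' => hU'.dist_le_mul x x'⟩
      bdd_P := ⟨|M|, abs_nonneg M, fun z hz => by
        rw [← eP hz]; exact (hM z hz).trans (le_abs_self M)⟩
      quad := fun z hz z' hz' => by
        rw [← eP hz, ← eX hz, ← eX hz', ← eU hz, ← eU hz']; exact hU z hz z' hz'
      y_near := fun i => by rw [← eX (W.z_mem i)]; exact hy i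
      sum_e := fun τ h1 h2 => (he τ h1 h2).1
      dual := fun τ h1 h2 i hi j hj l hl => by convert (he τ h1 h2).2.1 i hi j hj l hl
      norm_e := fun τ h1 h2 => (he τ h1 h2).2.2 }
  exact ⟨Φ, fun z hz => ⟨(eX hz).symm, (eP hz).symm, (eU hz).symm⟩⟩

end Jet

/-- The jet of a Lipschitz map into the Heisenberg group satisfies the quantitative contact
condition. -/
lemma jet_of_lipschitzOnCC {m n : ℕ} (hn : 1 ≤ n) {L : ℝ} (hL : 0 < L) {Z : Set (Euc m)}
    {f : Euc m → Euc (2 * n + 1)} (hf : LipschitzOnCC m n L Z f) {X P : Euc m → Euc n}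
    {U : Euc m → ℝ} (hX : ∀ z j, n * L * X z j = f z (xIdx n j))
    (hP : ∀ z j, n * L * P z j = f z (yIdx n j))
    (hU : ∀ z, (n * L) ^ 2 * (4 * U z - 2 * ∑ j, X z j * P z j) = f z (tIdx n)) :
    (∀ z ∈ Z, ∀ z' ∈ Z, dist (X z) (X z') ≤ dist z z') ∧
    (∀ z ∈ Z, ∀ z' ∈ Z, dist (P z) (P z') ≤ dist z z') ∧
    ∀ z ∈ Z, ∀ z' ∈ Z, |U z' - U z - inner ℝ (P z) (X z' - X z)| ≤ 2 * dist z z' ^ 2 := by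
  have hn1 : (1 : ℝ) ≤ n := by exact_mod_cast hn
  have hn0 : (0 : ℝ) < n := by linarith
  have hs : 0 < n * L := by positivity
  have lip : ∀ (Q : Euc m → Euc n) (z z' : Euc m),
      (∀ j, |n * L * Q z' j - n * L * Q z j| ≤ L * dist z z') → dist (Q z) (Q z') ≤ dist z z' := by
    intro Q z z' h
    rw [dist_comm, dist_eq_norm]
    have h1 := norm_le_of_abs_apply_le (a := Q z' - Q z) (D := dist z z' / n) (by positivity)
      fun j => by
        have h2 := h j
        rw [← mul_sub, abs_mul, abs_of_pos hs] at h2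
        rw [le_div_iff₀ hn0]
        refine le_of_mul_le_mul_left ?_ hL
        calc L * (|(Q z' - Q z) j| * n) = n * L * |Q z' j - Q z j| := by
              rw [PiLp.sub_apply]; ring
          _ ≤ _ := h2
    rwa [mul_div_cancel₀ _ hn0.ne'] at h1
  refine ⟨fun z hz z' hz' => ?_, fun z hz z' hz' => ?_, fun z hz z' hz' => ?_⟩
  · refine lip X z z' fun j => ?_
    rw [hX, hX]
    exact (bounds_of_ccDist_le hn (hf z hz z' hz')).1 j
  · refine lip P z z' fun j => ?_
    rw [hP, hP]
    exact (bounds_of_ccDist_le hn (hf z hz z' hz')).2.1 j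
  · obtain ⟨b1, b2, b3⟩ := bounds_of_ccDist_le hn (hf z hz z' hz')
    simp only [← hX, ← hP, ← hU, ← mul_sub, abs_mul, abs_of_pos hs] at b1 b2 b3
    set d := dist z z' with hd
    have hd0 : 0 ≤ d := dist_nonneg
    have b4 : |∑ j, (n * L) ^ 2 * ((X z' j - X z j) * (P z' j - P z j))| ≤ n * (L * d) ^ 2 := by
      refine (Finset.abs_sum_le_sum_abs _ _).trans ?_
      refine (Finset.sum_le_card_nsmul _ _ ((L * d) ^ 2) fun j _ => ?_).trans (by simp)
      rw [abs_mul, abs_mul, abs_of_pos (by positivity)]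
      calc (n * L) ^ 2 * (|X z' j - X z j| * |P z' j - P z j|)
          = (n * L * |X z' j - X z j|) * (n * L * |P z' j - P z j|) := by ring
        _ ≤ (L * d) * (L * d) := mul_le_mul (b1 j) (b2 j) (by positivity) (by positivity)
        _ = _ := by ring
    have e : 4 * (n * L) ^ 2 * (U z' - U z - inner ℝ (P z) (X z' - X z)) =
        ((n * L) ^ 2 * ((4 * U z' - 2 * ∑ j, X z' j * P z' j) -
          (4 * U z - 2 * ∑ j, X z j * P z j)) - 2 * ∑ j,
          (n * L * P z j * (n * L * X z' j) - n * L * X z j * (n * L * P z' j))) +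
        2 * ∑ j, (n * L) ^ 2 * ((X z' j - X z j) * (P z' j - P z j)) := by
      have e1 : ∀ j, n * L * P z j * (n * L * X z' j) - n * L * X z j * (n * L * P z' j) =
          (n * L) ^ 2 * (X z' j * P z j - X z j * P z' j) := fun j => by ring
      simp only [inner_sub_right, inner_eq_sum, e1, sub_mul, mul_sub, ← Finset.mul_sum,
        Finset.sum_sub_distrib, mul_comm (P z _)]
      ring
    have e2 : |4 * (n * L) ^ 2 * (U z' - U z - inner ℝ (P z) (X z' - X z))| ≤
        6 * n * (L * d) ^ 2 := by
      rw [e]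
      rw [abs_le] at b3 b4 ⊢
      constructor <;> linarith [b3.1, b3.2, b4.1, b4.2]
    rw [abs_mul, abs_of_pos (by positivity)] at e2
    have e3 : 6 * n * (L * d) ^ 2 ≤ 4 * (n * L) ^ 2 * (2 * d ^ 2) := by
      have : (n : ℝ) ≤ n ^ 2 := by nlinarith
      have h0 : 0 ≤ (L * d) ^ 2 := by positivity
      nlinarith
    exact le_of_mul_le_mul_left (e2.trans e3) (by positivity)

/-- A map which is Lipschitz with constant zero is constant. -/
lemma eq_of_lipschitzOnCC_zero {m n : ℕ} (hn : 1 ≤ n) {Z : Set (Euc m)}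
    {f : Euc m → Euc (2 * n + 1)} (hf : LipschitzOnCC m n 0 Z f) {z z' : Euc m} (hz : z ∈ Z)
    (hz' : z' ∈ Z) : f z' = f z := by
  have h := hf z hz z' hz'
  rw [zero_mul] at h
  obtain ⟨b1, b2, b3⟩ := bounds_of_ccDist_le hn h
  have h1 : ∀ j, f z' (xIdx n j) = f z (xIdx n j) := fun j =>
    sub_eq_zero.1 (abs_nonpos_iff.1 (b1 j))
  have h2 : ∀ j, f z' (yIdx n j) = f z (yIdx n j) := fun j =>
    sub_eq_zero.1 (abs_nonpos_iff.1 (b2 j))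
  ext i
  obtain ⟨j, rfl⟩ | ⟨j, rfl⟩ | rfl := eq_xIdx_or_yIdx_or_tIdx i
  · exact h1 j
  · exact h2 j
  · simp only [h1, h2] at b3
    have h3 : ∑ j : Fin n, (f z (yIdx n j) * f z (xIdx n j) - f z (xIdx n j) * f z (yIdx n j)) =
        0 := Finset.sum_eq_zero fun j _ => by ring
    rw [h3] at b3
    norm_num at b3
    exact sub_eq_zero.1 b3

lemma memW1pWith_const {m : ℕ} {p : ℝ} {Ω : Set (Euc m)} (hΩ : IsOpen Ω)
    (hb : Bornology.IsBounded Ω) (a : ℝ) : MemW1pWith m p Ω (fun _ => a) fun _ _ => 0 := by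
  have hfin : volume Ω < ⊤ := hb.measure_lt_top
  have : IsFiniteMeasure (volume.restrict Ω) := ⟨by simpa using hfin⟩
  refine ⟨memLp_const a, fun k => ⟨memLp_const 0, ?_⟩⟩
  have h := isWeakPartialDeriv_of_lipschitzOn hΩ (g := fun _ => a) (C := 0)
    (LipschitzWith.const a).lipschitzOnWith k
  simpa using h

lemma MemW1pWith.const_mul {m : ℕ} {p : ℝ} {Ω : Set (Euc m)} {u : Euc m → ℝ}
    {v : Fin m → Euc m → ℝ} (h : MemW1pWith m p Ω u v) (a : ℝ) :
    MemW1pWith m p Ω (fun x => a * u x) fun k x => a * v k x := by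
  refine ⟨MemLp.const_mul h.1 a, fun k => ⟨MemLp.const_mul (h.2 k).1 a, fun φ h1 h2 h3 => ?_⟩⟩
  simp only [mul_assoc]
  rw [integral_const_mul, integral_const_mul, (h.2 k).2 φ h1 h2 h3, mul_neg]

/-- The vector of `ℍⁿ` with given `x`, `y` and `t` components. -/
def heisVec {n : ℕ} {α : Type*} (a b : Fin n → α) (t : α) : Fin (2 * n + 1) → α :=
  Function.extend (xIdx n) a (Function.extend (yIdx n) b fun _ => t)

section HeisVec

variable {n : ℕ} {α : Type*} (a b : Fin n → α) (t : α)

lemma heisVec_xIdx (j : Fin n) : heisVec a b t (xIdx n j) = a j :=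
  xIdx_injective.extend_apply _ _ j

lemma heisVec_yIdx (j : Fin n) : heisVec a b t (yIdx n j) = b j := by
  rw [heisVec, Function.extend_apply' _ _ _ fun ⟨i, hi⟩ => xIdx_ne_yIdx i j hi]
  exact yIdx_injective.extend_apply _ _ j

lemma heisVec_tIdx : heisVec a b t (tIdx n) = t := by
  rw [heisVec, Function.extend_apply' _ _ _ fun ⟨i, hi⟩ => xIdx_ne_tIdx i hi,
    Function.extend_apply' _ _ _ fun ⟨i, hi⟩ => yIdx_ne_tIdx i hi]

end HeisVec

lemma volume_le_diam_pow {m : ℕ} {Ω : Set (Euc m)} (hb : Bornology.IsBounded Ω)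
    (hne : Ω.Nonempty) :
    volume Ω ≤ ENNReal.ofReal (diam Ω ^ m) * volume (ball (0 : Euc m) 1) := by
  obtain ⟨x, hx⟩ := hne
  have h := Measure.addHaar_closedBall (volume : Measure (Euc m)) x (diam_nonneg (s := Ω))
  rw [finrank_euclideanSpace_fin] at h
  rw [← h]
  exact measure_mono fun y hy => dist_le_diam_of_mem hb hy hx

lemma mul_volume_rpow_le {m : ℕ} {Ω : Set (Euc m)} (hb : Bornology.IsBounded Ω)
    (hne : Ω.Nonempty) (S : ℝ≥0∞) {p : ℝ} (hp : 0 < p) :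
    (S * volume Ω) ^ (1 / p) ≤ (S * volume (ball (0 : Euc m) 1)) ^ (1 / p) *
      ENNReal.ofReal (diam Ω ^ ((m : ℝ) / p)) := by
  have hd : 0 ≤ diam Ω := diam_nonneg
  have e : ENNReal.ofReal (diam Ω ^ ((m : ℝ) / p)) = ENNReal.ofReal (diam Ω ^ m) ^ (1 / p) := by
    rw [ENNReal.ofReal_rpow_of_nonneg (by positivity) (by positivity), ← Real.rpow_natCast,
      ← Real.rpow_mul hd, mul_one_div]
  rw [e, ← ENNReal.mul_rpow_of_nonneg _ _ (by positivity), mul_assoc]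
  gcongr
  rw [mul_comm (volume _)]
  exact volume_le_diam_pow hb hne

end Assembly

/-- **Theorem (Sobolev extension of Lipschitz maps into the Heisenberg group).**
For `m, n ≥ 1` and `1 ≤ p < n+1` there is `C > 0` depending only on `m`, `n`, `p`
such that for every compact `Z ⊂ ℝ^m`, every bounded domain `Ω ⊂ ℝ^m` containing `Z`,
and every `L`-Lipschitz `f : Z → ℍⁿ`, there is `F ∈ W^{1,p}(Ω,ℍⁿ)` extending `f`
with `‖∂F_j/∂x_k‖_{L^p(Ω)} ≤ C L (diam Ω)^{m/p}` for `j = 1,…,2n` and all `k`. -/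
theorem sobolev_extension_into_heisenberg
    (m n : ℕ) (hm : 1 ≤ m) (hn : 1 ≤ n) (p : ℝ) (hp1 : 1 ≤ p) (hp2 : p < n + 1) :
    ∃ C : ℝ, 0 < C ∧
      ∀ Z Ω : Set (Euc m), IsCompact Z → IsOpen Ω → IsConnected Ω →
        Bornology.IsBounded Ω → Z ⊆ Ω →
        ∀ L : ℝ, 0 ≤ L → ∀ f : Euc m → Euc (2*n+1), LipschitzOnCC m n L Z f →
          ∃ (F : Euc m → Euc (2*n+1)) (v : Fin (2*n+1) → Fin m → Euc m → ℝ),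
            MemW1pHeisWith m n p Ω F v ∧
            (∀ x ∈ Z, F x = f x) ∧
            ∀ i : Fin (2*n+1), (i : ℕ) < 2*n → ∀ k : Fin m,
              eLpNorm (v i k) (ENNReal.ofReal p) (volume.restrict Ω) ≤
                ENNReal.ofReal (C * L * (Metric.diam Ω) ^ ((m : ℝ) / p)) := by
  have hp0 : 0 < p := by linarith
  have hpk : p < ((n + 1 : ℕ) : ℝ) := by push_cast; exact hp2
  have hn0 : (0 : ℝ) < n := by exact_mod_cast hn
  set M := Fintype.card (ZMod 3 × (Fin m → ZMod 6))
  set K : ℝ := 2 + 2 * m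
  have hK : 0 ≤ K := by positivity
  set c : ℝ := (lipschitzExtensionConstant (Euc n) : ℝ)
  have hc : 0 ≤ c := NNReal.coe_nonneg _
  set E : ℝ := Whitney.vertConst K M n
  have hE : 0 ≤ E := Whitney.vertConst_nonneg hK _ _
  have hcX := Frame.cX_nonneg M hK hc
  have hcP := Frame.cP_nonneg M n hK hc hE
  set S := Whitney.indexConst M (n + 1) p
  set A := (S * volume (ball (0 : Euc m) 1)) ^ (1 / p)
  have hA : A < ⊤ := ENNReal.rpow_lt_top_of_nonneg (by positivity)
    (ENNReal.mul_lt_top (Whitney.indexConst_lt_top M hp0 hpk) measure_ball_lt_top).ne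
  set B := max (Frame.cX M K c) (Frame.cP M K c E n)
  have hB : 0 ≤ B := hcX.trans (le_max_left _ _)
  refine ⟨n * B * A.toReal + 1, by positivity, ?_⟩
  intro Z Ω hZ hΩ hconn hb hZΩ L hL f hf
  have hd0 : 0 ≤ diam Ω := diam_nonneg
  have const : ∀ q : Euc (2 * n + 1), (∀ z ∈ Z, f z = q) →
      ∃ (F : Euc m → Euc (2*n+1)) (v : Fin (2*n+1) → Fin m → Euc m → ℝ),
        MemW1pHeisWith m n p Ω F v ∧ (∀ x ∈ Z, F x = f x) ∧
        ∀ i : Fin (2*n+1), (i : ℕ) < 2*n → ∀ k : Fin m,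
          eLpNorm (v i k) (ENNReal.ofReal p) (volume.restrict Ω) ≤
            ENNReal.ofReal ((n * B * A.toReal + 1) * L * (Metric.diam Ω) ^ ((m : ℝ) / p)) := by
    intro q hq
    refine ⟨fun _ => q, fun _ _ _ => 0, ⟨fun i => memW1pWith_const hΩ hb _, ?_⟩,
      fun x hx => (hq x hx).symm, fun i _ k => by simp⟩
    exact Filter.Eventually.of_forall fun x k => by simp
  rcases Z.eq_empty_or_nonempty with rfl | hne
  · exact const 0 fun z hz => hz.elim
  rcases hL.eq_or_lt with rfl | hL
  · obtain ⟨z₀, hz₀⟩ := hne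
    exact const (f z₀) fun z hz => eq_of_lipschitzOnCC_zero hn hf hz₀ hz
  have hs : 0 < n * L := by positivity
  set s := n * L
  obtain ⟨W⟩ := exists_whitney m hm hZ hne
  obtain ⟨h1, h2, h3⟩ := jet_of_lipschitzOnCC hn hL hf
    (X := fun z => WithLp.toLp 2 fun j => f z (xIdx n j) / s)
    (P := fun z => WithLp.toLp 2 fun j => f z (yIdx n j) / s)
    (U := fun z => (f z (tIdx n) / s ^ 2 +
      2 * ∑ j, f z (xIdx n j) / s * (f z (yIdx n j) / s)) / 4)
    (fun z j => mul_div_cancel₀ _ hs.ne') (fun z j => mul_div_cancel₀ _ hs.ne')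
    (fun z => by
      change s ^ 2 * _ = _
      rw [mul_div_cancel₀ _ four_ne_zero, add_sub_cancel_right, mul_div_cancel₀ _ (by positivity)])
  obtain ⟨Φ, hΦ⟩ := exists_frame W hK hZ hn h1 h2 h3
  obtain ⟨X, P, T, vX, vP, vT, mX, mP, mT, hcon, hval, nX, nP⟩ :=
    Φ.exists_sobolev hK hc hE hZ.isClosed hne hΩ hb hp1 hp2
  have bound : ∀ (a : ℝ) (u : Euc m → ℝ), a ≤ B →
      eLpNorm u (ENNReal.ofReal p) (volume.restrict Ω) ≤
        ENNReal.ofReal a * (S * volume Ω) ^ (1 / p) →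
      eLpNorm (fun x => s * u x) (ENNReal.ofReal p) (volume.restrict Ω) ≤
        ENNReal.ofReal ((n * B * A.toReal + 1) * L * (Metric.diam Ω) ^ ((m : ℝ) / p)) := by
    intro a u ha hu
    have e1 := eLpNorm_const_smul s u (ENNReal.ofReal p) (volume.restrict Ω)
    change eLpNorm (fun x => s * u x) _ _ = _ at e1
    rw [e1, Real.enorm_of_nonneg hs.le]
    calc ENNReal.ofReal s * eLpNorm u (ENNReal.ofReal p) (volume.restrict Ω)
        ≤ ENNReal.ofReal s * (ENNReal.ofReal B *
          (ENNReal.ofReal A.toReal * ENNReal.ofReal (diam Ω ^ ((m : ℝ) / p)))) := by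
          rw [ENNReal.ofReal_toReal hA.ne]
          gcongr
          refine hu.trans ?_
          gcongr
          exact mul_volume_rpow_le hb hconn.nonempty S hp0
      _ = ENNReal.ofReal (n * B * A.toReal * L * (diam Ω) ^ ((m : ℝ) / p)) := by
          rw [← ENNReal.ofReal_mul ENNReal.toReal_nonneg, ← ENNReal.ofReal_mul hB,
            ← ENNReal.ofReal_mul hs.le]
          congr 1
          ring
      _ ≤ _ := by
          refine ENNReal.ofReal_le_ofReal ?_
          gcongr
          linarith
  refine ⟨fun x => WithLp.toLp 2 (heisVec (fun j => s * X j x) (fun j => s * P j x) (s ^ 2 * T x)),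
    heisVec (fun j k x => s * vX j k x) (fun j k x => s * vP j k x) (fun k x => s ^ 2 * vT k x),
    ⟨fun i => ?_, ?_⟩, fun z hz => ?_, fun i hi k => ?_⟩
  · obtain ⟨j, rfl⟩ | ⟨j, rfl⟩ | rfl := eq_xIdx_or_yIdx_or_tIdx i
    · simp only [heisVec_xIdx]; exact (mX j).const_mul s
    · simp only [heisVec_yIdx]; exact (mP j).const_mul s
    · simp only [heisVec_tIdx]; exact mT.const_mul (s ^ 2)
  · filter_upwards [hcon] with x hx k
    simp only [heisVec_xIdx, heisVec_yIdx, heisVec_tIdx, hx k, Finset.mul_sum]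
    refine Finset.sum_congr rfl fun j _ => ?_
    ring
  · obtain ⟨a1, a2, a3⟩ := hval z hz
    obtain ⟨c1, c2, c3⟩ := hΦ z hz
    ext i
    obtain ⟨j, rfl⟩ | ⟨j, rfl⟩ | rfl := eq_xIdx_or_yIdx_or_tIdx i
    · simp only [heisVec_xIdx, a1, c1]
      exact mul_div_cancel₀ _ hs.ne'
    · simp only [heisVec_yIdx, a2, c2]
      exact mul_div_cancel₀ _ hs.ne'
    · simp only [heisVec_tIdx, a3, c1, c2, c3]
      rw [mul_div_cancel₀ _ four_ne_zero, add_sub_cancel_right, mul_div_cancel₀ _ (by positivity)]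
  · obtain ⟨j, rfl⟩ | ⟨j, rfl⟩ | rfl := eq_xIdx_or_yIdx_or_tIdx i
    · rw [heisVec_xIdx]; exact bound _ _ (le_max_left _ _) (nX j k)
    · rw [heisVec_yIdx]; exact bound _ _ (le_max_right _ _) (nP j k)
    · simp [tIdx] at hi

end
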